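/- Let p be a positive integer such that the free Burnside group B(2,p) is not amenable (for instance, by Adyan's theorem, any odd p ≥ 665). Then for every integer n ≥ 2, the free Burnside group B(2,np) is not unitarizable. -/

import Mathlib

/-- A discrete group `G` is amenable: there exists a left-invariant mean on the
bounded real-valued functions on `G`. -/
def IsAmenable (G : Type*) [Group G] : Prop :=
  ∃ m : (G → ℝ) → ℝ,
    (∀ f₁ f₂ : G → ℝ, (∃ C, ∀ x, |f₁ x| ≤ C) → (∃ C, ∀ x, |f₂ x| ≤ C) →
      m (f₁ + f₂) = m f₁ + m f₂) ∧
    (∀ (c : ℝ) (f : G → ℝ), (∃ C, ∀ x, |f x| ≤ C) → m (c • f) = c * m f) ∧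
    (∀ f : G → ℝ, (∃ C, ∀ x, |f x| ≤ C) → (∀ x, 0 ≤ f x) → 0 ≤ m f) ∧
    m 1 = 1 ∧
    (∀ (g : G) (f : G → ℝ), (∃ C, ∀ x, |f x| ≤ C) → m (fun t => f (g⁻¹ * t)) = m f)

/-- A discrete group `G` is unitarizable if every uniformly bounded representation of `G`
on every complex Hilbert space is unitarizable. -/
def IsUnitarizableGroup (G : Type*) [Group G] : Prop :=
  ∀ (H : Type) [NormedAddCommGroup H] [InnerProductSpace ℂ H] [CompleteSpace H]
    (π : G →* (H →L[ℂ] H)ˣ),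
    (∃ C : ℝ, ∀ g : G, ‖(π g : H →L[ℂ] H)‖ ≤ C) →
    ∃ S : (H →L[ℂ] H)ˣ, ∀ g : G,
      ((S⁻¹ * π g * S : (H →L[ℂ] H)ˣ) : H →L[ℂ] H) ∈ unitary (H →L[ℂ] H)

/-- The free Burnside group `B(m,k)`: the quotient of the free group on `m` generators
by the normal closure of all `k`-th powers. -/
abbrev Burnside (m k : ℕ) : Type :=
  FreeGroup (Fin m) ⧸
    Subgroup.normalClosure {w : FreeGroup (Fin m) | ∃ v : FreeGroup (Fin m), w = v ^ k}

open MeasureTheory Filter Topology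
open scoped ENNReal NNReal InnerProductSpace

section DirectSum

variable {𝕜 ι : Type*} [RCLike 𝕜] {E : ι → Type*} [∀ i, NormedAddCommGroup (E i)]
  [∀ i, InnerProductSpace 𝕜 (E i)]

theorem memℓp_two_iff {f : ∀ i, E i} : Memℓp f 2 ↔ Summable fun i => ‖f i‖ ^ 2 := by
  rw [memℓp_gen_iff (by norm_num)]
  simp

theorem lp_two_norm_sq (f : lp E 2) : ‖f‖ ^ 2 = ∑' i, ‖f i‖ ^ 2 := by
  have := lp.norm_rpow_eq_tsum (p := 2) (by norm_num) f
  simpa using this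

theorem lp_two_summable (f : lp E 2) : Summable fun i => ‖f i‖ ^ 2 :=
  memℓp_two_iff.1 (lp.memℓp f)

theorem memℓp_two_of_le {f : ∀ i, E i} (g : lp E 2) {C : ℝ}
    (h : ∀ i, ‖f i‖ ≤ C * ‖g i‖) : Memℓp f 2 := by
  rw [memℓp_two_iff]
  refine Summable.of_nonneg_of_le (fun i => by positivity) (fun i => ?_)
    ((lp_two_summable g).mul_left (C ^ 2))
  rw [← mul_pow]
  exact pow_le_pow_left₀ (norm_nonneg _) (h i) 2

theorem lp_two_norm_le_of_le (f g : lp E 2) {C : ℝ} (hC : 0 ≤ C)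
    (h : ∀ i, ‖f i‖ ≤ C * ‖g i‖) : ‖f‖ ≤ C * ‖g‖ := by
  refine le_of_sq_le_sq ?_ (by positivity)
  rw [mul_pow, lp_two_norm_sq, lp_two_norm_sq, ← tsum_mul_left]
  refine Summable.tsum_le_tsum (fun i => ?_) (lp_two_summable f)
    ((lp_two_summable g).mul_left (C ^ 2))
  rw [← mul_pow]
  exact pow_le_pow_left₀ (norm_nonneg _) (h i) 2

/-- The direct sum of a uniformly bounded family of operators. -/
noncomputable def lpDirectSum (A : ∀ i, E i →L[𝕜] E i) (C : ℝ) (hA : ∀ i, ‖A i‖ ≤ C) :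
    lp E 2 →L[𝕜] lp E 2 :=
  LinearMap.mkContinuous
    { toFun := fun f => ⟨fun i => A i (f i), memℓp_two_of_le f
        (fun i => (A i).le_of_opNorm_le (hA i) _)⟩
      map_add' := fun f g => by
        ext i
        exact (A i).map_add _ _
      map_smul' := fun c f => by
        ext i
        exact (A i).map_smul _ _ }
    (max C 0) (fun f => lp_two_norm_le_of_le _ _ (le_max_right _ _) (fun i =>
      (A i).le_of_opNorm_le ((hA i).trans (le_max_left _ _)) _))

@[simp]
theorem lpDirectSum_apply (A : ∀ i, E i →L[𝕜] E i) (C : ℝ) (hA : ∀ i, ‖A i‖ ≤ C)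
    (f : lp E 2) (i : ι) : lpDirectSum A C hA f i = A i (f i) := rfl

theorem norm_lpDirectSum_le (A : ∀ i, E i →L[𝕜] E i) (C : ℝ) (hA : ∀ i, ‖A i‖ ≤ C) :
    ‖lpDirectSum A C hA‖ ≤ max C 0 :=
  LinearMap.mkContinuous_norm_le _ (le_max_right _ _) _

end DirectSum

section Gap

variable {G : Type*} [Group G]

/-- Right translation on `ℓ²(G)`. -/
noncomputable def rightShift (t : G) : lp (fun _ : G => ℝ) 2 →ₗᵢ[ℝ] lp (fun _ : G => ℝ) 2 where
  toFun f := ⟨fun g => f (g * t), memℓp_two_iff.2 (by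
    have h := (Equiv.mulRight t).summable_iff.2 (lp_two_summable f)
    exact h)⟩
  map_add' _ _ := rfl
  map_smul' _ _ := rfl
  norm_map' f := by
    refine (sq_eq_sq₀ (norm_nonneg _) (norm_nonneg _)).1 ?_
    rw [lp_two_norm_sq, lp_two_norm_sq]
    change ∑' g : G, ‖f (g * t)‖ ^ 2 = ∑' g : G, ‖f g‖ ^ 2
    exact (Equiv.mulRight t).tsum_eq (fun g => ‖f g‖ ^ 2)

@[simp]
theorem rightShift_apply (t : G) (f : lp (fun _ : G => ℝ) 2) (g : G) :
    rightShift t f g = f (g * t) := rfl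

theorem rightShift_mul (s t : G) (f : lp (fun _ : G => ℝ) 2) :
    rightShift (s * t) f = rightShift s (rightShift t f) := by
  ext g
  simp [mul_assoc]

theorem rightShift_one (f : lp (fun _ : G => ℝ) 2) : rightShift (1 : G) f = f := by
  ext g
  simp

theorem isAmenable_of_almost_invariant (ξ : ℕ → lp (fun _ : G => ℝ) 2) (h1 : ∀ i, ‖ξ i‖ = 1)
    (h : ∀ t : G, Tendsto (fun i => ‖rightShift t (ξ i) - ξ i‖) atTop (𝓝 0)) :
    IsAmenable G := by
  classical
  let U : Ultrafilter ℕ := hyperfilter ℕ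
  have hU : (U : Filter ℕ) ≤ atTop := Nat.hyperfilter_le_atTop
  let q : (G → ℝ) → lp (fun _ : G => ℝ) 2 → ℝ := fun f η => ∑' g, f g⁻¹ * (η g) ^ 2
  have hsq : ∀ η : lp (fun _ : G => ℝ) 2, Summable fun g => (η g) ^ 2 := fun η => by
    simpa using lp_two_summable η
  have hnsq : ∀ η : lp (fun _ : G => ℝ) 2, ∑' g, (η g) ^ 2 = ‖η‖ ^ 2 := fun η => by
    simp [lp_two_norm_sq]
  have hqs : ∀ (f : G → ℝ) (C : ℝ), (∀ x, |f x| ≤ C) → ∀ η : lp (fun _ : G => ℝ) 2,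
      Summable fun g => f g⁻¹ * (η g) ^ 2 := by
    intro f C hf η
    refine Summable.of_norm_bounded ((hsq η).mul_left C) (fun g => ?_)
    rw [norm_mul, Real.norm_eq_abs, Real.norm_of_nonneg (sq_nonneg _)]
    exact mul_le_mul_of_nonneg_right (hf _) (sq_nonneg _)
  have hqb : ∀ (f : G → ℝ) (C : ℝ), (∀ x, |f x| ≤ C) → ∀ i, q f (ξ i) ∈ Set.Icc (-C) C := by
    intro f C hf i
    have e1 : ∑' g, C * (ξ i g) ^ 2 = C := by rw [tsum_mul_left, hnsq, h1]; simp
    have e2 : ∑' g, (-C) * (ξ i g) ^ 2 = -C := by rw [tsum_mul_left, hnsq, h1]; simp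
    constructor
    · refine e2.symm.le.trans ?_
      refine Summable.tsum_le_tsum (fun g => ?_) ((hsq _).mul_left _) (hqs f C hf _)
      exact mul_le_mul_of_nonneg_right (abs_le.1 (hf _)).1 (sq_nonneg _)
    · refine le_trans ?_ e1.le
      refine Summable.tsum_le_tsum (fun g => ?_) (hqs f C hf _) ((hsq _).mul_left _)
      exact mul_le_mul_of_nonneg_right (abs_le.1 (hf _)).2 (sq_nonneg _)
  let m : (G → ℝ) → ℝ := fun f => limUnder (U : Filter ℕ) (fun i => q f (ξ i))
  have hm : ∀ (f : G → ℝ), (∃ C, ∀ x, |f x| ≤ C) →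
      Tendsto (fun i => q f (ξ i)) U (𝓝 (m f)) := by
    rintro f ⟨C, hf⟩
    obtain ⟨x, -, hx⟩ := (isCompact_Icc (a := -C) (b := C)).ultrafilter_le_nhds
      (U.map fun i => q f (ξ i)) (by
        rw [le_principal_iff]
        exact Filter.mem_map.2 (Filter.univ_mem' (hqb f C hf)))
    exact tendsto_nhds_limUnder ⟨x, hx⟩
  refine ⟨m, ?_, ?_, ?_, ?_, ?_⟩
  · rintro f₁ f₂ ⟨C₁, h₁⟩ ⟨C₂, h₂⟩
    refine tendsto_nhds_unique (hm (f₁ + f₂) ⟨C₁ + C₂, fun x =>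
      (abs_add_le _ _).trans (add_le_add (h₁ x) (h₂ x))⟩) ?_
    refine ((hm f₁ ⟨C₁, h₁⟩).add (hm f₂ ⟨C₂, h₂⟩)).congr (fun i => ?_)
    simp only [q]
    rw [← (hqs f₁ C₁ h₁ _).tsum_add (hqs f₂ C₂ h₂ _)]
    simp [add_mul]
  · rintro c f ⟨C, hf⟩
    refine tendsto_nhds_unique (hm (c • f) ⟨|c| * C, fun x => ?_⟩) ?_
    · rw [Pi.smul_apply, smul_eq_mul, abs_mul]
      exact mul_le_mul_of_nonneg_left (hf x) (abs_nonneg _)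
    · refine ((hm f ⟨C, hf⟩).const_mul c).congr (fun i => ?_)
      simp only [q]
      rw [← tsum_mul_left]
      simp [mul_assoc]
  · intro f hb hf
    refine ge_of_tendsto' (hm f hb) (fun i => tsum_nonneg fun g => ?_)
    exact mul_nonneg (hf _) (sq_nonneg _)
  · refine tendsto_nhds_unique (hm 1 ⟨1, by simp⟩) ?_
    refine tendsto_const_nhds.congr (fun i => ?_)
    simp [q, hnsq, h1]
  · rintro x f ⟨C, hf⟩
    refine tendsto_nhds_unique (hm (fun t => f (x⁻¹ * t)) ⟨C, fun t => hf _⟩) ?_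
    have hC : 0 ≤ C := (abs_nonneg _).trans (hf 1)
    have key : ∀ i, |q (fun t => f (x⁻¹ * t)) (ξ i) - q f (ξ i)|
        ≤ 2 * C * ‖rightShift x⁻¹ (ξ i) - ξ i‖ := by
      intro i
      let η := rightShift x⁻¹ (ξ i)
      have e1 : q (fun t => f (x⁻¹ * t)) (ξ i) = q f η := by
        simp only [q]
        rw [← (Equiv.mulRight x⁻¹).tsum_eq]
        simp [η]
      let A : lp (fun _ : G => ℝ) 2 →L[ℝ] lp (fun _ : G => ℝ) 2 :=
        lpDirectSum (fun g => f g⁻¹ • ContinuousLinearMap.id ℝ ℝ) C (fun g => by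
          refine (norm_smul_le (f g⁻¹) (ContinuousLinearMap.id ℝ ℝ)).trans ?_
          simpa using hf g⁻¹)
      have hA : ‖A‖ ≤ C := (norm_lpDirectSum_le _ _ _).trans (max_le le_rfl hC)
      have e2 : q f η - q f (ξ i) = ⟪A (η - ξ i), η + ξ i⟫_ℝ := by
        rw [lp.inner_eq_tsum]
        simp only [q]
        rw [← (hqs f C hf _).tsum_sub (hqs f C hf _)]
        refine tsum_congr fun g => ?_
        simp [A]
        ring
      rw [e1, e2]
      refine (abs_real_inner_le_norm _ _).trans ?_
      have e3 : ‖η + ξ i‖ ≤ 2 := by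
        refine (norm_add_le _ _).trans ?_
        rw [(rightShift x⁻¹).norm_map, h1]
        norm_num
      calc ‖A (η - ξ i)‖ * ‖η + ξ i‖ ≤ (C * ‖η - ξ i‖) * 2 :=
            mul_le_mul (A.le_of_opNorm_le hA _) e3 (norm_nonneg _) (by positivity)
        _ = 2 * C * ‖η - ξ i‖ := by ring
    have h0 : Tendsto (fun i => q (fun t => f (x⁻¹ * t)) (ξ i) - q f (ξ i)) U (𝓝 0) := by
      refine squeeze_zero_norm key ?_
      simpa using ((h x⁻¹).mono_left hU).const_mul (2 * C)
    simpa using h0.add (hm f ⟨C, hf⟩)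

theorem exists_norm_sum_rightShift_le (hG : ¬ IsAmenable G) (T : Finset G) (h1 : (1 : G) ∈ T)
    (hT : Subgroup.closure (T : Set G) = ⊤) :
    ∃ ρ : ℝ, 0 < ρ ∧ ρ < 1 ∧ ∀ ξ : lp (fun _ : G => ℝ) 2,
      ‖∑ t ∈ T, rightShift t ξ‖ ≤ ρ * T.card * ‖ξ‖ := by
  classical
  by_contra! hcon
  refine hG ?_
  have hex : ∀ i : ℕ, ∃ ξ : lp (fun _ : G => ℝ) 2, ‖ξ‖ = 1 ∧
      (1 - 1 / ((i : ℝ) + 2)) * T.card < ‖∑ t ∈ T, rightShift t ξ‖ := by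
    intro i
    have hi : 1 / ((i : ℝ) + 2) < 1 := by
      rw [div_lt_one (by positivity)]
      linarith [(Nat.cast_nonneg i : (0 : ℝ) ≤ i)]
    obtain ⟨ξ, hξ⟩ := hcon (1 - 1 / ((i : ℝ) + 2)) (by linarith)
      (by linarith [show (0 : ℝ) < 1 / ((i : ℝ) + 2) by positivity])
    have hn : ξ ≠ 0 := by
      rintro rfl
      simp at hξ
    have hp : 0 < ‖ξ‖ := norm_pos_iff.2 hn
    refine ⟨‖ξ‖⁻¹ • ξ, by rw [norm_smul]; simp [hp.ne'], ?_⟩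
    simp only [map_smul]
    rw [← Finset.smul_sum, norm_smul, norm_inv, norm_norm, lt_inv_mul_iff₀ hp]
    linarith
  choose ξ hξ1 hξ using hex
  let K : Subgroup G :=
    { carrier := {t | Tendsto (fun i => ‖rightShift t (ξ i) - ξ i‖) atTop (𝓝 0)}
      mul_mem' := by
        intro a b ha hb
        have := Tendsto.add hb ha
        rw [add_zero] at this
        refine squeeze_zero (fun _ => norm_nonneg _) (fun i => ?_) this
        have e : rightShift (a * b) (ξ i) - ξ i
            = rightShift a (rightShift b (ξ i) - ξ i) + (rightShift a (ξ i) - ξ i) := by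
          rw [rightShift_mul, map_sub]
          abel
        rw [e]
        refine (norm_add_le _ _).trans ?_
        rw [(rightShift a).norm_map]
      one_mem' := by simp [rightShift_one]
      inv_mem' := by
        intro a ha
        refine Tendsto.congr (fun i => ?_) ha
        rw [← (rightShift a⁻¹).norm_map, map_sub, ← rightShift_mul, inv_mul_cancel,
          rightShift_one, norm_sub_rev] }
  refine isAmenable_of_almost_invariant ξ hξ1 ?_
  suffices hK : K = ⊤ from fun t => (hK ▸ Subgroup.mem_top t : t ∈ K)
  rw [eq_top_iff, ← hT, Subgroup.closure_le]
  intro t ht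
  change Tendsto (fun i => ‖rightShift t (ξ i) - ξ i‖) atTop (𝓝 0)
  rcases eq_or_ne t 1 with rfl | ht1
  · simp [rightShift_one]
  have hlow : ∀ i : ℕ, 2 - T.card * (1 / ((i : ℝ) + 2)) ≤ ‖rightShift t (ξ i) + ξ i‖ := by
    intro i
    have e1 : ∑ s ∈ T, rightShift s (ξ i)
        = (rightShift t (ξ i) + ξ i) + ∑ s ∈ (T.erase 1).erase t, rightShift s (ξ i) := by
      rw [← Finset.add_sum_erase T _ h1, ← Finset.add_sum_erase (T.erase 1) _
        (Finset.mem_erase.2 ⟨ht1, ht⟩), rightShift_one]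
      abel
    have e2 : ‖∑ s ∈ (T.erase 1).erase t, rightShift s (ξ i)‖ ≤ T.card - 2 := by
      refine (norm_sum_le _ _).trans ?_
      simp only [(rightShift _).norm_map, hξ1]
      rw [Finset.sum_const, Finset.card_erase_of_mem (Finset.mem_erase.2 ⟨ht1, ht⟩),
        Finset.card_erase_of_mem h1, nsmul_eq_mul, mul_one]
      have : 2 ≤ T.card := by
        have := Finset.card_le_card (show ({1, t} : Finset G) ⊆ T by
          intro x hx; simp at hx; rcases hx with rfl | rfl <;> assumption)
        rwa [Finset.card_pair ht1.symm] at this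
      rw [Nat.sub_sub, Nat.cast_sub this]
      norm_num
    have e3 := hξ i
    rw [e1] at e3
    have e4 := norm_add_le (rightShift t (ξ i) + ξ i)
      (∑ s ∈ (T.erase 1).erase t, rightShift s (ξ i))
    linarith
  have hsq : ∀ i : ℕ, ‖rightShift t (ξ i) - ξ i‖ ^ 2 ≤ 4 * (T.card * (1 / ((i : ℝ) + 2))) := by
    intro i
    have hp := parallelogram_law_with_norm ℝ (rightShift t (ξ i)) (ξ i)
    rw [(rightShift t).norm_map, hξ1] at hp
    have h0 := norm_nonneg (rightShift t (ξ i) + ξ i)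
    have h3 : ‖rightShift t (ξ i) + ξ i‖ ≤ 2 := by
      refine (norm_add_le _ _).trans ?_
      rw [(rightShift t).norm_map, hξ1]; norm_num
    nlinarith [hlow i]
  have hlim : Tendsto (fun i : ℕ => 4 * (T.card * (1 / ((i : ℝ) + 2)))) atTop (𝓝 0) := by
    have : Tendsto (fun i : ℕ => 1 / ((i : ℝ) + 2)) atTop (𝓝 0) := by
      simp only [one_div]
      exact tendsto_inv_atTop_zero.comp
        (tendsto_atTop_add_const_right _ _ tendsto_natCast_atTop_atTop)
    simpa using (this.const_mul (T.card : ℝ)).const_mul 4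
  have h2 : Tendsto (fun i => ‖rightShift t (ξ i) - ξ i‖ ^ 2) atTop (𝓝 0) :=
    squeeze_zero (fun _ => by positivity) hsq hlim
  simpa using h2.sqrt

end Gap

section SmallNorm

variable {G : Type*} [Group G]

/-- Right translation as a homomorphism to bounded operators. -/
noncomputable def rightShiftHom (G : Type*) [Group G] :
    G →* (lp (fun _ : G => ℝ) 2 →L[ℝ] lp (fun _ : G => ℝ) 2) where
  toFun t := (rightShift t).toContinuousLinearMap
  map_one' := by
    ext1 f
    exact rightShift_one f
  map_mul' s t := by
    ext1 f
    exact rightShift_mul s t f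

theorem rightShiftHom_apply (t : G) (f : lp (fun _ : G => ℝ) 2) :
    rightShiftHom G t f = rightShift t f := rfl

theorem coeff_sum_single_pow_inv (T : Finset G) (hsym : ∀ t ∈ T, t⁻¹ ∈ T) (k : ℕ) (g : G) :
    ((∑ t ∈ T, MonoidAlgebra.single t (1 : ℕ)) ^ k).coeff g⁻¹
      = ((∑ t ∈ T, MonoidAlgebra.single t (1 : ℕ)) ^ k).coeff g := by
  classical
  induction k generalizing g with
  | zero =>
    simp only [pow_zero, MonoidAlgebra.one_def, MonoidAlgebra.coeff_single, Finsupp.single_apply]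
    congr 1
    simp [eq_comm]
  | succ k ih =>
    conv_lhs => rw [pow_succ']
    conv_rhs => rw [pow_succ]
    rw [Finset.sum_mul, Finset.mul_sum]
    simp only [MonoidAlgebra.coeff_sum, Finsupp.finsetSum_apply,
      MonoidAlgebra.coeff_single_mul_apply, MonoidAlgebra.coeff_mul_single_apply, one_mul, mul_one]
    refine Finset.sum_bij' (fun t _ => t⁻¹) (fun t _ => t⁻¹) hsym hsym (by simp) (by simp) ?_
    intro t _
    rw [← ih]
    simp

theorem exists_finset_norm_sum_rightShift_le (T : Finset G) (hT : T.Nonempty)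
    (hsym : ∀ t ∈ T, t⁻¹ ∈ T) {ρ : ℝ}
    (hρ0 : 0 < ρ) (hρ1 : ρ < 1) (hρ : ∀ ξ : lp (fun _ : G => ℝ) 2,
      ‖∑ t ∈ T, rightShift t ξ‖ ≤ ρ * T.card * ‖ξ‖) (δ : ℝ) (hδ : 0 < δ) :
    ∃ S : Finset G, S.Nonempty ∧ (∀ s ∈ S, s⁻¹ ∈ S) ∧ ∀ ξ : lp (fun _ : G => ℝ) 2,
      (∀ g, 0 ≤ ξ g) → ‖∑ s ∈ S, rightShift s ξ‖ ≤ δ * S.card * ‖ξ‖ := by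
  classical
  obtain ⟨k, hk⟩ : ∃ k : ℕ, 2 * ((k * T.card + 1 : ℕ) : ℝ) * ρ ^ k ≤ δ := by
    have h1 := tendsto_self_mul_const_pow_of_lt_one hρ0.le hρ1
    have h2 := tendsto_pow_atTop_nhds_zero_of_lt_one hρ0.le hρ1
    have h3 : Tendsto (fun k : ℕ => 2 * ((k * T.card + 1 : ℕ) : ℝ) * ρ ^ k) atTop (𝓝 0) := by
      have := ((h1.const_mul (2 * (T.card : ℝ))).add (h2.const_mul 2))
      simp only [mul_zero, add_zero] at this
      refine this.congr (fun k => ?_)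
      push_cast
      ring
    exact ((h3.eventually_le_const hδ)).exists
  let q : MonoidAlgebra ℕ G := ∑ t ∈ T, MonoidAlgebra.single t (1 : ℕ)
  let p := q ^ k
  let M : ℕ := T.card ^ k
  have hM : 0 < M := pow_pos hT.card_pos _
  have hsum : ∑ g ∈ p.coeff.support, p.coeff g = M := by
    have h1 : MonoidAlgebra.lift ℕ ℕ G (1 : G →* ℕ) p = M := by
      simp [p, q, M]
    rw [MonoidAlgebra.lift_apply] at h1
    simpa [Finsupp.sum] using h1
  have hop : ∀ ξ : lp (fun _ : G => ℝ) 2,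
      ‖∑ g ∈ p.coeff.support, (p.coeff g : ℝ) • rightShift g ξ‖ ≤ ρ ^ k * M * ‖ξ‖ := by
    intro ξ
    let L := MonoidAlgebra.lift ℕ (lp (fun _ : G => ℝ) 2 →L[ℝ] lp (fun _ : G => ℝ) 2) G
      (rightShiftHom G)
    have h1 : L p ξ = ∑ g ∈ p.coeff.support, (p.coeff g : ℝ) • rightShift g ξ := by
      simp only [L]
      rw [MonoidAlgebra.lift_apply, Finsupp.sum, sum_apply]
      refine Finset.sum_congr rfl (fun g _ => ?_)
      rw [Nat.cast_smul_eq_nsmul]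
      rfl
    have h2 : ‖L q‖ ≤ ρ * T.card := by
      refine ContinuousLinearMap.opNorm_le_bound _ (by positivity) (fun η => ?_)
      have : L q η = ∑ t ∈ T, rightShift t η := by
        simp [L, q, map_sum, rightShiftHom_apply]
      rw [this]
      exact hρ η
    rw [← h1]
    have h3 : ‖L p‖ ≤ (ρ * T.card) ^ k := by
      simp only [p, map_pow]
      rcases Nat.eq_zero_or_pos k with rfl | hk
      · rw [pow_zero, pow_zero]
        exact ContinuousLinearMap.norm_id_le
      · exact (norm_pow_le' _ hk).trans (pow_le_pow_left₀ (norm_nonneg _) h2 _)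
    refine ((L p).le_of_opNorm_le h3 ξ).trans (le_of_eq ?_)
    simp [M, mul_pow]
  let J := k * T.card + 1
  have hJ : (0 : ℝ) < J := by positivity
  have hmaps : ∀ g ∈ p.coeff.support, Nat.log 2 (p.coeff g) ∈ Finset.range J := by
    intro g hg
    rw [Finset.mem_range, Nat.lt_succ_iff]
    have h1 : p.coeff g ≤ M := hsum ▸ Finset.single_le_sum (fun _ _ => Nat.zero_le _) hg
    have h2 : M ≤ 2 ^ (k * T.card) := by
      rw [mul_comm, pow_mul]
      exact Nat.pow_le_pow_left Nat.lt_two_pow_self.le _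
    calc Nat.log 2 (p.coeff g) ≤ Nat.log 2 (2 ^ (k * T.card)) := Nat.log_mono_right (h1.trans h2)
      _ = _ := Nat.log_pow (by norm_num) _
  obtain ⟨i, -, hi⟩ := Finset.exists_le_sum_fiber_of_maps_to_of_nsmul_le_sum
    (w := fun g => (p.coeff g : ℝ)) (b := (M : ℝ) / J) hmaps ⟨0, by simp [J]⟩ (by
      rw [Finset.card_range, nsmul_eq_mul, mul_div_cancel₀ _ hJ.ne']
      exact_mod_cast hsum.ge)
  set S := p.coeff.support.filter (fun g => Nat.log 2 (p.coeff g) = i) with hS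
  have hlow : ∀ g ∈ S, (2 : ℝ) ^ i ≤ p.coeff g := by
    intro g hg
    obtain ⟨h1, rfl⟩ := Finset.mem_filter.1 hg
    exact_mod_cast Nat.pow_log_le_self 2 (Finsupp.mem_support_iff.1 h1)
  have hup : ∑ g ∈ S, (p.coeff g : ℝ) ≤ S.card * 2 ^ (i + 1) := by
    rw [← nsmul_eq_mul]
    refine Finset.sum_le_card_nsmul _ _ _ (fun g hg => ?_)
    obtain ⟨h1, rfl⟩ := Finset.mem_filter.1 hg
    exact_mod_cast (Nat.lt_pow_succ_log_self (by norm_num) _).le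
  have hMS : (M : ℝ) ≤ J * (S.card * 2 ^ (i + 1)) := by
    have := hi.trans hup
    rwa [div_le_iff₀' hJ] at this
  refine ⟨S, ?_, ?_, ?_⟩
  · rw [Finset.nonempty_iff_ne_empty]
    intro h
    rw [h] at hMS
    simp at hMS
    omega
  · intro s hs
    rw [hS, Finset.mem_filter, Finsupp.mem_support_iff] at hs ⊢
    rwa [show p.coeff s⁻¹ = p.coeff s from coeff_sum_single_pow_inv T hsym k s]
  · intro ξ hξ
    have h1 : ‖∑ s ∈ S, rightShift s ξ‖ ≤
        (2 ^ i : ℝ)⁻¹ * ‖∑ g ∈ p.coeff.support, (p.coeff g : ℝ) • rightShift g ξ‖ := by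
      refine lp_two_norm_le_of_le _ _ (by positivity) (fun g => ?_)
      rw [lp.coeFn_sum, lp.coeFn_sum, Finset.sum_apply, Finset.sum_apply]
      simp only [lp.coeFn_smul, Pi.smul_apply, rightShift_apply, smul_eq_mul]
      rw [Real.norm_of_nonneg (Finset.sum_nonneg fun _ _ => hξ _),
        Real.norm_of_nonneg (Finset.sum_nonneg fun _ _ => mul_nonneg (Nat.cast_nonneg _) (hξ _)),
        inv_mul_eq_div, le_div_iff₀ (by positivity), Finset.sum_mul]
      refine le_trans (Finset.sum_le_sum fun s hs => ?_)
        (Finset.sum_le_sum_of_subset_of_nonneg (Finset.filter_subset _ _)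
          (fun _ _ _ => mul_nonneg (Nat.cast_nonneg _) (hξ _)))
      rw [mul_comm]
      exact mul_le_mul_of_nonneg_right (hlow s hs) (hξ _)
    calc ‖∑ s ∈ S, rightShift s ξ‖ ≤ (2 ^ i : ℝ)⁻¹ * (ρ ^ k * M * ‖ξ‖) :=
          h1.trans (mul_le_mul_of_nonneg_left (hop ξ) (by positivity))
      _ ≤ (2 ^ i : ℝ)⁻¹ * (ρ ^ k * (J * (S.card * 2 ^ (i + 1))) * ‖ξ‖) := by gcongr
      _ = (2 * J * ρ ^ k) * S.card * ‖ξ‖ := by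
          field_simp
          ring
      _ ≤ δ * S.card * ‖ξ‖ := by gcongr

end SmallNorm

section PathCount

variable {G : Type*} [Group G]

open Classical in
/-- The number of `k`-tuples `s₁, …, s_k` in `S` with `g s₁ ⋯ s_k ∈ C`. -/
noncomputable def pathCount (S : Finset G) (C : Subgroup G) : ℕ → G → ℕ
  | 0, g => if g ∈ C then 1 else 0
  | k + 1, g => ∑ s ∈ S, pathCount S C k (g * s)

theorem exists_finset_pathCount_le [Group.FG G] (hG : ¬ IsAmenable G) (C : Subgroup G) [Finite C]
    (δ : ℝ) (hδ : 0 < δ) :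
    ∃ S : Finset G, (∀ s ∈ S, s⁻¹ ∈ S) ∧ (∀ s ∈ S, ∀ a ∈ C, ∀ b ∈ C, a * s * b ∈ S) ∧
      0 < S.card ∧ 1 ≤ δ ^ 2 * S.card ∧
      ∀ m, (pathCount S C (m + 2) 1 : ℝ) ≤ Nat.card C * (δ * S.card) ^ m * S.card := by
  classical
  obtain ⟨T₀, hT₀⟩ := (Group.fg_def.1 ‹Group.FG G›)
  let T : Finset G := insert 1 (T₀ ∪ T₀.image (·⁻¹))
  have hTsym : ∀ t ∈ T, t⁻¹ ∈ T := by
    intro t ht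
    simp only [T, Finset.mem_insert, Finset.mem_union, Finset.mem_image] at ht ⊢
    rcases ht with rfl | ht | ⟨s, hs, rfl⟩
    · simp
    · exact Or.inr (Or.inr ⟨t, ht, rfl⟩)
    · simp [hs]
  have hTgen : Subgroup.closure (T : Set G) = ⊤ := by
    rw [eq_top_iff, ← hT₀]
    refine Subgroup.closure_mono fun x hx => ?_
    simp only [T, Finset.coe_insert, Finset.coe_union]
    exact Or.inr (Or.inl hx)
  have h1T : (1 : G) ∈ T := Finset.mem_insert_self _ _
  obtain ⟨ρ, hρ0, hρ1, hρ⟩ := exists_norm_sum_rightShift_le hG T h1T hTgen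
  let K : Finset G := (Set.toFinite (C : Set G)).toFinset
  have hK : ∀ g, g ∈ K ↔ g ∈ C := fun g => by simp [K]
  have hKc : K.card = Nat.card C := (Nat.card_eq_card_finite_toFinset _).symm
  set c := Nat.card C with hc
  have hc0 : 0 < c := Nat.card_pos
  obtain ⟨S₀, hne, hsym, hS₀⟩ := exists_finset_norm_sum_rightShift_le T ⟨1, h1T⟩ hTsym hρ0 hρ1 hρ
    (δ / c ^ 2) (by positivity)
  let S : Finset G := (K ×ˢ S₀ ×ˢ K).image (fun x => x.1 * x.2.1 * x.2.2)
  have hS : ∀ g, g ∈ S ↔ ∃ a ∈ C, ∃ s ∈ S₀, ∃ b ∈ C, a * s * b = g := by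
    intro g
    simp only [S, Finset.mem_image, Finset.mem_product, Prod.exists, hK]
    constructor
    · rintro ⟨a, s, b, ⟨ha, hs, hb⟩, rfl⟩
      exact ⟨a, ha, s, hs, b, hb, rfl⟩
    · rintro ⟨a, ha, s, hs, b, hb, rfl⟩
      exact ⟨a, s, b, ⟨ha, hs, hb⟩, rfl⟩
  have hS₀S : S₀ ⊆ S := fun s hs => (hS s).2 ⟨1, C.one_mem, s, hs, 1, C.one_mem, by simp⟩
  have hScard : S₀.card ≤ S.card := Finset.card_le_card hS₀S
  have hSinv : ∀ s ∈ S, s⁻¹ ∈ S := by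
    intro s hs
    obtain ⟨a, ha, t, ht, b, hb, rfl⟩ := (hS s).1 hs
    exact (hS _).2 ⟨b⁻¹, C.inv_mem hb, t⁻¹, hsym t ht, a⁻¹, C.inv_mem ha, by simp [mul_assoc]⟩
  have hSC : ∀ s ∈ S, ∀ a ∈ C, ∀ b ∈ C, a * s * b ∈ S := by
    intro s hs a' ha' b' hb'
    obtain ⟨a, ha, t, ht, b, hb, rfl⟩ := (hS s).1 hs
    exact (hS _).2 ⟨a' * a, C.mul_mem ha' ha, t, ht, b * b', C.mul_mem hb hb', by simp [mul_assoc]⟩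
  have hSpos : 0 < S.card := hne.card_pos.trans_le hScard
  have hnormK : ∀ ξ : lp (fun _ : G => ℝ) 2, ‖∑ a ∈ K, rightShift a ξ‖ ≤ c * ‖ξ‖ := by
    intro ξ
    refine (norm_sum_le _ _).trans (le_of_eq ?_)
    simp [hKc]
  have hop : ∀ ξ : lp (fun _ : G => ℝ) 2, (∀ g, 0 ≤ ξ g) →
      ‖∑ s ∈ S, rightShift s ξ‖ ≤ δ * S.card * ‖ξ‖ := by
    intro ξ hξ
    have e1 : ‖∑ s ∈ S, rightShift s ξ‖ ≤
        1 * ‖∑ a ∈ K, rightShift a (∑ s ∈ S₀, rightShift s (∑ b ∈ K, rightShift b ξ))‖ := by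
      refine lp_two_norm_le_of_le _ _ zero_le_one (fun g => ?_)
      have e : (∑ a ∈ K, rightShift a (∑ s ∈ S₀, rightShift s (∑ b ∈ K, rightShift b ξ)))
          = ∑ x ∈ K ×ˢ S₀ ×ˢ K, rightShift (x.1 * x.2.1 * x.2.2) ξ := by
        simp only [Finset.sum_product, map_sum, rightShift_mul]
      rw [e, lp.coeFn_sum, lp.coeFn_sum, Finset.sum_apply, Finset.sum_apply]
      simp only [rightShift_apply]
      rw [Real.norm_of_nonneg (Finset.sum_nonneg fun _ _ => hξ _),
        Real.norm_of_nonneg (Finset.sum_nonneg fun _ _ => hξ _), one_mul]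
      exact Finset.sum_image_le_of_nonneg (f := fun s => ξ (g * s)) (fun _ _ => hξ _)
    have e2 : ∀ g, 0 ≤ (∑ b ∈ K, rightShift b ξ : lp (fun _ : G => ℝ) 2) g := by
      intro g
      rw [lp.coeFn_sum, Finset.sum_apply]
      exact Finset.sum_nonneg fun _ _ => hξ _
    calc _ ≤ c * (δ / c ^ 2 * S₀.card * (c * ‖ξ‖)) := by
          rw [one_mul] at e1
          refine e1.trans ((hnormK _).trans ?_)
          gcongr
          refine (hS₀ _ e2).trans ?_
          gcongr
          exact hnormK ξ
      _ = δ * S₀.card * ‖ξ‖ := by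
          field_simp
      _ ≤ δ * S.card * ‖ξ‖ := by gcongr
  have hsumle : ∀ (f : lp (fun _ : G => ℝ) 2), ∑ s ∈ S, (f s) ^ 2 ≤ ‖f‖ ^ 2 := by
    intro f
    rw [lp_two_norm_sq]
    simpa using (lp_two_summable f).sum_le_tsum S (fun _ _ => by positivity)
  refine ⟨S, hSinv, hSC, hSpos, ?_, ?_⟩
  · let ξ : lp (fun _ : G => ℝ) 2 := lp.single 2 1 1
    have hξ : ∀ g, ξ g = if g = 1 then 1 else 0 := by
      intro g
      rcases eq_or_ne g 1 with rfl | h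
      · simp [ξ]
      · simp [ξ, h]
    have h1 := hop ξ (fun g => by rw [hξ]; split_ifs <;> norm_num)
    have h2 : ‖ξ‖ = 1 := by simp [ξ, lp.norm_single]
    have h3 := hsumle (∑ s ∈ S, rightShift s ξ)
    have h4 : ∀ g ∈ S, (∑ s ∈ S, rightShift s ξ : lp (fun _ : G => ℝ) 2) g = 1 := by
      intro g hg
      rw [lp.coeFn_sum, Finset.sum_apply]
      simp only [rightShift_apply, hξ]
      rw [Finset.sum_eq_single g⁻¹ (fun s _ hs => by
        rw [if_neg]
        intro h
        exact hs (eq_inv_of_mul_eq_one_right h)) (fun h => absurd (hSinv g hg) h)]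
      simp
    rw [Finset.sum_congr rfl (fun g hg => by rw [h4 g hg])] at h3
    simp only [one_pow, Finset.sum_const, nsmul_eq_mul, mul_one] at h3
    rw [h2, mul_one] at h1
    have h5 : (S.card : ℝ) ≤ (δ * S.card) ^ 2 := h3.trans (pow_le_pow_left₀ (norm_nonneg _) h1 2)
    have h6 : (0 : ℝ) < S.card := by exact_mod_cast hSpos
    nlinarith
  · have hu0 : ∃ u : lp (fun _ : G => ℝ) 2, ∀ g, u g = pathCount S C 0 g := by
      refine ⟨∑ a ∈ K, lp.single 2 a 1, fun g => ?_⟩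
      rw [lp.coeFn_sum, Finset.sum_apply]
      by_cases hg : g ∈ C
      · rw [Finset.sum_eq_single g]
        · simp [pathCount, hg]
        · intro b _ hb
          simp [hb.symm]
        · simp [hK, hg]
      · rw [Finset.sum_eq_zero]
        · simp [pathCount, hg]
        · intro a ha
          rw [lp.single_apply_ne]
          rintro rfl
          exact hg ((hK _).1 ha)
    have hu : ∀ k, ∃ u : lp (fun _ : G => ℝ) 2, ∀ g, u g = pathCount S C k g := by
      intro k
      induction k with
      | zero => exact hu0
      | succ k ih =>
        obtain ⟨u, hu⟩ := ih
        refine ⟨∑ s ∈ S, rightShift s u, fun g => ?_⟩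
        rw [lp.coeFn_sum, Finset.sum_apply]
        simp [hu, pathCount]
    choose u hu using hu
    have hsucc : ∀ k, u (k + 1) = ∑ s ∈ S, rightShift s (u k) := by
      intro k
      ext g
      rw [lp.coeFn_sum, Finset.sum_apply]
      simp [hu, pathCount]
    have hu1 : ‖u 1‖ ^ 2 ≤ S.card * c ^ 2 := by
      rw [lp_two_norm_sq, tsum_eq_sum (s := S)]
      · rw [← nsmul_eq_mul]
        refine Finset.sum_le_card_nsmul _ _ _ (fun g _ => ?_)
        refine pow_le_pow_left₀ (norm_nonneg _) ?_ 2
        rw [hu, Real.norm_of_nonneg (Nat.cast_nonneg _)]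
        norm_cast
        simp only [pathCount]
        rw [Finset.sum_boole, Nat.cast_id, ← hKc]
        refine Finset.card_le_card_of_injOn (fun s => g * s) (fun s hs => ?_)
          (fun s _ t _ h => mul_left_cancel h)
        simp only [Finset.coe_filter, Set.mem_ofPred_eq] at hs
        exact (hK _).2 hs.2
      · intro g hg
        rw [hu]
        have : pathCount S C 1 g = 0 := by
          simp only [pathCount]
          refine Finset.sum_eq_zero (fun s hs => if_neg fun h => hg ?_)
          have := hSC s⁻¹ (hSinv s hs) _ h 1 C.one_mem
          simpa using this
        simp [this]
    have hum : ∀ m, ‖u (m + 1)‖ ≤ (δ * S.card) ^ m * ‖u 1‖ := by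
      intro m
      induction m with
      | zero => simp
      | succ m ih =>
        rw [hsucc]
        refine (hop _ (fun g => by rw [hu]; positivity)).trans ?_
        calc _ ≤ δ * S.card * ((δ * S.card) ^ m * ‖u 1‖) := by gcongr
          _ = _ := by ring
    intro m
    rw [← hu, hsucc, lp.coeFn_sum, Finset.sum_apply]
    simp only [rightShift_apply, one_mul]
    refine abs_le_of_sq_le_sq' ?_ (by positivity) |>.2
    calc (∑ s ∈ S, u (m + 1) s) ^ 2 ≤ S.card * ∑ s ∈ S, (u (m + 1) s) ^ 2 :=
          sq_sum_le_card_mul_sum_sq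
      _ ≤ S.card * ‖u (m + 1)‖ ^ 2 := by gcongr; exact hsumle _
      _ ≤ S.card * ((δ * S.card) ^ m * ‖u 1‖) ^ 2 := by gcongr; exact hum m
      _ = S.card * ((δ * S.card) ^ m) ^ 2 * ‖u 1‖ ^ 2 := by ring
      _ ≤ S.card * ((δ * S.card) ^ m) ^ 2 * (S.card * c ^ 2) := by gcongr
      _ = (c * (δ * S.card) ^ m * S.card) ^ 2 := by ring

end PathCount

section Orientation

variable {V : Type*}

/-- `t` can be reached from `s` by a walk of at most `k` steps. -/
def SimpleGraph.ReachWithin (G : SimpleGraph V) : ℕ → V → V → Prop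
  | 0, s, r => s = r
  | k + 1, s, r => G.ReachWithin k s r ∨ ∃ x, G.Adj s x ∧ G.ReachWithin k x r

/-- The edge between `s` and `t` exists and lies on no cycle. -/
def SimpleGraph.BridgeAt (G : SimpleGraph V) (s t : V) : Prop :=
  G.Adj s t ∧ ¬ (G.deleteEdges {s(s, t)}).Reachable s t

/-- `t` is the next vertex on the way from `s` along a bridge to the `e`-minimal vertex of the
component. -/
def SimpleGraph.IsParent (G : SimpleGraph V) (e : V → ℕ) (s t : V) : Prop :=
  G.BridgeAt s t ∧ ∃ r k, G.Reachable s r ∧ (∀ r', G.Reachable s r' → e r ≤ e r') ∧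
    G.ReachWithin k t r ∧ ¬ G.ReachWithin k s r

namespace SimpleGraph

variable {G : SimpleGraph V} {e : V → ℕ} {s t t' r : V}

theorem reachable_iff_exists_reachWithin :
    G.Reachable s r ↔ ∃ k, G.ReachWithin k s r := by
  constructor
  · rintro ⟨p⟩
    induction p with
    | nil => exact ⟨0, rfl⟩
    | cons h p ih =>
      obtain ⟨k, hk⟩ := ih
      exact ⟨k + 1, Or.inr ⟨_, h, hk⟩⟩
  · rintro ⟨k, hk⟩
    induction k generalizing s with
    | zero => exact hk ▸ Reachable.refl _
    | succ k ih =>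
      rcases hk with hk | ⟨x, hx, hk⟩
      · exact ih hk
      · exact hx.reachable.trans (ih hk)

theorem ReachWithin.mono {k l : ℕ} (hkl : k ≤ l) (h : G.ReachWithin k s r) :
    G.ReachWithin l s r := by
  induction hkl with
  | refl => exact h
  | step _ ih => exact Or.inl ih

theorem BridgeAt.symm (h : G.BridgeAt s t) : G.BridgeAt t s := by
  refine ⟨h.1.symm, fun h' => h.2 ?_⟩
  rw [Sym2.eq_swap]
  exact h'.symm

theorem reachable_deleteEdges_of_reachWithin (hst : ∀ k, G.ReachWithin k s r → G.ReachWithin k t r)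
    {k : ℕ} {x : V} (hx : G.ReachWithin k x r) (hk : ∀ j < k, ¬ G.ReachWithin j t r) :
    (G.deleteEdges {s(s, t)}).Reachable x r := by
  induction k generalizing x with
  | zero => exact hx ▸ Reachable.refl _
  | succ k ih =>
    have hk' : ∀ j < k, ¬ G.ReachWithin j t r := fun j hj => hk j (by omega)
    rcases hx with hx | ⟨x', hxx', hx⟩
    · exact ih hx hk'
    · refine Reachable.trans (Adj.reachable ?_) (ih hx hk')
      rw [deleteEdges_adj]
      refine ⟨hxx', fun h => ?_⟩
      have hxt : x' = s ∨ x' = t := by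
        rw [Set.mem_singleton_iff, Sym2.eq_iff] at h
        tauto
      rcases hxt with rfl | rfl
      · exact hk k (by omega) (hst k hx)
      · exact hk k (by omega) hx

theorem exists_min_reachable (e : V → ℕ) (s : V) :
    ∃ r, G.Reachable s r ∧ ∀ r', G.Reachable s r' → e r ≤ e r' := by
  obtain ⟨r, hr, hmin⟩ := (measure e).wf.has_min {r | G.Reachable s r} ⟨s, Reachable.refl s⟩
  exact ⟨r, hr, fun r' hr' => not_lt.1 (hmin r' hr')⟩

theorem exists_reachWithin_min (h : G.Reachable t r) :
    ∃ k, G.ReachWithin k t r ∧ ∀ j < k, ¬ G.ReachWithin j t r := by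
  classical
  have h' := reachable_iff_exists_reachWithin.1 h
  exact ⟨Nat.find h', Nat.find_spec h', fun j hj => Nat.find_min h' hj⟩

theorem BridgeAt.isParent_or (h : G.BridgeAt s t) : G.IsParent e s t ∨ G.IsParent e t s := by
  obtain ⟨r, hr, hmin⟩ := G.exists_min_reachable e s
  have hts : G.Reachable t s := h.1.symm.reachable
  have hmint : ∀ r', G.Reachable t r' → e r ≤ e r' := fun r' hr' => hmin r' (hts.symm.trans hr')
  by_cases h1 : ∃ k, G.ReachWithin k t r ∧ ¬ G.ReachWithin k s r
  · obtain ⟨k, hk⟩ := h1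
    exact Or.inl ⟨h, r, k, hr, hmin, hk⟩
  by_cases h2 : ∃ k, G.ReachWithin k s r ∧ ¬ G.ReachWithin k t r
  · obtain ⟨k, hk⟩ := h2
    exact Or.inr ⟨h.symm, r, k, hts.trans hr, hmint, hk⟩
  push Not at h1 h2
  exfalso
  obtain ⟨k, hk, hlt⟩ := exists_reachWithin_min (hts.trans hr)
  exact h.2 ((reachable_deleteEdges_of_reachWithin h2 (h1 k hk) hlt).trans
    (reachable_deleteEdges_of_reachWithin h2 hk hlt).symm)

theorem IsParent.not_swap (he : Function.Injective e) (h : G.IsParent e s t) :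
    ¬ G.IsParent e t s := by
  rintro ⟨-, r', k', hr', hmin', hk', hnk'⟩
  obtain ⟨hb, r, k, hr, hmin, hk, hnk⟩ := h
  have hst := hb.1.reachable
  obtain rfl : r = r' := he (le_antisymm (hmin _ (hst.trans hr')) (hmin' _ (hst.symm.trans hr)))
  rcases le_total k k' with h | h
  · exact hnk' (hk.mono h)
  · exact hnk (hk'.mono h)

theorem IsParent.unique_aux (hb : G.BridgeAt s t) (hadj : G.Adj s t') (hne : t ≠ t') {k : ℕ}
    (hk : G.ReachWithin k t r) (hnk : ¬ G.ReachWithin k s r)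
    (hle : ∀ k, G.ReachWithin k t r → G.ReachWithin k t' r) : False := by
  obtain ⟨l, hl, hlt⟩ := exists_reachWithin_min (reachable_iff_exists_reachWithin.2 ⟨k, hk⟩)
  have hst : ∀ j, G.ReachWithin j s r → G.ReachWithin j t r := fun j hj => by
    rcases le_total k j with h | h
    · exact hk.mono h
    · exact absurd (hj.mono h) hnk
  have h1 := reachable_deleteEdges_of_reachWithin hst hl hlt
  have h2 := reachable_deleteEdges_of_reachWithin hst (hle l hl) hlt
  refine hb.2 (Reachable.trans (Adj.reachable ?_) (h2.trans h1.symm))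
  rw [deleteEdges_adj]
  refine ⟨hadj, fun h => ?_⟩
  rw [Set.mem_singleton_iff, Sym2.eq_iff] at h
  have := hb.1.ne
  rcases h with ⟨-, h⟩ | ⟨h, -⟩
  · exact hne h.symm
  · exact this h

theorem IsParent.unique (he : Function.Injective e) (h : G.IsParent e s t)
    (h' : G.IsParent e s t') : t = t' := by
  obtain ⟨hb, r, k, hr, hmin, hk, hnk⟩ := h
  obtain ⟨hb', r', k', hr', hmin', hk', hnk'⟩ := h'
  obtain rfl : r = r' := he (le_antisymm (hmin _ hr') (hmin' _ hr))
  by_contra hne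
  by_cases hle : ∀ k, G.ReachWithin k t r → G.ReachWithin k t' r
  · exact unique_aux hb hb'.1 hne hk hnk hle
  · refine unique_aux hb' hb.1 (Ne.symm hne) hk' hnk' (fun j hj => ?_)
    push Not at hle
    obtain ⟨i, hi, hni⟩ := hle
    rcases le_total i j with h | h
    · exact hi.mono h
    · exact absurd (hj.mono h) hni

section Measurability

variable [Countable V] {Y : Type*} [MeasurableSpace Y] {𝒢 : Y → SimpleGraph V}

theorem measurableSet_reachWithin (h : ∀ s t, MeasurableSet {y | (𝒢 y).Adj s t}) (k : ℕ) (s r : V) :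
    MeasurableSet {y | (𝒢 y).ReachWithin k s r} := by
  induction k generalizing s with
  | zero => exact MeasurableSet.const _
  | succ k ih =>
    have : {y | (𝒢 y).ReachWithin (k + 1) s r} = {y | (𝒢 y).ReachWithin k s r} ∪
        ⋃ x, ({y | (𝒢 y).Adj s x} ∩ {y | (𝒢 y).ReachWithin k x r}) := by
      ext y
      simp [ReachWithin]
    rw [this]
    exact (ih s).union (MeasurableSet.iUnion fun x => (h s x).inter (ih x))

theorem measurableSet_reachable (h : ∀ s t, MeasurableSet {y | (𝒢 y).Adj s t}) (s r : V) :
    MeasurableSet {y | (𝒢 y).Reachable s r} := by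
  have : {y | (𝒢 y).Reachable s r} = ⋃ k, {y | (𝒢 y).ReachWithin k s r} := by
    ext y
    simp [reachable_iff_exists_reachWithin]
  rw [this]
  exact MeasurableSet.iUnion fun k => measurableSet_reachWithin h k s r

theorem measurableSet_bridgeAt (h : ∀ s t, MeasurableSet {y | (𝒢 y).Adj s t}) (s t : V) :
    MeasurableSet {y | (𝒢 y).BridgeAt s t} := by
  refine (h s t).inter (measurableSet_reachable (𝒢 := fun y => (𝒢 y).deleteEdges {s(s, t)})
    (fun a b => ?_) s t).compl
  simp only [deleteEdges_adj]
  exact (h a b).inter (MeasurableSet.const _)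

theorem measurableSet_isParent (h : ∀ s t, MeasurableSet {y | (𝒢 y).Adj s t}) (e : V → ℕ)
    (s t : V) : MeasurableSet {y | (𝒢 y).IsParent e s t} := by
  refine (measurableSet_bridgeAt h s t).inter ?_
  have : {y | ∃ r k, (𝒢 y).Reachable s r ∧ (∀ r', (𝒢 y).Reachable s r' → e r ≤ e r') ∧
      (𝒢 y).ReachWithin k t r ∧ ¬ (𝒢 y).ReachWithin k s r} =
      ⋃ r, ⋃ k, ({y | (𝒢 y).Reachable s r} ∩ ((⋂ r', ({y | (𝒢 y).Reachable s r'}ᶜ ∪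
        {_y | e r ≤ e r'})) ∩ ({y | (𝒢 y).ReachWithin k t r} ∩
        {y | (𝒢 y).ReachWithin k s r}ᶜ))) := by
    ext y
    simp [imp_iff_not_or]
  change MeasurableSet {y | _}
  rw [this]
  exact MeasurableSet.iUnion fun r => MeasurableSet.iUnion fun k =>
    (measurableSet_reachable h s r).inter ((MeasurableSet.iInter fun r' =>
      (measurableSet_reachable h s r').compl.union (MeasurableSet.const _)).inter
      ((measurableSet_reachWithin h k t r).inter (measurableSet_reachWithin h k s r).compl))

end Measurability

end SimpleGraph

end Orientation

section Percolation

variable {G : Type*} [Group G] (C : Subgroup G) [Fintype C] (n : ℕ)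

/-- The number, modulo `n`, of open sites of `y` in a left coset of `C`. -/
noncomputable def cosetCount (y : G → Bool) (ω : G ⧸ C) : ZMod n :=
  ∑ a : C, if y (ω.out * a) then 1 else 0

theorem cosetCount_mk (y : G → Bool) (g : G) :
    cosetCount C n y g = ∑ a : C, if y (g * a) then 1 else 0 := by
  obtain ⟨h, hh⟩ := QuotientGroup.mk_out_eq_mul C g
  rw [cosetCount, hh]
  refine Fintype.sum_equiv (Equiv.mulLeft h) _ _ (fun a => ?_)
  rw [Equiv.coe_mulLeft, Subgroup.coe_mul, mul_assoc]

/-- A coset is occupied if its number of open sites is nonzero modulo `n`. -/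
def Occupied (y : G → Bool) (ω : G ⧸ C) : Prop := cosetCount C n y ω ≠ 0

/-- The graph on occupied cosets, with edges given by the set `S`. -/
def percGraph (S : Finset G) (y : G → Bool) : SimpleGraph (G ⧸ C) where
  Adj ω ω' := ω ≠ ω' ∧ Occupied C n y ω ∧ Occupied C n y ω' ∧
    (ω.out⁻¹ * ω'.out ∈ S ∨ ω'.out⁻¹ * ω.out ∈ S)
  symm := ⟨fun _ _ ⟨h1, h2, h3, h4⟩ => ⟨h1.symm, h3, h2, h4.symm⟩⟩
  loopless := ⟨fun _ h => h.1 rfl⟩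

variable {C n}

theorem percGraph_adj {S : Finset G} (hinv : ∀ s ∈ S, s⁻¹ ∈ S)
    (hC : ∀ s ∈ S, ∀ a ∈ C, ∀ b ∈ C, a * s * b ∈ S) {y : G → Bool} {g h : G} :
    (percGraph C n S y).Adj g h ↔ ((g : G ⧸ C) ≠ h ∧ Occupied C n y g ∧ Occupied C n y h ∧
      g⁻¹ * h ∈ S) := by
  have h1 : ∀ g h : G, ((g : G ⧸ C).out⁻¹ * (h : G ⧸ C).out ∈ S ↔ g⁻¹ * h ∈ S) := by
    intro g h
    obtain ⟨a, ha⟩ := QuotientGroup.mk_out_eq_mul C g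
    obtain ⟨b, hb⟩ := QuotientGroup.mk_out_eq_mul C h
    rw [ha, hb]
    constructor
    · intro hm
      have := hC _ hm a a.2 (b : G)⁻¹ (C.inv_mem b.2)
      simpa [mul_assoc] using this
    · intro hm
      have := hC _ hm (a : G)⁻¹ (C.inv_mem a.2) b b.2
      simpa [mul_assoc] using this
  have h2 : ∀ g h : G, g⁻¹ * h ∈ S ↔ h⁻¹ * g ∈ S := by
    intro g h
    constructor <;> intro hm <;> simpa using hinv _ hm
  change _ ∧ _ ∧ _ ∧ (_ ∨ _) ↔ _
  rw [h1, h1, ← h2 g h, or_self]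

/-- Left translation of configurations. -/
def shiftConfig (x : G) (y : G → Bool) : G → Bool := fun h => y (x⁻¹ * h)

theorem occupied_shiftConfig (x : G) (y : G → Bool) (g : G) :
    Occupied C n (shiftConfig x y) ((x * g : G) : G ⧸ C) ↔ Occupied C n y g := by
  simp [Occupied, cosetCount_mk, shiftConfig, mul_assoc]

theorem SimpleGraph.BridgeAt.of_equiv {V : Type*} {𝒢 𝒢' : SimpleGraph V} (σ : V ≃ V)
    (h : ∀ a b, 𝒢'.Adj (σ a) (σ b) ↔ 𝒢.Adj a b) (a b : V) :
    𝒢'.BridgeAt (σ a) (σ b) ↔ 𝒢.BridgeAt a b := by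
  let φ : 𝒢.deleteEdges {s(a, b)} ≃g 𝒢'.deleteEdges {s(σ a, σ b)} :=
    { toEquiv := σ
      map_rel_iff' := by
        intro c d
        simp [SimpleGraph.deleteEdges_adj, h] }
  have h1 : (𝒢'.deleteEdges {s(σ a, σ b)}).Reachable (σ a) (σ b) ↔
      (𝒢.deleteEdges {s(a, b)}).Reachable a b := φ.reachable_iff
  rw [SimpleGraph.BridgeAt, SimpleGraph.BridgeAt, h, h1]

theorem bridgeAt_shiftConfig {S : Finset G} (hinv : ∀ s ∈ S, s⁻¹ ∈ S)
    (hC : ∀ s ∈ S, ∀ a ∈ C, ∀ b ∈ C, a * s * b ∈ S) (x : G) (y : G → Bool) (s t : G) :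
    (percGraph C n S (shiftConfig x y)).BridgeAt ((x * s : G) : G ⧸ C) ((x * t : G) : G ⧸ C) ↔
      (percGraph C n S y).BridgeAt s t := by
  refine SimpleGraph.BridgeAt.of_equiv (MulAction.toPerm x : Equiv.Perm (G ⧸ C))
    (fun a b => ?_) s t
  induction a using QuotientGroup.induction_on with | _ a => ?_
  induction b using QuotientGroup.induction_on with | _ b => ?_
  change (percGraph C n S (shiftConfig x y)).Adj ((x * a : G) : G ⧸ C) ((x * b : G) : G ⧸ C) ↔ _
  rw [percGraph_adj hinv hC, percGraph_adj hinv hC, occupied_shiftConfig, occupied_shiftConfig]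
  simp only [ne_eq, QuotientGroup.eq]
  simp [mul_assoc]

variable (C n) in
theorem measurable_cosetCount [MeasurableSpace (ZMod n)] (ω : G ⧸ C) :
    Measurable (fun y : G → Bool => cosetCount C n y ω) := by
  unfold cosetCount
  let F : (C → Bool) → ZMod n := fun z => ∑ a : C, if z a then 1 else 0
  have hF : Measurable F := measurable_of_finite F
  exact hF.comp (measurable_pi_lambda _ fun a => measurable_pi_apply _)

variable (C n) in
theorem measurableSet_occupied (ω : G ⧸ C) : MeasurableSet {y : G → Bool | Occupied C n y ω} := by
  let _ : MeasurableSpace (ZMod n) := ⊤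
  exact measurable_cosetCount C n ω (measurableSet_singleton (0 : ZMod n)).compl

/-- The Bernoulli measure on `Bool`. -/
noncomputable def siteMeasure (ε : unitInterval) : Measure Bool :=
  ENNReal.ofReal ε • Measure.dirac true + ENNReal.ofReal (1 - ε) • Measure.dirac false

instance (ε : unitInterval) : IsProbabilityMeasure (siteMeasure ε) where
  measure_univ := by
    simp only [siteMeasure, Measure.coe_add, Measure.coe_smul, Pi.add_apply, Pi.smul_apply,
      measure_univ, smul_eq_mul, mul_one]
    rw [← ENNReal.ofReal_add ε.2.1 (by linarith [ε.2.2])]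
    simp

theorem siteMeasure_true (ε : unitInterval) : siteMeasure ε {true} = ENNReal.ofReal ε := by
  simp [siteMeasure]

theorem siteMeasure_false (ε : unitInterval) :
    siteMeasure ε {false} = ENNReal.ofReal (1 - ε) := by
  simp [siteMeasure]

/-- Bernoulli percolation on the sites of `G`. -/
noncomputable def percMeasure (G : Type*) (ε : unitInterval) : Measure (G → Bool) :=
  Measure.infinitePi (fun _ : G => siteMeasure ε)

instance (ε : unitInterval) : IsProbabilityMeasure (percMeasure G ε) := by
  unfold percMeasure
  infer_instance

omit [Group G] in
theorem percMeasure_open (ε : unitInterval) (F : Finset G) :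
    percMeasure G ε {y | ∀ h ∈ F, y h = true} = ENNReal.ofReal ε ^ F.card := by
  have : {y : G → Bool | ∀ h ∈ F, y h = true} = Set.pi F (fun _ => {true}) := by
    ext y
    simp [Set.mem_pi]
  rw [this, percMeasure, Measure.infinitePi_pi _ (fun _ _ => MeasurableSet.singleton _)]
  simp [siteMeasure_true]

theorem percMeasure_occupied_open_le (ε : unitInterval) (X : Finset (G ⧸ C)) (F : Finset G)
    (hF : ∀ h ∈ F, (h : G ⧸ C) ∉ X) :
    percMeasure G ε {y | (∀ ω ∈ X, Occupied C n y ω) ∧ ∀ h ∈ F, y h = true} ≤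
      (Fintype.card C : ℝ≥0∞) ^ X.card * ENNReal.ofReal ε ^ (X.card + F.card) := by
  classical
  induction X using Finset.induction_on generalizing F with
  | empty => simp [percMeasure_open]
  | insert ω X hω ih =>
    have hsub : {y : G → Bool | (∀ ω' ∈ insert ω X, Occupied C n y ω') ∧ ∀ h ∈ F, y h = true} ⊆
        ⋃ a ∈ (Finset.univ : Finset C), {y | (∀ ω' ∈ X, Occupied C n y ω') ∧
          ∀ h ∈ insert (ω.out * a) F, y h = true} := by
      rintro y ⟨h1, h2⟩
      obtain ⟨a, ha⟩ : ∃ a : C, y (ω.out * a) = true := by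
        by_contra hcon
        push Not at hcon
        exact h1 ω (Finset.mem_insert_self _ _) (by simp [cosetCount, hcon])
      refine Set.mem_biUnion (Finset.mem_univ a) ⟨fun ω' h => h1 ω' (Finset.mem_insert_of_mem h),
        fun h hh => ?_⟩
      rcases Finset.mem_insert.1 hh with rfl | hh
      · exact ha
      · exact h2 h hh
    refine (measure_mono hsub).trans ((measure_biUnion_finset_le _ _).trans ?_)
    have hmk : ∀ a : C, ((ω.out * a : G) : G ⧸ C) = ω := fun a => by simp
    have hterm : ∀ a ∈ (Finset.univ : Finset C), percMeasure G ε
        {y | (∀ ω' ∈ X, Occupied C n y ω') ∧ ∀ h ∈ insert (ω.out * a) F, y h = true} ≤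
        (Fintype.card C : ℝ≥0∞) ^ X.card * ENNReal.ofReal ε ^ (X.card + 1 + F.card) := by
      intro a _
      refine (ih (insert (ω.out * a) F) (fun h hh => ?_)).trans (le_of_eq ?_)
      · rcases Finset.mem_insert.1 hh with rfl | hh
        · rwa [hmk]
        · exact fun h' => hF h hh (Finset.mem_insert_of_mem h')
      · rw [Finset.card_insert_of_notMem, add_assoc, add_comm 1]
        intro hmem
        exact hF _ hmem (by rw [hmk]; exact Finset.mem_insert_self _ _)
    refine (Finset.sum_le_sum hterm).trans (le_of_eq ?_)
    rw [Finset.sum_const, Finset.card_insert_of_notMem hω, Finset.card_univ, nsmul_eq_mul, pow_succ]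
    ring

theorem percMeasure_occupied_le (ε : unitInterval) (X : Finset (G ⧸ C)) :
    percMeasure G ε {y | ∀ ω ∈ X, Occupied C n y ω} ≤
      ENNReal.ofReal (Fintype.card C * ε) ^ X.card := by
  have := percMeasure_occupied_open_le (C := C) (n := n) ε X ∅ (by simp)
  simp only [Finset.notMem_empty, false_imp_iff, implies_true, and_true, Finset.card_empty,
    add_zero] at this
  rwa [ENNReal.ofReal_mul (Nat.cast_nonneg _), ENNReal.ofReal_natCast, mul_pow]

theorem le_percMeasure_occupied_pair (hn : 2 ≤ n) (ε : unitInterval) (h : G) (hh : h ∉ C) :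
    ENNReal.ofReal (ε ^ 2 * (1 - ε) ^ (2 * Fintype.card C)) ≤
      percMeasure G ε {y | Occupied C n y ((1 : G) : G ⧸ C) ∧ Occupied C n y (h : G ⧸ C)} := by
  classical
  have : Fact (1 < n) := ⟨hn⟩
  let K : Finset G := Finset.univ.image (fun a : C => (a : G)) ∪
    Finset.univ.image (fun a : C => h * (a : G))
  have hKc : K.card ≤ 2 * Fintype.card C := by
    refine (Finset.card_union_le _ _).trans ?_
    have h1 := Finset.card_image_le (s := (Finset.univ : Finset C)) (f := fun a : C => (a : G))
    have h2 := Finset.card_image_le (s := (Finset.univ : Finset C)) (f := fun a : C => h * (a : G))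
    rw [Finset.card_univ] at h1 h2
    omega
  have hh1 : h ≠ 1 := fun h' => hh (h' ▸ C.one_mem)
  let t : G → Set Bool := fun g => if g = 1 ∨ g = h then {true} else {false}
  have hsub : Set.pi K t ⊆
      {y | Occupied C n y ((1 : G) : G ⧸ C) ∧ Occupied C n y (h : G ⧸ C)} := by
    intro y hy
    have hy' : ∀ g ∈ K, (y g = true ↔ g = 1 ∨ g = h) := by
      intro g hg
      have := hy g hg
      simp only [t] at this
      split_ifs at this with hc
      · exact iff_of_true (by simpa using this) hc
      · exact iff_of_false (by simpa using this) hc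
    constructor
    · rw [Occupied, cosetCount_mk, Finset.sum_eq_single (1 : C)]
      · rw [if_pos]
        · exact one_ne_zero
        · exact (hy' _ (by simp [K])).2 (by simp)
      · intro b _ hb
        rw [if_neg]
        rw [hy' _ (by simp [K])]
        simp only [one_mul, not_or]
        exact ⟨by simpa using hb, fun hc => hh (hc ▸ b.2)⟩
      · simp
    · rw [Occupied, cosetCount_mk, Finset.sum_eq_single (1 : C)]
      · rw [if_pos]
        · exact one_ne_zero
        · exact (hy' _ (by simp [K])).2 (by simp)
      · intro b _ hb
        rw [if_neg]
        rw [hy' _ (by simp [K])]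
        simp only [not_or]
        refine ⟨fun hc => hh ?_, by simpa using hb⟩
        rw [eq_inv_of_mul_eq_one_left hc]
        exact C.inv_mem b.2
      · simp
  refine le_trans ?_ (measure_mono hsub)
  have hmt : ∀ i ∈ K, MeasurableSet (t i) := fun i _ => .of_discrete
  rw [percMeasure, Measure.infinitePi_pi _ hmt]
  have h1K : (1 : G) ∈ K := by
    simp only [K, Finset.mem_union, Finset.mem_image]
    exact Or.inl ⟨1, Finset.mem_univ _, rfl⟩
  have hhK : h ∈ K.erase 1 := by
    refine Finset.mem_erase.2 ⟨hh1, ?_⟩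
    simp only [K, Finset.mem_union, Finset.mem_image]
    exact Or.inr ⟨1, Finset.mem_univ _, by simp⟩
  rw [← Finset.mul_prod_erase K _ h1K, ← Finset.mul_prod_erase _ _ hhK]
  have hrest : ∏ x ∈ (K.erase 1).erase h, siteMeasure ε (t x) =
      ENNReal.ofReal (1 - ε) ^ ((K.erase 1).erase h).card := by
    refine Finset.prod_eq_pow_card (fun x hx => ?_)
    have hx1 := Finset.mem_erase.1 hx
    have hx2 := Finset.mem_erase.1 hx1.2
    simp [t, hx1.1, hx2.1, siteMeasure_false]
  have h0 : (0 : ℝ) ≤ 1 - ε := by linarith [ε.2.2]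
  rw [hrest, show t 1 = {true} by simp [t], show t h = {true} by simp [t], siteMeasure_true,
    ENNReal.ofReal_mul (by positivity), ENNReal.ofReal_pow ε.2.1, ENNReal.ofReal_pow h0,
    ← mul_assoc, ← sq]
  refine mul_le_mul_right (pow_le_pow_right_of_le_one' ?_ ?_) _
  · exact ENNReal.ofReal_le_one.2 (by linarith [ε.2.1])
  · exact (Finset.card_le_card ((Finset.erase_subset _ _).trans (Finset.erase_subset _ _))).trans
      hKc

end Percolation

section BridgeDensity

variable {G : Type*} [Group G] (C : Subgroup G) [Fintype C] (n : ℕ)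

open Classical in
/-- There is a self-avoiding path of `k` steps from `g` to the identity coset which avoids `X`,
all of whose sites are occupied. -/
def PathEvent (S : Finset G) : ℕ → Finset (G ⧸ C) → G → (G → Bool) → Prop
  | 0, X, g, y => (∀ ω ∈ X, Occupied C n y ω) ∧ g ∈ C
  | k + 1, X, g, y => ∃ s ∈ S, ((g * s : G) : G ⧸ C) ∉ X ∧
      PathEvent S k (insert ((g * s : G) : G ⧸ C) X) (g * s) y

variable {C n}

theorem percMeasure_pathEvent_le (ε : unitInterval) (S : Finset G) (k : ℕ) (X : Finset (G ⧸ C))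
    (g : G) : percMeasure G ε {y | PathEvent C n S k X g y} ≤
      pathCount S C k g * ENNReal.ofReal (Fintype.card C * ε) ^ (X.card + k) := by
  classical
  induction k generalizing X g with
  | zero =>
    by_cases hg : g ∈ C
    · simpa [PathEvent, pathCount, hg] using percMeasure_occupied_le ε X
    · simp [PathEvent, hg]
  | succ k ih =>
    have hsub : {y | PathEvent C n S (k + 1) X g y} ⊆ ⋃ s ∈ S,
        {y | ((g * s : G) : G ⧸ C) ∉ X ∧
          PathEvent C n S k (insert ((g * s : G) : G ⧸ C) X) (g * s) y} := by
      rintro y ⟨s, hs, hy⟩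
      refine Set.mem_biUnion hs ⟨hy.1, ?_⟩
      convert hy.2
    refine (measure_mono hsub).trans ((measure_biUnion_finset_le _ _).trans ?_)
    rw [pathCount, Nat.cast_sum, Finset.sum_mul]
    refine Finset.sum_le_sum (fun s _ => ?_)
    by_cases hX : ((g * s : G) : G ⧸ C) ∈ X
    · simp [hX]
    · simp only [hX, not_false_eq_true, true_and]
      refine (ih _ _).trans (le_of_eq ?_)
      rw [Finset.card_insert_of_notMem hX, add_assoc, add_comm 1]

theorem pathEvent_of_isPath {S : Finset G} (hinv : ∀ s ∈ S, s⁻¹ ∈ S)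
    (hC : ∀ s ∈ S, ∀ a ∈ C, ∀ b ∈ C, a * s * b ∈ S) {y : G → Bool} {u v : G ⧸ C}
    (w : (percGraph C n S y).Walk u v) (hw : w.IsPath) (X : Finset (G ⧸ C)) (g : G)
    (hu : u = g) (hv : v = (1 : G)) (hX : ∀ ω ∈ X, Occupied C n y ω)
    (hd : ∀ ω ∈ w.support.tail, ω ∉ X) : PathEvent C n S w.length X g y := by
  classical
  induction w generalizing X g with
  | nil =>
    refine ⟨hX, ?_⟩
    rw [hu, eq_comm, QuotientGroup.eq] at hv
    simpa using hv
  | @cons u x v h p ih =>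
    rw [SimpleGraph.Walk.cons_isPath_iff] at hw
    obtain ⟨g', rfl⟩ := QuotientGroup.mk_surjective x
    subst hu
    have hadj := (percGraph_adj hinv hC).1 h
    have hgg : g * (g⁻¹ * g') = g' := by group
    have hpX : ∀ ω ∈ p.support, ω ∉ X := by simpa using hd
    refine ⟨g⁻¹ * g', hadj.2.2.2, ?_, ?_⟩
    · rw [hgg]
      exact hpX _ p.start_mem_support
    · rw [hgg]
      have := ih hw.1 (insert (g' : G ⧸ C) X) g' rfl hv ?_ ?_
      · convert this
      · intro ω hω
        rcases Finset.mem_insert.1 hω with rfl | hω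
        · exact hadj.2.2.1
        · exact hX ω hω
      · intro ω hω hmem
        rcases Finset.mem_insert.1 hmem with rfl | hmem
        · have hnd := hw.1.support_nodup
          rw [← SimpleGraph.Walk.cons_tail_support, List.nodup_cons] at hnd
          exact hnd.1 hω
        · exact hpX ω (List.mem_of_mem_tail hω) hmem

theorem bridgeAt_or_pathEvent {S : Finset G} (hinv : ∀ s ∈ S, s⁻¹ ∈ S)
    (hC : ∀ s ∈ S, ∀ a ∈ C, ∀ b ∈ C, a * s * b ∈ S) {y : G → Bool} {h : G} (hS : h ∈ S)
    (hh : h ∉ C) (h1 : Occupied C n y (1 : G)) (h2 : Occupied C n y h) :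
    (percGraph C n S y).BridgeAt (1 : G) h ∨ ∃ k, PathEvent C n S (k + 2) {(h : G ⧸ C)} h y := by
  classical
  have hne : ((1 : G) : G ⧸ C) ≠ h := by
    rw [Ne, QuotientGroup.eq]
    simpa using hh
  have hadj : (percGraph C n S y).Adj (1 : G) h :=
    (percGraph_adj hinv hC).2 ⟨hne, h1, h2, by simpa using hS⟩
  by_cases hb : (percGraph C n S y).BridgeAt (1 : G) h
  · exact Or.inl hb
  refine Or.inr ?_
  have hr : ((percGraph C n S y).deleteEdges {s(((1 : G) : G ⧸ C), (h : G ⧸ C))}).Reachable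
      (1 : G) h := by
    by_contra hcon
    exact hb ⟨hadj, hcon⟩
  obtain ⟨w, hw⟩ := hr.symm.exists_isPath
  have hle := SimpleGraph.deleteEdges_le (G := percGraph C n S y)
    {s(((1 : G) : G ⧸ C), (h : G ⧸ C))}
  have key := pathEvent_of_isPath hinv hC (w.mapLe hle)
    ((SimpleGraph.Walk.isPath_mapLe hle).2 hw) {(h : G ⧸ C)} h rfl rfl (by simpa using h2) (by
      intro ω hω
      have hnd := hw.support_nodup
      rw [SimpleGraph.Walk.support_mapLe_eq_support] at hω
      rw [← SimpleGraph.Walk.cons_tail_support, List.nodup_cons] at hnd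
      rintro hmem
      rw [Finset.mem_singleton] at hmem
      exact hnd.1 (hmem ▸ hω))
  rw [SimpleGraph.Walk.length_map] at key
  have hl0 : w.length ≠ 0 := fun h0 => hne (SimpleGraph.Walk.eq_of_length_eq_zero h0).symm
  have hl1 : w.length ≠ 1 := by
    intro h1
    have := SimpleGraph.Walk.adj_of_length_eq_one h1
    rw [SimpleGraph.deleteEdges_adj] at this
    exact this.2 (by rw [Sym2.eq_swap]; rfl)
  refine ⟨w.length - 2, ?_⟩
  rwa [Nat.sub_add_cancel (by omega)]

theorem le_percMeasure_bridgeAt (hn : 2 ≤ n) (ε : unitInterval) {S : Finset G}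
    (hinv : ∀ s ∈ S, s⁻¹ ∈ S) (hC : ∀ s ∈ S, ∀ a ∈ C, ∀ b ∈ C, a * s * b ∈ S) {h : G}
    (hS : h ∈ S) (hh : h ∉ C) :
    ENNReal.ofReal (ε ^ 2 * (1 - ε) ^ (2 * Fintype.card C)) ≤
      percMeasure G ε {y | (percGraph C n S y).BridgeAt (1 : G) h} +
      ∑' k, pathCount S C (k + 2) h * ENNReal.ofReal (Fintype.card C * ε) ^ (k + 3) := by
  refine (le_percMeasure_occupied_pair hn ε h hh).trans ?_
  have hsub : {y | Occupied C n y ((1 : G) : G ⧸ C) ∧ Occupied C n y (h : G ⧸ C)} ⊆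
      {y | (percGraph C n S y).BridgeAt (1 : G) h} ∪
        ⋃ k, {y | PathEvent C n S (k + 2) {(h : G ⧸ C)} h y} := by
    rintro y ⟨h1, h2⟩
    rcases bridgeAt_or_pathEvent hinv hC hS hh h1 h2 with hb | ⟨k, hk⟩
    · exact Or.inl hb
    · exact Or.inr (Set.mem_iUnion.2 ⟨k, hk⟩)
  refine (measure_mono hsub).trans ((measure_union_le _ _).trans ?_)
  refine add_le_add le_rfl ((measure_iUnion_le _).trans (ENNReal.tsum_le_tsum fun k => ?_))
  refine (percMeasure_pathEvent_le ε S (k + 2) _ h).trans (le_of_eq ?_)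
  rw [Finset.card_singleton]
  congr 2
  ring

theorem sum_tsum_pathCount_le (ε : unitInterval) {S T : Finset G} (hT : T ⊆ S) {δ A : ℝ}
    (hδ : 0 ≤ δ) (hA : 0 ≤ A) (hq : δ * S.card * (Fintype.card C * ε) ≤ 1 / 2)
    (hpath : ∀ m, (pathCount S C (m + 2) 1 : ℝ) ≤ A * (δ * S.card) ^ m * S.card) :
    ∑ h ∈ T, ∑' k, pathCount S C (k + 2) h *
        ENNReal.ofReal (Fintype.card C * ε) ^ (k + 3) ≤
      ENNReal.ofReal (2 * A * S.card * (Fintype.card C * ε) ^ 2 *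
        (δ * S.card * (Fintype.card C * ε))) := by
  have hε : (0 : ℝ) ≤ ε := ε.2.1
  set r : ℝ := Fintype.card C * ε with hr
  have hr0 : 0 ≤ r := by positivity
  set q : ℝ := δ * S.card * r with hqd
  have hq0 : 0 ≤ q := by positivity
  rw [← Summable.tsum_finsetSum (fun i _ => ENNReal.summable)]
  have hterm : ∀ k : ℕ, ∑ h ∈ T, (pathCount S C (k + 2) h : ℝ≥0∞) * ENNReal.ofReal r ^ (k + 3) ≤
      ENNReal.ofReal (A * S.card * r ^ 2 * q * (1 / 2) ^ k) := by
    intro k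
    rw [← Finset.sum_mul]
    have h1 : ∑ h ∈ T, (pathCount S C (k + 2) h : ℝ≥0∞) ≤
        ENNReal.ofReal (A * (δ * S.card) ^ (k + 1) * S.card) := by
      refine (Finset.sum_le_sum_of_subset hT).trans ?_
      have h2 : ∑ h ∈ S, (pathCount S C (k + 2) h : ℝ≥0∞) =
          ENNReal.ofReal (pathCount S C (k + 1 + 2) 1 : ℝ) := by
        rw [ENNReal.ofReal_natCast, show k + 1 + 2 = (k + 2) + 1 by ring, pathCount]
        simp
      rw [h2]
      exact ENNReal.ofReal_le_ofReal (hpath (k + 1))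
    rw [← ENNReal.ofReal_pow hr0]
    refine (mul_le_mul_left h1 _).trans ?_
    rw [← ENNReal.ofReal_mul (by positivity)]
    refine ENNReal.ofReal_le_ofReal ?_
    have h3 : A * (δ * S.card) ^ (k + 1) * S.card * r ^ (k + 3) =
        A * S.card * r ^ 2 * q * q ^ k := by
      rw [hqd]; ring
    rw [h3]
    gcongr
  refine (ENNReal.tsum_le_tsum hterm).trans ?_
  rw [← ENNReal.ofReal_tsum_of_nonneg (fun k => by positivity)
    (summable_geometric_two.mul_left _), tsum_mul_left, tsum_geometric_two]
  refine ENNReal.ofReal_le_ofReal (le_of_eq ?_)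
  ring

theorem exists_percolation_bridge [Group.FG G] (hG : ¬ IsAmenable G) (hn : 2 ≤ n) (D : ℕ)
    (hD : 1 ≤ D) : ∃ S : Finset G, (∀ s ∈ S, s⁻¹ ∈ S) ∧
      (∀ s ∈ S, ∀ a ∈ C, ∀ b ∈ C, a * s * b ∈ S) ∧ ∃ ε : unitInterval, (0 : ℝ) < ε ∧
      (ε * D / 8 : ℝ) ≤
        ∑ h ∈ S, (percMeasure G ε).real {y | (percGraph C n S y).BridgeAt (1 : G) h} := by
  classical
  set c : ℝ := (Fintype.card C : ℝ) with hc
  have hc1 : 1 ≤ c := by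
    rw [hc]
    exact_mod_cast Fintype.card_pos
  have hD1 : (1 : ℝ) ≤ D := by exact_mod_cast hD
  obtain ⟨S, hinv, hC, hN, hδ, hpath⟩ := exists_finset_pathCount_le hG C
    (1 / (16 * c ^ 4 * D)) (by positivity)
  refine ⟨S, hinv, hC, ?_⟩
  set N : ℝ := (S.card : ℝ) with hNd
  have hN0 : 0 < N := by
    rw [hNd]
    exact_mod_cast hN
  have hNlarge : 256 * c ^ 8 * D ^ 2 ≤ N := by
    have : 1 ≤ N / (256 * c ^ 8 * D ^ 2) := by
      calc (1 : ℝ) ≤ (1 / (16 * c ^ 4 * D)) ^ 2 * N := hδ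
        _ = _ := by field_simp; ring
    rwa [one_le_div (by positivity)] at this
  have hc8 : c ≤ c ^ 8 := le_self_pow₀ hc1 (by norm_num)
  have hDD : (D : ℝ) ≤ (D : ℝ) ^ 2 := le_self_pow₀ hD1 (by norm_num)
  have hNcD : 256 * (c * D) ≤ N := by
    refine le_trans ?_ hNlarge
    rw [mul_assoc]
    gcongr
  have hNc : 2 * c ≤ N := by nlinarith
  have hND : (D : ℝ) ≤ N := by nlinarith
  let ε : unitInterval := ⟨D / N, by positivity, (div_le_one hN0).2 hND⟩
  have hεv : (ε : ℝ) = D / N := rfl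
  have hε0 : (0 : ℝ) < ε := by rw [hεv]; positivity
  have hεN : ε * N = D := by rw [hεv]; field_simp
  have hcε : c * ε ≤ 1 / 4 := by
    rw [hεv, mul_div_assoc', div_le_iff₀ hN0]
    linarith
  refine ⟨ε, hε0, ?_⟩
  set T : Finset G := S.filter (· ∉ C) with hTd
  have hT : T ⊆ S := Finset.filter_subset _ _
  have hTcard : N - c ≤ T.card := by
    have h1 := Finset.card_filter_add_card_filter_not (s := S) (· ∈ C)
    have h2 : (S.filter (· ∈ C)).card ≤ Fintype.card C := by
      rw [← Finset.card_univ, ← Finset.card_map (Function.Embedding.subtype _)]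
      refine Finset.card_le_card fun g hg => ?_
      simpa using (Finset.mem_filter.1 hg).2
    have h3 : ((S.filter (· ∈ C)).card : ℝ) + T.card = N := by
      rw [hNd, ← h1]
      push_cast
      rfl
    have h4 : ((S.filter (· ∈ C)).card : ℝ) ≤ c := by
      rw [hc]
      exact_mod_cast h2
    linarith
  have htail := sum_tsum_pathCount_le (C := C) ε hT (δ := 1 / (16 * c ^ 4 * D)) (A := c)
    (by positivity) (by positivity) (by
      change 1 / (16 * c ^ 4 * D) * N * (c * ε) ≤ 1 / 2
      rw [hεv]
      have hc3 : 1 ≤ c ^ 3 := one_le_pow₀ hc1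
      have : 1 / (16 * c ^ 4 * D) * N * (c * (D / N)) = 1 / (16 * c ^ 3) := by
        field_simp
      rw [this]
      refine one_div_le_one_div_of_le (by norm_num) ?_
      linarith)
    (by
      intro m
      have := hpath m
      rwa [Nat.card_eq_fintype_card] at this)
  have hsum := Finset.sum_le_sum (s := T) (fun h hh => le_percMeasure_bridgeAt (n := n) hn ε hinv hC
    (hT hh) (Finset.mem_filter.1 hh).2)
  rw [Finset.sum_add_distrib] at hsum
  have hsum2 := hsum.trans (add_le_add (Finset.sum_le_sum_of_subset hT) htail)
  have hfin : ∀ h ∈ S, percMeasure G ε {y | (percGraph C n S y).BridgeAt (1 : G) h} ≠ ⊤ :=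
    fun h _ => measure_ne_top _ _
  have hE : ∑ h ∈ S, percMeasure G ε {y | (percGraph C n S y).BridgeAt (1 : G) h} =
      ENNReal.ofReal (∑ h ∈ S,
        (percMeasure G ε).real {y | (percGraph C n S y).BridgeAt (1 : G) h}) := by
    rw [ENNReal.ofReal_sum_of_nonneg (fun _ _ => measureReal_nonneg)]
    exact Finset.sum_congr rfl fun h hh => (ENNReal.ofReal_toReal (hfin h hh)).symm
  have h1ε : (0 : ℝ) ≤ 1 - ε := by linarith [ε.2.2]
  have hEd0 : 0 ≤ ∑ h ∈ S,
      (percMeasure G ε).real {y | (percGraph C n S y).BridgeAt (1 : G) h} :=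
    Finset.sum_nonneg fun _ _ => measureReal_nonneg
  rw [hE, Finset.sum_const, nsmul_eq_mul, ← ENNReal.ofReal_natCast, ← ENNReal.ofReal_mul
    (Nat.cast_nonneg _), ← ENNReal.ofReal_add hEd0 (by positivity),
    ENNReal.ofReal_le_ofReal_iff (by positivity)] at hsum2
  have hbern : 1 / 2 ≤ (1 - (ε : ℝ)) ^ (2 * Fintype.card C) := by
    have h1 : (-2 : ℝ) ≤ -ε := by linarith [ε.2.2]
    have := one_add_mul_le_pow h1 (2 * Fintype.card C)
    push_cast at this
    rw [← sub_eq_add_neg] at this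
    refine le_trans ?_ this
    rw [← hc]
    linarith
  have hlow : N / 2 * (ε ^ 2 * (1 / 2)) ≤
      T.card * ((ε : ℝ) ^ 2 * (1 - ε) ^ (2 * Fintype.card C)) := by
    gcongr
    linarith
  have htv : 2 * c * N * (c * ε) ^ 2 * (1 / (16 * c ^ 4 * D) * N * (c * ε)) =
      ε ^ 2 * N / 8 := by
    rw [hεv]
    field_simp
    ring
  have hfinal := hlow.trans hsum2
  rw [← hc, ← hNd, htv] at hfinal
  have : (ε : ℝ) ^ 2 * N = ε * D := by rw [sq, mul_assoc, hεN]
  linarith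

end BridgeDensity

section Derivation

/-- The upper triangular operator with diagonal `A` and corner `B`. -/
noncomputable def upperBlock {H : Type*} [NormedAddCommGroup H] [InnerProductSpace ℂ H]
    (A B : H →L[ℂ] H) : WithLp 2 (H × H) →L[ℂ] WithLp 2 (H × H) :=
  ((WithLp.prodContinuousLinearEquiv 2 ℂ H H).symm : H × H →L[ℂ] WithLp 2 (H × H)) ∘L
    ((A ∘L ContinuousLinearMap.fst ℂ H H + B ∘L ContinuousLinearMap.snd ℂ H H).prod
      (A ∘L ContinuousLinearMap.snd ℂ H H)) ∘L
    (WithLp.prodContinuousLinearEquiv 2 ℂ H H : WithLp 2 (H × H) →L[ℂ] H × H)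

theorem upperBlock_apply {H : Type*} [NormedAddCommGroup H] [InnerProductSpace ℂ H]
    (A B : H →L[ℂ] H) (x : WithLp 2 (H × H)) :
    upperBlock A B x = WithLp.toLp 2 (A x.fst + B x.snd, A x.snd) := rfl

theorem norm_upperBlock_le {H : Type*} [NormedAddCommGroup H] [InnerProductSpace ℂ H]
    (A B : H →L[ℂ] H) : ‖upperBlock A B‖ ≤ 2 * ‖A‖ + ‖B‖ := by
  refine ContinuousLinearMap.opNorm_le_bound _ (by positivity) (fun x => ?_)
  have h1 : ‖x.fst‖ ≤ ‖x‖ := WithLp.norm_fst_le _ x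
  have h2 : ‖x.snd‖ ≤ ‖x‖ := WithLp.norm_snd_le _ x
  have h3 : upperBlock A B x =
      WithLp.toLp 2 (A x.fst + B x.snd, 0) + WithLp.toLp 2 (0, A x.snd) := by
    rw [upperBlock_apply, ← WithLp.toLp_add]
    simp
  rw [h3]
  refine (norm_add_le _ _).trans ?_
  rw [WithLp.norm_toLp_fst, WithLp.norm_toLp_snd]
  have h4 := A.le_opNorm x.fst
  have h5 := A.le_opNorm x.snd
  have h6 := B.le_opNorm x.snd
  have h7 := norm_add_le (A x.fst) (B x.snd)
  have h8 : ‖A‖ * ‖x.fst‖ ≤ ‖A‖ * ‖x‖ := by gcongr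
  have h9 : ‖A‖ * ‖x.snd‖ ≤ ‖A‖ * ‖x‖ := by gcongr
  have h10 : ‖B‖ * ‖x.snd‖ ≤ ‖B‖ * ‖x‖ := by gcongr
  linarith

/-- Over a unitarizable group, every bounded derivation along a uniformly bounded representation
is inner. -/
theorem IsUnitarizableGroup.exists_inner_derivation {Γ : Type*} [Group Γ]
    (hΓ : IsUnitarizableGroup Γ) {H : Type} [NormedAddCommGroup H] [InnerProductSpace ℂ H]
    [CompleteSpace H] (ρ : Γ →* (H →L[ℂ] H)) (A : ℝ) (hρ : ∀ γ, ‖ρ γ‖ ≤ A)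
    (D : Γ → (H →L[ℂ] H)) (hD : ∀ γ γ', D (γ * γ') = ρ γ * D γ' + D γ * ρ γ') (R : ℝ)
    (hR : ∀ γ, ‖D γ‖ ≤ R) : ∃ B : H →L[ℂ] H, ∀ γ, D γ = ρ γ * B - B * ρ γ := by
  have hD1 : D 1 = 0 := by
    have := hD 1 1
    simpa using this
  let π₀ : Γ →* (WithLp 2 (H × H) →L[ℂ] WithLp 2 (H × H)) :=
    { toFun := fun γ => upperBlock (ρ γ) (D γ)
      map_one' := by
        ext1 x
        simp only [upperBlock_apply, hD1, map_one, zero_apply, add_zero]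
        rfl
      map_mul' := by
        intro γ γ'
        ext1 x
        simp [upperBlock_apply, hD, add_assoc] }
  have hπ₀ : ∀ γ x, π₀ γ x = WithLp.toLp 2 (ρ γ x.fst + D γ x.snd, ρ γ x.snd) := fun _ _ => rfl
  obtain ⟨S, hS⟩ := hΓ (WithLp 2 (H × H)) π₀.toHomUnits ⟨2 * A + R, fun γ => by
    refine (norm_upperBlock_le _ _).trans ?_
    linarith [hρ γ, hR γ]⟩
  set S₁ : WithLp 2 (H × H) →L[ℂ] WithLp 2 (H × H) := S.val with hS₁
  set S₂ : WithLp 2 (H × H) →L[ℂ] WithLp 2 (H × H) := S⁻¹.val with hS₂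
  have h12 : ∀ x, S₁ (S₂ x) = x := fun x => by
    rw [← mul_apply_eq_comp, hS₁, hS₂, Units.mul_inv]; rfl
  have h21 : ∀ x, S₂ (S₁ x) = x := fun x => by
    rw [← mul_apply_eq_comp, hS₁, hS₂, Units.inv_mul]; rfl
  let U : Γ → (WithLp 2 (H × H) →L[ℂ] WithLp 2 (H × H)) := fun γ => S₂ * π₀ γ * S₁
  have hU : ∀ γ, U γ ∈ unitary _ := fun γ => hS γ
  have hUU : ∀ γ, U γ * U γ⁻¹ = 1 := by
    intro γ
    ext1 x
    simp only [U, mul_apply_eq_comp, h12]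
    rw [← mul_apply_eq_comp (π₀ γ), ← map_mul, mul_inv_cancel, map_one]
    exact h21 x
  have hUstar : ∀ γ, star (U γ) = U γ⁻¹ := by
    intro γ
    have := (Unitary.mem_iff.1 (hU γ)).1
    calc star (U γ) = star (U γ) * (U γ * U γ⁻¹) := by rw [hUU, mul_one]
      _ = _ := by rw [← mul_assoc, this, one_mul]
  let sndS : WithLp 2 (H × H) →L[ℂ] H := WithLp.sndL 2 ℂ H H ∘L S₁
  let M : Submodule ℂ (WithLp 2 (H × H)) := sndS.ker
  have hMc : IsClosed (M : Set (WithLp 2 (H × H))) := sndS.isClosed_ker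
  have : CompleteSpace M := hMc.completeSpace_coe
  have hM : ∀ x, x ∈ M ↔ (S₁ x).snd = 0 := fun x => Iff.rfl
  set Q := M.starProjection with hQ
  have hQM : ∀ x, Q x ∈ M := M.starProjection_apply_mem
  have hQid : ∀ x ∈ M, Q x = x := fun x hx => Submodule.starProjection_eq_self_iff.2 hx
  have hUM : ∀ γ, ∀ x ∈ M, U γ x ∈ M := by
    intro γ x hx
    rw [hM] at hx ⊢
    simp [U, h12, hπ₀, hx]
  have hQUQ : ∀ γ, Q * U γ * Q = U γ * Q := by
    intro γ
    ext1 x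
    exact hQid _ (hUM γ _ (hQM x))
  have hQstar : star Q = Q := isSelfAdjoint_starProjection M
  have hcomm : ∀ γ, Q * U γ = U γ * Q := by
    intro γ
    have h1 := congrArg star (hQUQ γ⁻¹)
    simp only [star_mul, hQstar, hUstar, inv_inv] at h1
    rw [← h1, ← mul_assoc, hQUQ]
  let F : WithLp 2 (H × H) →L[ℂ] WithLp 2 (H × H) := S₁ * Q * S₂
  have hFπ : ∀ γ x, F (π₀ γ x) = π₀ γ (F x) := by
    intro γ x
    have := congrArg (fun A => S₁ (A (S₂ x))) (hcomm γ)
    simpa [U, h12, F] using this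
  have hF1 : ∀ x : WithLp 2 (H × H), x.snd = 0 → F x = x := by
    intro x hx
    have : S₂ x ∈ M := by rw [hM, h12, hx]
    simp [F, hQid _ this, h12]
  have hF2 : ∀ x : WithLp 2 (H × H), (F x).snd = 0 := fun x => (hM _).1 (hQM _)
  let J : H →L[ℂ] WithLp 2 (H × H) :=
    ((WithLp.prodContinuousLinearEquiv 2 ℂ H H).symm : H × H →L[ℂ] WithLp 2 (H × H)) ∘L
      ContinuousLinearMap.inr ℂ H H
  have hJ : ∀ y, J y = WithLp.toLp 2 (0, y) := fun _ => rfl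
  refine ⟨WithLp.fstL 2 ℂ H H ∘L F ∘L J, fun γ => ?_⟩
  ext y
  have h1 : π₀ γ (J y) = WithLp.toLp 2 (D γ y, 0) + J (ρ γ y) := by
    rw [hπ₀, hJ, hJ, ← WithLp.toLp_add]
    simp
  have h2 := congrArg WithLp.fst (hFπ γ (J y))
  rw [h1, map_add, hF1 (WithLp.toLp 2 (D γ y, 0)) rfl, hπ₀, hF2] at h2
  have h3 : D γ y + (F (J (ρ γ y))).fst = ρ γ (F (J y)).fst := by simpa using h2
  change D γ y = ρ γ (F (J y)).fst - (F (J (ρ γ y))).fst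
  rw [← h3, add_sub_cancel_right]

theorem IsUnitarizableGroup.exists_uniform_commute {Γ : Type*} [Group Γ]
    (hΓ : IsUnitarizableGroup Γ) {H : ℕ → Type} [∀ j, NormedAddCommGroup (H j)]
    [∀ j, InnerProductSpace ℂ (H j)] [∀ j, CompleteSpace (H j)]
    (ρ : ∀ j, Γ →* (H j →L[ℂ] H j)) (hρ : ∀ j γ, ‖ρ j γ‖ ≤ 1) (T : ∀ j, H j →L[ℂ] H j) (R : ℝ)
    (hR : ∀ j γ, ‖ρ j γ * T j - T j * ρ j γ‖ ≤ R) :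
    ∃ K : ℝ, ∀ j, ∃ B : H j →L[ℂ] H j, ‖B‖ ≤ K ∧ ∀ γ, Commute (ρ j γ) (T j - B) := by
  let ρ' : Γ →* (lp H 2 →L[ℂ] lp H 2) :=
    { toFun := fun γ => lpDirectSum (fun j => ρ j γ) 1 (fun j => hρ j γ)
      map_one' := by
        ext x j
        simp
      map_mul' := by
        intro γ γ'
        ext x j
        simp }
  have hρ' : ∀ γ x j, ρ' γ x j = ρ j γ (x j) := fun _ _ _ => rfl
  let D : Γ → (lp H 2 →L[ℂ] lp H 2) := fun γ =>
    lpDirectSum (fun j => ρ j γ * T j - T j * ρ j γ) R (fun j => hR j γ)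
  have hD : ∀ γ x j, D γ x j = ρ j γ (T j (x j)) - T j (ρ j γ (x j)) := fun _ _ _ => rfl
  obtain ⟨B, hB⟩ := hΓ.exists_inner_derivation ρ' (max 1 0)
    (fun γ => norm_lpDirectSum_le _ 1 (fun j => hρ j γ)) D (by
      intro γ γ'
      ext x j
      simp [hD, hρ']) (max R 0) (fun γ => norm_lpDirectSum_le _ R (fun j => hR j γ))
  refine ⟨‖B‖, fun j => ⟨lp.evalCLM ℂ H 2 j ∘L B ∘L lp.singleContinuousLinearMap ℂ H 2 j, ?_, ?_⟩⟩
  · refine ContinuousLinearMap.opNorm_le_bound _ (norm_nonneg _) (fun x => ?_)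
    refine (lp.norm_apply_le_norm (by norm_num) (B (lp.single 2 j x)) j).trans ?_
    refine (B.le_opNorm _).trans (le_of_eq ?_)
    rw [lp.norm_single (by norm_num)]
  · intro γ
    have hs : ∀ x : H j, ρ' γ (lp.single 2 j x) = lp.single 2 j (ρ j γ x) := by
      intro x
      ext i
      rw [hρ']
      by_cases hij : i = j
      · subst hij
        simp
      · rw [lp.single_apply_ne _ _ _ hij, lp.single_apply_ne _ _ _ hij, map_zero]
    ext x
    have h1 := congrArg (fun A : lp H 2 →L[ℂ] lp H 2 => A (lp.single 2 j x) j) (hB γ)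
    simp only [hD, sub_apply, mul_apply_eq_comp, lp.coeFn_sub,
      Pi.sub_apply, hρ', hs, lp.single_apply_self] at h1
    change ρ j γ (T j x - B (lp.single 2 j x) j) =
      T j (ρ j γ x) - B (lp.single 2 j (ρ j γ x)) j
    rw [map_sub]
    rw [sub_eq_iff_eq_add] at h1 ⊢
    rw [h1]
    abel

end Derivation

section Operators

/-- The algebra of bounded measurable complex functions. -/
def bddMeas (Z : Type*) [MeasurableSpace Z] : Subalgebra ℂ (Z → ℂ) where
  carrier := {m | Measurable m ∧ ∃ A : ℝ, ∀ z, ‖m z‖ ≤ A}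
  mul_mem' := by
    rintro a b ⟨ha, A, hA⟩ ⟨hb, B, hB⟩
    refine ⟨ha.mul hb, A * B, fun z => ?_⟩
    rw [Pi.mul_apply, norm_mul]
    exact mul_le_mul (hA z) (hB z) (norm_nonneg _) ((norm_nonneg _).trans (hA z))
  add_mem' := by
    rintro a b ⟨ha, A, hA⟩ ⟨hb, B, hB⟩
    exact ⟨ha.add hb, A + B, fun z => (norm_add_le _ _).trans (add_le_add (hA z) (hB z))⟩
  algebraMap_mem' := fun r => ⟨measurable_const, ‖r‖, fun _ => le_rfl⟩

variable {Z : Type*} [MeasurableSpace Z]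

/-- Precomposition of a bounded measurable function with a measurable map. -/
def bddMeas.comp {W : Type*} [MeasurableSpace W] (m : bddMeas W) (f : Z → W)
    (hf : Measurable f) : bddMeas Z :=
  ⟨fun z => m.1 (f z), m.2.1.comp hf, m.2.2.choose, fun _ => m.2.2.choose_spec _⟩

/-- The indicator function of a measurable set, as a bounded measurable function. -/
noncomputable def bddMeas.ind (E : Set Z) (hE : MeasurableSet E) : bddMeas Z :=
  ⟨E.indicator 1, measurable_one.indicator hE, 1, fun z => by
    by_cases hz : z ∈ E <;> simp [hz]⟩

theorem bddMeas.ind_apply {E : Set Z} (hE : MeasurableSet E) (z : Z) :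
    (bddMeas.ind E hE).1 z = E.indicator 1 z := rfl

theorem bddMeas.memLp_mul {μ : Measure Z} (m : bddMeas Z) (ξ : Lp ℂ 2 μ) :
    MemLp (fun z => m.1 z * ξ z) 2 μ := by
  obtain ⟨A, hA⟩ := m.2.2
  refine MemLp.of_le_mul (Lp.memLp ξ) (c := A) ?_ (ae_of_all _ fun z => ?_)
  · exact m.2.1.aestronglyMeasurable.mul (Lp.aestronglyMeasurable ξ)
  · rw [norm_mul]
    exact mul_le_mul_of_nonneg_right (hA z) (norm_nonneg _)

/-- Multiplication by a bounded measurable function on `L²`. -/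
noncomputable def mulCLM (μ : Measure Z) (m : bddMeas Z) : Lp ℂ 2 μ →L[ℂ] Lp ℂ 2 μ :=
  LinearMap.mkContinuousOfExistsBound
    { toFun := fun ξ => (bddMeas.memLp_mul m ξ).toLp _
      map_add' := by
        intro ξ η
        rw [← MemLp.toLp_add, MemLp.toLp_eq_toLp_iff]
        filter_upwards [Lp.coeFn_add ξ η] with z hz
        rw [hz, Pi.add_apply, Pi.add_apply, mul_add]
      map_smul' := by
        intro c ξ
        rw [RingHom.id_apply, ← MemLp.toLp_const_smul, MemLp.toLp_eq_toLp_iff]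
        filter_upwards [Lp.coeFn_smul c ξ] with z hz
        rw [hz, Pi.smul_apply, Pi.smul_apply, smul_eq_mul, smul_eq_mul]
        ring }
    (by
      obtain ⟨A, hA⟩ := m.2.2
      refine ⟨A, fun ξ => ?_⟩
      refine Lp.norm_le_mul_norm_of_ae_le_mul ?_
      filter_upwards [MemLp.coeFn_toLp (bddMeas.memLp_mul m ξ)] with z hz
      change ‖(MemLp.toLp _ (bddMeas.memLp_mul m ξ)) z‖ ≤ _
      rw [hz, norm_mul]
      exact mul_le_mul_of_nonneg_right (hA z) (norm_nonneg _))

variable {μ : Measure Z}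

theorem coeFn_mulCLM (m : bddMeas Z) (ξ : Lp ℂ 2 μ) :
    mulCLM μ m ξ =ᵐ[μ] fun z => m.1 z * ξ z := MemLp.coeFn_toLp (bddMeas.memLp_mul m ξ)

theorem norm_mulCLM_le (m : bddMeas Z) {A : ℝ} (hA0 : 0 ≤ A) (hA : ∀ z, ‖m.1 z‖ ≤ A) :
    ‖mulCLM μ m‖ ≤ A := by
  refine ContinuousLinearMap.opNorm_le_bound _ hA0 (fun ξ => ?_)
  refine Lp.norm_le_mul_norm_of_ae_le_mul ?_
  filter_upwards [coeFn_mulCLM m ξ] with z hz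
  rw [hz, norm_mul]
  exact mul_le_mul_of_nonneg_right (hA z) (norm_nonneg _)

/-- Multiplication operators, as an algebra homomorphism. -/
noncomputable def mulHom (μ : Measure Z) : bddMeas Z →ₐ[ℂ] (Lp ℂ 2 μ →L[ℂ] Lp ℂ 2 μ) :=
  AlgHom.ofLinearMap
    { toFun := mulCLM μ
      map_add' := by
        intro m m'
        ext1 ξ
        refine Lp.ext ?_
        filter_upwards [coeFn_mulCLM (m + m') ξ, coeFn_mulCLM m ξ, coeFn_mulCLM m' ξ,
          Lp.coeFn_add (mulCLM μ m ξ) (mulCLM μ m' ξ)] with z h1 h2 h3 h4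
        rw [h1, add_apply, h4, Pi.add_apply, h2, h3, ← add_mul]
        rfl
      map_smul' := by
        intro c m
        ext1 ξ
        refine Lp.ext ?_
        filter_upwards [coeFn_mulCLM (c • m) ξ, coeFn_mulCLM m ξ,
          Lp.coeFn_smul c (mulCLM μ m ξ)] with z h1 h2 h3
        rw [h1, RingHom.id_apply, smul_apply, h3, Pi.smul_apply, h2, smul_eq_mul, ← mul_assoc]
        rfl }
    (by
      ext1 ξ
      refine Lp.ext ?_
      filter_upwards [coeFn_mulCLM (1 : bddMeas Z) ξ] with z h1
      refine h1.trans ?_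
      exact one_mul _)
    (by
      intro m m'
      ext1 ξ
      refine Lp.ext ?_
      filter_upwards [coeFn_mulCLM (m * m') ξ, coeFn_mulCLM m' ξ,
        coeFn_mulCLM m (mulCLM μ m' ξ)] with z h1 h2 h3
      refine h1.trans ?_
      rw [mul_apply_eq_comp]
      refine Eq.trans ?_ h3.symm
      rw [h2, ← mul_assoc]
      rfl)

theorem mulHom_apply (m : bddMeas Z) : mulHom μ m = mulCLM μ m := rfl

/-- Composition with a measure preserving map on `L²`. -/
noncomputable def compCLM {f : Z → Z} (hf : MeasurePreserving f μ μ) :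
    Lp ℂ 2 μ →L[ℂ] Lp ℂ 2 μ :=
  (Lp.compMeasurePreservingₗᵢ ℂ f hf).toContinuousLinearMap

theorem coeFn_compCLM {f : Z → Z} (hf : MeasurePreserving f μ μ) (ξ : Lp ℂ 2 μ) :
    compCLM hf ξ =ᵐ[μ] fun z => ξ (f z) := Lp.coeFn_compMeasurePreserving ξ hf

theorem norm_compCLM_apply {f : Z → Z} (hf : MeasurePreserving f μ μ) (ξ : Lp ℂ 2 μ) :
    ‖compCLM hf ξ‖ = ‖ξ‖ := (Lp.compMeasurePreservingₗᵢ ℂ f hf).norm_map ξ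

theorem compCLM_mul_mulCLM {f : Z → Z} (hf : MeasurePreserving f μ μ) (m : bddMeas Z) :
    compCLM hf * mulCLM μ m = mulCLM μ (bddMeas.comp m f hf.measurable) * compCLM hf := by
  ext1 ξ
  refine Lp.ext ?_
  rw [mul_apply_eq_comp, mul_apply_eq_comp]
  filter_upwards [coeFn_compCLM hf (mulCLM μ m ξ),
    hf.quasiMeasurePreserving.ae (coeFn_mulCLM m ξ),
    coeFn_mulCLM (bddMeas.comp m f hf.measurable) (compCLM hf ξ), coeFn_compCLM hf ξ]
    with z h1 h2 h3 h4
  rw [h1, h2, h3, h4]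
  rfl

theorem compCLM_mul_compCLM {f g k : Z → Z} (hf : MeasurePreserving f μ μ)
    (hg : MeasurePreserving g μ μ) (hk : MeasurePreserving k μ μ) (h : ∀ z, g (f z) = k z) :
    compCLM hf * compCLM hg = compCLM hk := by
  ext1 ξ
  refine Lp.ext ?_
  rw [mul_apply_eq_comp]
  filter_upwards [coeFn_compCLM hf (compCLM hg ξ), hf.quasiMeasurePreserving.ae
    (coeFn_compCLM hg ξ), coeFn_compCLM hk ξ] with z h1 h2 h3
  rw [h1, h2, h3, h]

theorem norm_sum_mulCLM_mul_compCLM_le {ι : Type*} (s : Finset ι) (k : ι → bddMeas Z)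
    {R R' : ι → Z → Z} (hR : ∀ u, MeasurePreserving (R u) μ μ)
    (hR' : ∀ u, MeasurePreserving (R' u) μ μ) (hRR : ∀ u z, R u (R' u z) = z) {A : ℝ}
    (hA0 : 0 ≤ A) (hrow : ∀ z, ∑ u ∈ s, ‖(k u).1 z‖ ≤ A)
    (hcol : ∀ z, ∑ u ∈ s, ‖(k u).1 (R' u z)‖ ≤ A) :
    ‖∑ u ∈ s, mulCLM μ (k u) * compCLM (hR u)‖ ≤ A := by
  refine ContinuousLinearMap.opNorm_le_bound _ hA0 (fun ξ => ?_)
  set η := (∑ u ∈ s, mulCLM μ (k u) * compCLM (hR u)) ξ with hη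
  have hηz : ∀ᵐ z ∂μ, η z = ∑ u ∈ s, (k u).1 z * ξ (R u z) := by
    have h0 : η = ∑ u ∈ s, mulCLM μ (k u) (compCLM (hR u) ξ) := by
      rw [hη, sum_apply]
      rfl
    have h1 : ∀ᵐ z ∂μ, ∀ u ∈ s, mulCLM μ (k u) (compCLM (hR u) ξ) z = (k u).1 z * ξ (R u z) := by
      rw [Finset.eventually_all]
      intro u _
      filter_upwards [coeFn_mulCLM (k u) (compCLM (hR u) ξ), coeFn_compCLM (hR u) ξ] with z h2 h3
      rw [h2, h3]
    filter_upwards [h1, Lp.coeFn_finsetSum s (fun u => mulCLM μ (k u) (compCLM (hR u) ξ))]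
      with z h2 h3
    rw [h0, h3, Finset.sum_apply]
    exact Finset.sum_congr rfl h2
  have hξm : Measurable (fun z => ENNReal.ofReal (‖ξ z‖ ^ 2)) :=
    ((Lp.stronglyMeasurable ξ).measurable.norm.pow_const 2).ennreal_ofReal
  have hkm : ∀ u, Measurable (fun z => ENNReal.ofReal ‖(k u).1 z‖) := fun u =>
    (k u).2.1.norm.ennreal_ofReal
  have hsq : ∀ ζ : Lp ℂ 2 μ, ∫⁻ z, ENNReal.ofReal (‖ζ z‖ ^ 2) ∂μ = ENNReal.ofReal (‖ζ‖ ^ 2) := by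
    intro ζ
    rw [← ofReal_integral_eq_lintegral_ofReal
      ((memLp_two_iff_integrable_sq_norm (Lp.aestronglyMeasurable ζ)).1 (Lp.memLp ζ))
      (ae_of_all _ fun z => by positivity)]
    congr 1
    have := L2.inner_def (𝕜 := ℂ) ζ ζ
    rw [inner_self_eq_norm_sq_to_K] at this
    have h2 : ∫ a, ⟪ζ a, ζ a⟫_ℂ ∂μ = ((∫ a, ‖ζ a‖ ^ 2 ∂μ : ℝ) : ℂ) := by
      rw [← integral_complex_ofReal]
      refine integral_congr_ae (ae_of_all _ fun a => ?_)
      simp only [inner_self_eq_norm_sq_to_K]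
      simp
    rw [h2] at this
    exact Complex.ofReal_injective (by simpa using this.symm)
  have key : ENNReal.ofReal (‖η‖ ^ 2) ≤ ENNReal.ofReal (A ^ 2 * ‖ξ‖ ^ 2) := by
    calc ENNReal.ofReal (‖η‖ ^ 2) = ∫⁻ z, ENNReal.ofReal (‖η z‖ ^ 2) ∂μ := (hsq η).symm
      _ ≤ ∫⁻ z, ENNReal.ofReal A * ∑ u ∈ s, ENNReal.ofReal ‖(k u).1 z‖ *
          ENNReal.ofReal (‖ξ (R u z)‖ ^ 2) ∂μ := by
        refine lintegral_mono_ae ?_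
        filter_upwards [hηz] with z hz
        have h1 : ‖η z‖ ^ 2 ≤ A * ∑ u ∈ s, ‖(k u).1 z‖ * ‖ξ (R u z)‖ ^ 2 := by
          have h2 : ‖η z‖ ≤ ∑ u ∈ s, ‖(k u).1 z‖ * ‖ξ (R u z)‖ := by
            rw [hz]
            refine (norm_sum_le _ _).trans (le_of_eq ?_)
            simp
          have h3 := Finset.sum_sq_le_sum_mul_sum_of_sq_le_mul s
            (r := fun u => ‖(k u).1 z‖ * ‖ξ (R u z)‖) (f := fun u => ‖(k u).1 z‖)
            (g := fun u => ‖(k u).1 z‖ * ‖ξ (R u z)‖ ^ 2) (fun u _ => by positivity)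
            (fun u _ => by positivity) (fun u _ => le_of_eq (by ring))
          calc ‖η z‖ ^ 2 ≤ (∑ u ∈ s, ‖(k u).1 z‖ * ‖ξ (R u z)‖) ^ 2 := by gcongr
            _ ≤ _ := h3
            _ ≤ _ := by
              gcongr
              exact hrow z
        refine (ENNReal.ofReal_le_ofReal h1).trans (le_of_eq ?_)
        rw [ENNReal.ofReal_mul hA0, ENNReal.ofReal_sum_of_nonneg (fun u _ => by positivity)]
        congr 1
        exact Finset.sum_congr rfl fun u _ => ENNReal.ofReal_mul (norm_nonneg _)
      _ = ENNReal.ofReal A * ∑ u ∈ s, ∫⁻ z, ENNReal.ofReal ‖(k u).1 z‖ *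
          ENNReal.ofReal (‖ξ (R u z)‖ ^ 2) ∂μ := by
        rw [lintegral_const_mul, lintegral_finsetSum]
        · exact fun u _ => (hkm u).mul (hξm.comp (hR u).measurable)
        · exact Finset.measurable_fun_sum _ fun u _ =>
            (hkm u).mul (hξm.comp (hR u).measurable)
      _ = ENNReal.ofReal A * ∑ u ∈ s, ∫⁻ z, ENNReal.ofReal ‖(k u).1 (R' u z)‖ *
          ENNReal.ofReal (‖ξ z‖ ^ 2) ∂μ := by
        congr 1
        refine Finset.sum_congr rfl fun u _ => ?_
        rw [← (hR' u).lintegral_comp (f := fun z => ENNReal.ofReal ‖(k u).1 z‖ *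
          ENNReal.ofReal (‖ξ (R u z)‖ ^ 2)) ((hkm u).mul (hξm.comp (hR u).measurable))]
        simp only [hRR]
      _ = ENNReal.ofReal A * ∫⁻ z, (∑ u ∈ s, ENNReal.ofReal ‖(k u).1 (R' u z)‖) *
          ENNReal.ofReal (‖ξ z‖ ^ 2) ∂μ := by
        congr 1
        rw [← lintegral_finsetSum]
        · simp only [Finset.sum_mul]
        · exact fun u _ => ((hkm u).comp (hR' u).measurable).mul hξm
      _ ≤ ENNReal.ofReal A * ∫⁻ z, ENNReal.ofReal A * ENNReal.ofReal (‖ξ z‖ ^ 2) ∂μ := by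
        gcongr with z
        rw [← ENNReal.ofReal_sum_of_nonneg (fun u _ => norm_nonneg _)]
        exact ENNReal.ofReal_le_ofReal (hcol z)
      _ = _ := by
        rw [lintegral_const_mul _ hξm, hsq, ENNReal.ofReal_mul (by positivity),
          ENNReal.ofReal_pow hA0]
        ring
  rw [ENNReal.ofReal_le_ofReal_iff (by positivity), ← mul_pow] at key
  exact (pow_le_pow_iff_left₀ (norm_nonneg _) (by positivity) two_ne_zero).1 key

end Operators

section Commute

variable {Z : Type*} [MeasurableSpace Z] {μ : Measure Z}

theorem inner_mulCLM_ind {E : Set Z} (hE : MeasurableSet E) (ξ η : Lp ℂ 2 μ) :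
    ⟪ξ, mulCLM μ (bddMeas.ind E hE) η⟫_ℂ = ∫ z in E, ⟪ξ z, η z⟫_ℂ ∂μ := by
  rw [L2.inner_def, ← integral_indicator hE]
  refine integral_congr_ae ?_
  filter_upwards [coeFn_mulCLM (μ := μ) (bddMeas.ind E hE) η] with z hz
  rw [hz, bddMeas.ind_apply]
  by_cases h : z ∈ E <;> simp [h]

theorem mulCLM_ind_inner {E : Set Z} (hE : MeasurableSet E) (ξ η : Lp ℂ 2 μ) :
    ⟪mulCLM μ (bddMeas.ind E hE) ξ, η⟫_ℂ = ∫ z in E, ⟪ξ z, η z⟫_ℂ ∂μ := by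
  rw [L2.inner_def, ← integral_indicator hE]
  refine integral_congr_ae ?_
  filter_upwards [coeFn_mulCLM (μ := μ) (bddMeas.ind E hE) ξ] with z hz
  rw [hz, bddMeas.ind_apply]
  by_cases h : z ∈ E <;> simp [h]

theorem commute_mulCLM_ind_iff {E : Set Z} (hE : MeasurableSet E)
    (h : Lp ℂ 2 μ →L[ℂ] Lp ℂ 2 μ) :
    Commute h (mulCLM μ (bddMeas.ind E hE)) ↔
      ∀ ξ η : Lp ℂ 2 μ, ∫ z in E, ⟪ContinuousLinearMap.adjoint h ξ z, η z⟫_ℂ ∂μ =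
        ∫ z in E, ⟪ξ z, h η z⟫_ℂ ∂μ := by
  have key : ∀ ξ η : Lp ℂ 2 μ, (⟪ξ, (h * mulCLM μ (bddMeas.ind E hE)) η⟫_ℂ =
      ⟪ξ, (mulCLM μ (bddMeas.ind E hE) * h) η⟫_ℂ ↔
      ∫ z in E, ⟪ContinuousLinearMap.adjoint h ξ z, η z⟫_ℂ ∂μ =
        ∫ z in E, ⟪ξ z, h η z⟫_ℂ ∂μ) := by
    intro ξ η
    rw [mul_apply_eq_comp, mul_apply_eq_comp, inner_mulCLM_ind,
      ← ContinuousLinearMap.adjoint_inner_left, inner_mulCLM_ind]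
  constructor
  · intro hc ξ η
    exact (key ξ η).1 (by rw [hc.eq])
  · intro hc
    ext1 η
    exact ext_inner_left ℂ fun ξ => (key ξ η).2 (hc ξ η)

/-- The measurable sets whose indicator functions commute with a given bounded operator
form a `σ`-algebra. -/
theorem commute_mulCLM_ind_of_generateFrom (h : Lp ℂ 2 μ →L[ℂ] Lp ℂ 2 μ) {𝒞 : Set (Set Z)}
    (h𝒞 : ∀ E ∈ 𝒞, ∃ hE : MeasurableSet E, Commute h (mulCLM μ (bddMeas.ind E hE)))
    {E : Set Z} (hE : MeasurableSet[MeasurableSpace.generateFrom 𝒞] E) :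
    ∃ hE : MeasurableSet E, Commute h (mulCLM μ (bddMeas.ind E hE)) := by
  have hmul_int : ∀ ξ η : Lp ℂ 2 μ, Integrable (fun z => ⟪ξ z, η z⟫_ℂ) μ := fun ξ η =>
    L2.integrable_inner ξ η
  have hdiff : ∀ t s : Set Z,
      (∃ hE : MeasurableSet t, Commute h (mulCLM μ (bddMeas.ind t hE))) →
      (∃ hE : MeasurableSet s, Commute h (mulCLM μ (bddMeas.ind s hE))) →
      ∃ hE : MeasurableSet (t \ s), Commute h (mulCLM μ (bddMeas.ind (t \ s) hE)) := by
    rintro t s ⟨ht, hct⟩ ⟨hs, hcs⟩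
    refine ⟨ht.diff hs, ?_⟩
    have h1 : bddMeas.ind (t \ s) (ht.diff hs) =
        bddMeas.ind t ht * (1 - bddMeas.ind s hs) := by
      refine Subtype.ext (funext fun z => ?_)
      rw [Subalgebra.coe_mul, Subalgebra.coe_sub, Subalgebra.coe_one, Pi.mul_apply, Pi.sub_apply,
        Pi.one_apply, bddMeas.ind_apply, bddMeas.ind_apply, bddMeas.ind_apply]
      by_cases hzt : z ∈ t <;> by_cases hzs : z ∈ s <;> simp [hzt, hzs]
    rw [h1, ← mulHom_apply, map_mul, map_sub, map_one, mulHom_apply, mulHom_apply]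
    exact hct.mul_right ((Commute.one_right h).sub_right hcs)
  have huniv : ∃ hE : MeasurableSet (Set.univ : Set Z),
      Commute h (mulCLM μ (bddMeas.ind Set.univ hE)) := by
    refine ⟨MeasurableSet.univ, ?_⟩
    rw [commute_mulCLM_ind_iff]
    intro ξ η
    rw [Measure.restrict_univ, ← L2.inner_def, ← L2.inner_def,
      ContinuousLinearMap.adjoint_inner_left]
  induction E, hE using MeasurableSpace.generateFrom_induction with
  | hC t ht _ => exact h𝒞 t ht
  | empty => simpa using hdiff _ _ huniv huniv
  | compl t _ ht =>
    rw [Set.compl_eq_univ_sdiff]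
    exact hdiff _ _ huniv ht
  | iUnion s _ hs =>
    have hd : ∀ i, ∃ hE : MeasurableSet (disjointed s i),
        Commute h (mulCLM μ (bddMeas.ind (disjointed s i) hE)) := fun i =>
      disjointedRec (p := fun t => ∃ hE : MeasurableSet t,
        Commute h (mulCLM μ (bddMeas.ind t hE))) (fun _ j hj => hdiff _ _ hj (hs j)) (hs i)
    rw [← iUnion_disjointed]
    refine ⟨MeasurableSet.iUnion fun i => (hd i).1, ?_⟩
    rw [commute_mulCLM_ind_iff]
    intro ξ η
    refine HasSum.unique (hasSum_integral_iUnion (fun i => (hd i).1) (disjoint_disjointed s)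
      (hmul_int _ _).integrableOn) ?_
    convert hasSum_integral_iUnion (fun i => (hd i).1) (disjoint_disjointed s)
      (hmul_int ξ (h η)).integrableOn using 2 with i
    exact (commute_mulCLM_ind_iff (hd i).1 h).1 (hd i).2 ξ η

end Commute

section Vectors

variable {Y G : Type*} [MeasurableSpace Y] [Countable G] [MeasurableSpace G]
  [DiscreteMeasurableSpace G] (ν : Measure Y) [IsProbabilityMeasure ν]

open Classical in
theorem memLp_vec (s : G) (q : bddMeas Y) :
    MemLp (fun z : Y × G => if z.2 = s then q.1 z.1 else 0) 2 (ν.prod Measure.count) := by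
  obtain ⟨A, hA⟩ := q.2.2
  have hs : MeasurableSet ((Set.univ : Set Y) ×ˢ ({s} : Set G)) :=
    MeasurableSet.univ.prod (measurableSet_singleton s)
  have h1 : MemLp (((Set.univ : Set Y) ×ˢ ({s} : Set G)).indicator fun _ => (1 : ℂ)) 2
      (ν.prod Measure.count) := by
    refine memLp_indicator_const 2 hs 1 (Or.inr ?_)
    rw [Measure.prod_prod]
    simp
  refine h1.of_le_mul (c := A) ?_ (ae_of_all _ fun z => ?_)
  · refine Measurable.aestronglyMeasurable ?_
    exact Measurable.ite (measurable_snd (measurableSet_singleton s))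
      (q.2.1.comp measurable_fst) measurable_const
  · by_cases h : z.2 = s
    · simpa [h] using hA z.1
    · simp [h]

/-- The vector of `L²(Y × G)` which is the bounded function `q` on the fibre over `s` and
vanishes elsewhere. -/
noncomputable def fibreVec (s : G) (q : bddMeas Y) : Lp ℂ 2 (ν.prod (Measure.count : Measure G)) :=
  (memLp_vec ν s q).toLp _

open Classical in
theorem coeFn_fibreVec (s : G) (q : bddMeas Y) :
    fibreVec ν s q =ᵐ[ν.prod Measure.count] fun z => if z.2 = s then q.1 z.1 else 0 :=
  MemLp.coeFn_toLp _

theorem mulCLM_fibreVec (m : bddMeas (Y × G)) (s : G) (q : bddMeas Y) :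
    mulCLM _ m (fibreVec ν s q) =
      fibreVec ν s (bddMeas.comp m (fun y => (y, s)) measurable_prodMk_right * q) := by
  refine Lp.ext ?_
  filter_upwards [coeFn_mulCLM m (fibreVec ν s q), coeFn_fibreVec ν s q, coeFn_fibreVec ν s
    (bddMeas.comp m (fun y => (y, s)) measurable_prodMk_right * q)] with z h1 h2 h3
  rw [h1, h2, h3]
  obtain ⟨y, t⟩ := z
  by_cases h : t = s
  · subst h
    simp only [if_true]
    rfl
  · simp [h]

theorem compCLM_fibreVec {f : Y × G → Y × G}
    (hf : MeasurePreserving f (ν.prod Measure.count) (ν.prod Measure.count)) {s t : G}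
    {τ : Y → Y} (hτ : Measurable τ) (h : ∀ z, (f z).2 = s ↔ z.2 = t) (h' : ∀ y, (f (y, t)).1 = τ y)
    (q : bddMeas Y) :
    compCLM hf (fibreVec ν s q) = fibreVec ν t (bddMeas.comp q τ hτ) := by
  refine Lp.ext ?_
  filter_upwards [coeFn_compCLM hf (fibreVec ν s q), hf.quasiMeasurePreserving.ae
    (coeFn_fibreVec ν s q), coeFn_fibreVec ν t (bddMeas.comp q τ hτ)] with z h1 h2 h3
  rw [h1, h2, h3]
  obtain ⟨y, r⟩ := z
  by_cases hr : r = t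
  · subst hr
    rw [if_pos ((h _).2 rfl), if_pos rfl, h']
    rfl
  · rw [if_neg (fun h4 => hr ((h _).1 h4)), if_neg hr]

theorem inner_fibreVec_of_ne {s t : G} (hst : s ≠ t) (q q' : bddMeas Y) :
    ⟪fibreVec ν s q, fibreVec ν t q'⟫_ℂ = 0 := by
  rw [L2.inner_def]
  refine integral_eq_zero_of_ae ?_
  filter_upwards [coeFn_fibreVec ν s q, coeFn_fibreVec ν t q'] with z h1 h2
  rw [h1, h2]
  by_cases hs : z.2 = s
  · rw [if_neg (fun h => hst (hs.symm.trans h)), inner_zero_right]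
    rfl
  · rw [if_neg hs, inner_zero_left]
    rfl

theorem inner_fibreVec (s : G) (q q' : bddMeas Y) :
    ⟪fibreVec ν s q, fibreVec ν s q'⟫_ℂ = ∫ y, ⟪q.1 y, q'.1 y⟫_ℂ ∂ν := by
  have hs : MeasurableSet ((Set.univ : Set Y) ×ˢ ({s} : Set G)) :=
    MeasurableSet.univ.prod (measurableSet_singleton s)
  have h1 : ⟪fibreVec ν s q, fibreVec ν s q'⟫_ℂ =
      ∫ z in (Set.univ : Set Y) ×ˢ ({s} : Set G), ⟪q.1 z.1, q'.1 z.1⟫_ℂ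
        ∂(ν.prod Measure.count) := by
    rw [L2.inner_def, ← integral_indicator hs]
    refine integral_congr_ae ?_
    filter_upwards [coeFn_fibreVec ν s q, coeFn_fibreVec ν s q'] with z h1 h2
    rw [h1, h2]
    by_cases h : z.2 = s <;> simp [h]
  have hm : Measurable fun y => ⟪q.1 y, q'.1 y⟫_ℂ := q.2.1.inner q'.2.1
  rw [h1, ← Measure.prod_restrict, Measure.restrict_univ, Measure.restrict_singleton,
    Measure.count_singleton, one_smul, Measure.prod_dirac, integral_map]
  · exact measurable_prodMk_right.aemeasurable
  · exact (hm.comp measurable_fst).aestronglyMeasurable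

end Vectors

/-- A homomorphism `Γ → G`, a measure preserving action of `G` on `Y`, and a unimodular cocycle
of `Γ` over it. -/
structure TwistedAction (Γ G : Type*) {Y : Type*} [Group Γ] [Group G] [MeasurableSpace Y]
    (ν : Measure Y) where
  φ : Γ →* G
  τ : G → Y → Y
  measurePreserving : ∀ g, MeasurePreserving (τ g) ν ν
  τ_one : ∀ y, τ 1 y = y
  τ_mul : ∀ g h y, τ (g * h) y = τ g (τ h y)
  χ : Γ → bddMeas Y
  norm_χ : ∀ γ y, ‖(χ γ).1 y‖ = 1
  χ_mul : ∀ γ γ' y, (χ (γ * γ')).1 y = (χ γ).1 y * (χ γ').1 (τ (φ γ)⁻¹ y)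

namespace TwistedAction

variable {Γ G Y : Type*} [Group Γ] [Group G] [MeasurableSpace Y] {ν : Measure Y}
  (A : TwistedAction Γ G ν)

theorem χ_one (y : Y) : (A.χ 1).1 y = 1 := by
  have h := A.χ_mul 1 1 y
  rw [map_one, inv_one, A.τ_one, mul_one] at h
  have h0 : (A.χ 1).1 y ≠ 0 := fun h0 => by simpa [h0] using A.norm_χ 1 y
  exact (mul_left_cancel₀ h0 (by rw [mul_one, ← h])).symm

theorem χ_inv (γ : Γ) (y : Y) :
    (A.χ γ⁻¹).1 y = starRingEnd ℂ ((A.χ γ).1 (A.τ (A.φ γ) y)) := by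
  have h := A.χ_mul γ⁻¹ γ y
  rw [inv_mul_cancel, A.χ_one, map_inv, inv_inv] at h
  rw [← Complex.inv_eq_conj (A.norm_χ _ _)]
  exact eq_inv_of_mul_eq_one_left h.symm

variable [Countable G] [MeasurableSpace G] [DiscreteMeasurableSpace G] [IsProbabilityMeasure ν]

omit [Group G] [Countable G] in
theorem measurePreserving_count_equiv (σ : Equiv.Perm G) :
    MeasurePreserving σ (Measure.count : Measure G) Measure.count := by
  refine ⟨.of_discrete, ?_⟩
  ext E hE
  rw [Measure.map_apply .of_discrete hE, Measure.count_apply .of_discrete, Measure.count_apply hE,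
    Set.encard_preimage_of_bijective σ.bijective]

theorem measurePreserving_left (g : G) :
    MeasurePreserving (fun z : Y × G => (A.τ g⁻¹ z.1, g⁻¹ * z.2)) (ν.prod Measure.count)
      (ν.prod Measure.count) :=
  (A.measurePreserving g⁻¹).prod (measurePreserving_count_equiv (Equiv.mulLeft g⁻¹))

variable (ν) in
theorem measurePreserving_right (u : G) :
    MeasurePreserving (fun z : Y × G => (z.1, z.2 * u)) (ν.prod Measure.count)
      (ν.prod Measure.count) :=
  (MeasurePreserving.id ν).prod (measurePreserving_count_equiv (Equiv.mulRight u))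

/-- The twisted translation representation on `L²(Y × G)`. -/
noncomputable def rep : Γ →* (Lp ℂ 2 (ν.prod (Measure.count : Measure G)) →L[ℂ]
    Lp ℂ 2 (ν.prod (Measure.count : Measure G))) where
  toFun γ := mulCLM _ (bddMeas.comp (A.χ γ) Prod.fst measurable_fst) *
    compCLM (A.measurePreserving_left (A.φ γ))
  map_one' := by
    ext1 ξ
    refine Lp.ext ?_
    rw [mul_apply_eq_comp]
    filter_upwards [coeFn_mulCLM (bddMeas.comp (A.χ 1) Prod.fst measurable_fst)
      (compCLM (A.measurePreserving_left (A.φ 1)) ξ), coeFn_compCLM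
      (A.measurePreserving_left (A.φ 1)) ξ] with z h1 h2
    rw [h1, h2, map_one, inv_one, A.τ_one, one_mul]
    change (A.χ 1).1 z.1 * _ = _
    rw [A.χ_one, one_mul]
    rfl
  map_mul' γ γ' := by
    have h := compCLM_mul_compCLM (A.measurePreserving_left (A.φ γ))
      (A.measurePreserving_left (A.φ γ')) (A.measurePreserving_left (A.φ (γ * γ')))
      (fun z => by
        rw [map_mul, mul_inv_rev, A.τ_mul, mul_assoc])
    rw [mul_assoc, ← mul_assoc (compCLM _), compCLM_mul_mulCLM, mul_assoc (mulCLM _ _), h,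
      ← mul_assoc, ← mulHom_apply, ← mulHom_apply, ← mulHom_apply, ← map_mul]
    congr 2
    refine Subtype.ext (funext fun z => ?_)
    exact A.χ_mul γ γ' z.1

theorem rep_apply (γ : Γ) : A.rep γ = mulCLM _ (bddMeas.comp (A.χ γ) Prod.fst measurable_fst) *
    compCLM (A.measurePreserving_left (A.φ γ)) := rfl

omit [Countable G] [MeasurableSpace G] [DiscreteMeasurableSpace G] [IsProbabilityMeasure ν] in
theorem _root_.norm_compCLM_le {Z : Type*} [MeasurableSpace Z] {μ : Measure Z} {f : Z → Z}
    (hf : MeasurePreserving f μ μ) : ‖compCLM hf‖ ≤ 1 :=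
  ContinuousLinearMap.opNorm_le_bound _ zero_le_one fun ξ => by
    rw [norm_compCLM_apply, one_mul]

theorem norm_rep_le (γ : Γ) : ‖A.rep γ‖ ≤ 1 := by
  refine (norm_mul_le _ _).trans (mul_le_one₀ ?_ (norm_nonneg _) (norm_compCLM_le _))
  exact norm_mulCLM_le _ zero_le_one fun z => (A.norm_χ γ z.1).le

theorem rep_fibreVec (γ : Γ) (s : G) (q : bddMeas Y) :
    A.rep γ (fibreVec ν s q) = fibreVec ν (A.φ γ * s) (A.χ γ *
      bddMeas.comp q (A.τ (A.φ γ)⁻¹) (A.measurePreserving _).measurable) := by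
  rw [rep_apply, mul_apply_eq_comp, compCLM_fibreVec ν (A.measurePreserving_left (A.φ γ))
    (t := A.φ γ * s) (A.measurePreserving _).measurable (fun z => ?_) (fun y => rfl),
    mulCLM_fibreVec]
  · rfl
  · exact inv_mul_eq_iff_eq_mul

/-- A random `[0,1]`-valued weight on ordered pairs in `G` with bounded row sums over `S`,
whose symmetrization is equivariant. -/
structure Weight (S : Finset G) (c : ℝ) where
  a : G → G → Y → ℝ
  measurable : ∀ s t, Measurable (a s t)
  nonneg : ∀ s t y, 0 ≤ a s t y
  le_one : ∀ s t y, a s t y ≤ 1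
  row : ∀ y s, ∑ u ∈ S, a s (s * u) y ≤ c
  equivariant : ∀ x y s t,
    a (x * s) (x * t) (A.τ x y) + a (x * t) (x * s) (A.τ x y) = a s t y + a t s y

namespace Weight

variable {A} {S : Finset G} {c : ℝ} (w : A.Weight S c) (l : G → Γ)

/-- The kernel of the convolution operator associated with a weight and a section of `φ`. -/
noncomputable def kernel (u : G) : bddMeas (Y × G) :=
  ⟨fun z => (w.a z.2 (z.2 * u) z.1 : ℂ) * starRingEnd ℂ ((A.χ (l u)).1 (A.τ z.2⁻¹ z.1)), by
    refine measurable_from_prod_countable_left fun s => ?_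
    exact (Complex.measurable_ofReal.comp (w.measurable s (s * u))).mul
      (Complex.continuous_conj.measurable.comp ((A.χ (l u)).2.1.comp
        (A.measurePreserving s⁻¹).measurable)), 1, fun z => by
    rw [norm_mul, RCLike.norm_conj, A.norm_χ, mul_one, Complex.norm_real, Real.norm_eq_abs,
      abs_of_nonneg (w.nonneg _ _ _)]
    exact w.le_one _ _ _⟩

omit [IsProbabilityMeasure ν] in
theorem kernel_apply (u : G) (z : Y × G) : (w.kernel l u).1 z =
    (w.a z.2 (z.2 * u) z.1 : ℂ) * starRingEnd ℂ ((A.χ (l u)).1 (A.τ z.2⁻¹ z.1)) := rfl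

/-- The convolution operator associated with a weight and a section of `φ`. -/
noncomputable def op : Lp ℂ 2 (ν.prod (Measure.count : Measure G)) →L[ℂ]
    Lp ℂ 2 (ν.prod (Measure.count : Measure G)) :=
  ∑ u ∈ S, mulCLM _ (w.kernel l u) * compCLM (measurePreserving_right ν u)

theorem rep_mul_op_sub (γ : Γ) : A.rep γ * w.op l - w.op l * A.rep γ =
    (∑ u ∈ S, mulCLM _ (bddMeas.comp (A.χ γ) Prod.fst measurable_fst *
      (bddMeas.comp (w.kernel l u) (fun z => (A.τ (A.φ γ)⁻¹ z.1, (A.φ γ)⁻¹ * z.2))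
        (A.measurePreserving_left (A.φ γ)).measurable - w.kernel l u)) *
      compCLM (measurePreserving_right ν u)) * compCLM (A.measurePreserving_left (A.φ γ)) := by
  rw [op, Finset.mul_sum, Finset.sum_mul, Finset.sum_mul, ← Finset.sum_sub_distrib]
  refine Finset.sum_congr rfl fun u _ => ?_
  have hLR : compCLM (A.measurePreserving_left (A.φ γ)) * compCLM (measurePreserving_right ν u) =
      compCLM (measurePreserving_right ν u) * compCLM (A.measurePreserving_left (A.φ γ)) := by
    have hk := (A.measurePreserving_left (A.φ γ)).comp (measurePreserving_right ν u)
    exact (compCLM_mul_compCLM _ _ hk fun z => by simp [mul_assoc]).trans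
      (compCLM_mul_compCLM (measurePreserving_right ν u) (A.measurePreserving_left (A.φ γ)) hk
        fun z => rfl).symm
  have hR : compCLM (measurePreserving_right ν u) *
      mulCLM (ν.prod (Measure.count : Measure G)) (bddMeas.comp (A.χ γ) Prod.fst measurable_fst) =
      mulCLM _ (bddMeas.comp (A.χ γ) Prod.fst measurable_fst) *
        compCLM (measurePreserving_right ν u) := compCLM_mul_mulCLM _ _
  have hcomm : mulCLM (ν.prod Measure.count) (w.kernel l u) *
      mulCLM _ (bddMeas.comp (A.χ γ) Prod.fst measurable_fst) =
      mulCLM _ (bddMeas.comp (A.χ γ) Prod.fst measurable_fst) * mulCLM _ (w.kernel l u) := by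
    rw [← mulHom_apply, ← mulHom_apply, ← map_mul, ← map_mul, mul_comm]
  rw [← mulHom_apply (bddMeas.comp (A.χ γ) _ _ * _), map_mul, map_sub, mulHom_apply, mulHom_apply,
    mulHom_apply, rep_apply, mul_assoc, ← mul_assoc (compCLM _), compCLM_mul_mulCLM,
    mul_assoc (mulCLM _ _) (compCLM _), hLR, mul_assoc (mulCLM _ (w.kernel l u)),
    ← mul_assoc (compCLM _) (mulCLM _ _), hR, ← mul_assoc (mulCLM _ (w.kernel l u)),
    ← mul_assoc (mulCLM _ (w.kernel l u)), hcomm]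
  simp only [mul_assoc, sub_mul, mul_sub]

theorem norm_rep_mul_op_sub_le (hc : 0 ≤ c) (hS : ∀ s ∈ S, s⁻¹ ∈ S) (γ : Γ) :
    ‖A.rep γ * w.op l - w.op l * A.rep γ‖ ≤ 2 * c := by
  rw [rep_mul_op_sub]
  refine (norm_mul_le _ _).trans ((mul_le_mul ?_ (norm_compCLM_le _) (norm_nonneg _)
    (by positivity)).trans (mul_one _).le)
  have hnorm : ∀ u (z : Y × G), ‖(bddMeas.comp (A.χ γ) Prod.fst measurable_fst *
      (bddMeas.comp (w.kernel l u) (fun z : Y × G => (A.τ (A.φ γ)⁻¹ z.1, (A.φ γ)⁻¹ * z.2))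
        (A.measurePreserving_left (A.φ γ)).measurable - w.kernel l u)).1 z‖ =
      |w.a ((A.φ γ)⁻¹ * z.2) ((A.φ γ)⁻¹ * (z.2 * u)) (A.τ (A.φ γ)⁻¹ z.1) -
        w.a z.2 (z.2 * u) z.1| := by
    intro u z
    change ‖(A.χ γ).1 z.1 * ((w.kernel l u).1 (A.τ (A.φ γ)⁻¹ z.1, (A.φ γ)⁻¹ * z.2) -
      (w.kernel l u).1 z)‖ = _
    rw [norm_mul, A.norm_χ, one_mul, kernel_apply, kernel_apply, mul_inv_rev, inv_inv, A.τ_mul,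
      ← A.τ_mul (A.φ γ), mul_inv_cancel, A.τ_one, ← sub_mul, norm_mul, RCLike.norm_conj, A.norm_χ,
      mul_one, ← Complex.ofReal_sub, Complex.norm_real, Real.norm_eq_abs, mul_assoc]
  have habs : ∀ x y : ℝ, 0 ≤ x → 0 ≤ y → |x - y| ≤ x + y := fun x y hx hy =>
    abs_sub_le_iff.2 ⟨by linarith, by linarith⟩
  refine norm_sum_mulCLM_mul_compCLM_le S _ (fun u => measurePreserving_right ν u)
    (fun u => measurePreserving_right ν u⁻¹) (fun u z => by simp) (by positivity)
    (fun z => ?_) (fun z => ?_)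
  · simp only [hnorm]
    refine (Finset.sum_le_sum fun u _ => habs _ _ (w.nonneg _ _ _) (w.nonneg _ _ _)).trans ?_
    rw [Finset.sum_add_distrib, two_mul]
    refine add_le_add ?_ (w.row _ _)
    simpa only [mul_assoc] using w.row (A.τ (A.φ γ)⁻¹ z.1) ((A.φ γ)⁻¹ * z.2)
  · simp only [hnorm, inv_mul_cancel_right]
    have h1 : ∀ u, |w.a ((A.φ γ)⁻¹ * (z.2 * u⁻¹)) ((A.φ γ)⁻¹ * z.2) (A.τ (A.φ γ)⁻¹ z.1) -
        w.a (z.2 * u⁻¹) z.2 z.1| ≤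
        w.a ((A.φ γ)⁻¹ * z.2) ((A.φ γ)⁻¹ * (z.2 * u⁻¹)) (A.τ (A.φ γ)⁻¹ z.1) +
        w.a z.2 (z.2 * u⁻¹) z.1 := by
      intro u
      have h2 := w.equivariant (A.φ γ)⁻¹ z.1 z.2 (z.2 * u⁻¹)
      refine le_trans (le_of_eq ?_) (habs _ _ (w.nonneg _ _ _) (w.nonneg _ _ _))
      rw [abs_sub_comm (w.a ((A.φ γ)⁻¹ * z.2) _ _)]
      congr 1
      linarith
    refine (Finset.sum_le_sum fun u _ => h1 u).trans ?_
    rw [Finset.sum_add_distrib, two_mul]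
    have h3 : ∀ f : G → ℝ, ∑ u ∈ S, f u⁻¹ = ∑ u ∈ S, f u := fun f =>
      Finset.sum_nbij' (fun u => u⁻¹) (fun u => u⁻¹) hS hS (fun u _ => inv_inv u)
        (fun u _ => inv_inv u) (fun u _ => rfl)
    rw [h3 fun u => w.a ((A.φ γ)⁻¹ * z.2) ((A.φ γ)⁻¹ * (z.2 * u)) (A.τ (A.φ γ)⁻¹ z.1),
      h3 fun u => w.a z.2 (z.2 * u) z.1]
    refine add_le_add ?_ (w.row _ _)
    simpa only [mul_assoc] using w.row (A.τ (A.φ γ)⁻¹ z.1) ((A.φ γ)⁻¹ * z.2)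

end Weight

end TwistedAction

section Real

variable {Z : Type*} [MeasurableSpace Z] {μ : Measure Z}

/-- A function on the base, as a function on the product. -/
noncomputable abbrev bddLift (G : Type*) {Y : Type*} [MeasurableSpace Y]
    [MeasurableSpace G] (q : bddMeas Y) : bddMeas (Y × G) :=
  bddMeas.comp q Prod.fst measurable_fst

theorem inner_mulCLM_ind_left {E : Set Z} (hE : MeasurableSet E) (ξ η : Lp ℂ 2 μ) :
    ⟪mulCLM μ (bddMeas.ind E hE) ξ, η⟫_ℂ = ⟪ξ, mulCLM μ (bddMeas.ind E hE) η⟫_ℂ := by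
  rw [inner_mulCLM_ind, mulCLM_ind_inner]

theorem inner_compCLM_compCLM {f : Z → Z} (hf : MeasurePreserving f μ μ) (ξ η : Lp ℂ 2 μ) :
    ⟪compCLM hf ξ, compCLM hf η⟫_ℂ = ⟪ξ, η⟫_ℂ :=
  (Lp.compMeasurePreservingₗᵢ ℂ f hf).inner_map_map ξ η

theorem inner_mulCLM_mulCLM {m : bddMeas Z} (hm : ∀ z, ‖m.1 z‖ = 1) (ξ η : Lp ℂ 2 μ) :
    ⟪mulCLM μ m ξ, mulCLM μ m η⟫_ℂ = ⟪ξ, η⟫_ℂ := by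
  rw [L2.inner_def, L2.inner_def]
  refine integral_congr_ae ?_
  filter_upwards [coeFn_mulCLM m ξ, coeFn_mulCLM m η] with z h1 h2
  rw [h1, h2, RCLike.inner_apply, RCLike.inner_apply, map_mul]
  have := Complex.mul_conj' (m.1 z)
  rw [hm] at this
  calc m.1 z * η z * (starRingEnd ℂ (m.1 z) * starRingEnd ℂ (ξ z))
      = m.1 z * starRingEnd ℂ (m.1 z) * (η z * starRingEnd ℂ (ξ z)) := by ring
    _ = _ := by rw [this]; simp

end Real

namespace TwistedAction

variable {Γ G Y : Type*} [Group Γ] [Group G] [MeasurableSpace Y] {ν : Measure Y}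
  {A : TwistedAction Γ G ν} [Countable G] [MeasurableSpace G] [DiscreteMeasurableSpace G]
  [IsProbabilityMeasure ν]

theorem inner_rep_rep (γ : Γ) (ξ η : Lp ℂ 2 (ν.prod (Measure.count : Measure G))) :
    ⟪A.rep γ ξ, A.rep γ η⟫_ℂ = ⟪ξ, η⟫_ℂ := by
  rw [rep_apply, mul_apply_eq_comp, mul_apply_eq_comp,
    inner_mulCLM_mulCLM fun z => A.norm_χ γ z.1, inner_compCLM_compCLM]

theorem inner_rep_right (γ : Γ) (ξ η : Lp ℂ 2 (ν.prod (Measure.count : Measure G))) :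
    ⟪ξ, A.rep γ η⟫_ℂ = ⟪A.rep γ⁻¹ ξ, η⟫_ℂ := by
  rw [← inner_rep_rep γ⁻¹ ξ, ← mul_apply_eq_comp, ← map_mul, inv_mul_cancel, map_one]
  rfl

omit [Group G] in
theorem inner_sum_fibreVec {ι : Type*} (I : Finset ι) {σ : ι → G} (hσ : Function.Injective σ)
    (p q : ι → bddMeas Y) :
    ⟪∑ i ∈ I, fibreVec ν (σ i) (p i), ∑ i ∈ I, fibreVec ν (σ i) (q i)⟫_ℂ =
      ∑ i ∈ I, ∫ y, ⟪(p i).1 y, (q i).1 y⟫_ℂ ∂ν := by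
  rw [sum_inner]
  refine Finset.sum_congr rfl fun i hi => ?_
  rw [inner_sum, Finset.sum_eq_single i, inner_fibreVec]
  · exact fun j _ hj => inner_fibreVec_of_ne ν (fun h => hj (hσ h).symm) _ _
  · exact fun h => (h hi).elim

namespace Weight

variable {S : Finset G} {c : ℝ} (w : A.Weight S c) (l : G → Γ)

theorem op_fibreVec (s : G) (q : bddMeas Y) :
    w.op l (fibreVec ν s q) = ∑ u ∈ S, fibreVec ν (s * u⁻¹)
      (bddMeas.comp (w.kernel l u) (fun y => (y, s * u⁻¹)) measurable_prodMk_right * q) := by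
  rw [op, sum_apply]
  refine Finset.sum_congr rfl fun u _ => ?_
  rw [mul_apply_eq_comp, compCLM_fibreVec ν (measurePreserving_right ν u) (t := s * u⁻¹)
    measurable_id (fun z => ?_) (fun y => rfl), mulCLM_fibreVec]
  · rfl
  · exact eq_mul_inv_iff_mul_eq.symm

omit [Countable G] [MeasurableSpace G] [DiscreteMeasurableSpace G] in
theorem integrable_weight (s t : G) : Integrable (w.a s t) ν :=
  Integrable.of_bound (w.measurable s t).aestronglyMeasurable 1 (ae_of_all _ fun y => by
    rw [Real.norm_eq_abs, abs_of_nonneg (w.nonneg s t y)]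
    exact w.le_one s t y)

section Energy

variable {F : G → Set Y}

omit [Countable G] [MeasurableSpace G] [DiscreteMeasurableSpace G] [IsProbabilityMeasure ν] in
theorem mem_iff_of_weight
    (ha : ∀ u y, w.a 1 u y + w.a u 1 y = (F u).indicator 1 y)
    (u : G) (y : Y) : A.τ u y ∈ F u ↔ y ∈ F u⁻¹ := by
  have h := w.equivariant u y u⁻¹ 1
  rw [mul_inv_cancel, mul_one, ha, add_comm, ha] at h
  by_cases h1 : A.τ u y ∈ F u <;> by_cases h2 : y ∈ F u⁻¹ <;> simp_all

omit [Countable G] [MeasurableSpace G] [DiscreteMeasurableSpace G] [IsProbabilityMeasure ν] in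
theorem weight_left_eq_zero
    (ha : ∀ u y, w.a 1 u y + w.a u 1 y = (F u).indicator 1 y)
    {u : G} {y : Y} (hy : y ∉ F u) : w.a 1 u y = 0 := by
  have h := ha u y
  rw [Set.indicator_of_notMem hy] at h
  linarith [w.nonneg 1 u y, w.nonneg u 1 y]

omit [Countable G] [MeasurableSpace G] [DiscreteMeasurableSpace G] [IsProbabilityMeasure ν] in
theorem weight_right_eq_zero
    (ha : ∀ u y, w.a 1 u y + w.a u 1 y = (F u).indicator 1 y)
    {u : G} {y : Y} (hy : y ∉ F u) : w.a u 1 y = 0 := by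
  have h := ha u y
  rw [Set.indicator_of_notMem hy] at h
  linarith [w.nonneg 1 u y, w.nonneg u 1 y]

omit [Countable G] [MeasurableSpace G] [DiscreteMeasurableSpace G] in
theorem sum_integral_weight_le
    (ha : ∀ u y, w.a 1 u y + w.a u 1 y = (F u).indicator 1 y)
    {V : Set Y} (hV : MeasurableSet V) (hFV : ∀ u, F u ⊆ V) :
    ∑ u ∈ S, ∫ y, w.a 1 u y ∂ν ≤ c * ν.real V := by
  rw [← integral_finsetSum _ fun u _ => w.integrable_weight 1 u]
  have h1 : ∫ y, V.indicator (fun _ => c) y ∂ν = c * ν.real V := by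
    rw [integral_indicator_const _ hV, smul_eq_mul, mul_comm]
  rw [← h1]
  refine integral_mono (integrable_finsetSum _ fun u _ => w.integrable_weight 1 u)
    ((integrable_const c).indicator hV) fun y => ?_
  by_cases hy : y ∈ V
  · rw [Set.indicator_of_mem hy]
    simpa using w.row y 1
  · rw [Set.indicator_of_notMem hy]
    exact (Finset.sum_eq_zero fun u _ => weight_left_eq_zero w ha fun h => hy (hFV u h)).le

set_option maxHeartbeats 1000000 in
/-- The energy inequality: if the convolution operator of a weight is within a bounded
operator `B` of commuting with the representation and with the edge events, then the expected
number of edges at the origin is controlled by the probability of the origin being occupied. -/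
theorem energy_le {l : G → Γ} (hl : ∀ u, A.φ (l u) = u)
    (ha : ∀ u y, w.a 1 u y + w.a u 1 y = (F u).indicator 1 y)
    (hF : ∀ u, MeasurableSet (F u)) (hS : ∀ s ∈ S, s⁻¹ ∈ S) {V : Set Y} (hV : MeasurableSet V)
    (hFV : ∀ u, F u ⊆ V)
    (B : Lp ℂ 2 (ν.prod (Measure.count : Measure G)) →L[ℂ]
      Lp ℂ 2 (ν.prod (Measure.count : Measure G)))
    (hB : ∀ γ, Commute (A.rep γ) (w.op l - B))
    (hBF : ∀ u, Commute (w.op l - B) (mulCLM _ (bddLift G (bddMeas.ind (F u) (hF u))))) :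
    ∑ u ∈ S, ν.real (F u) ≤ 2 * (c * ν.real V) +
      2 * ‖B‖ * √(ν.real V * ∑ u ∈ S, ν.real (F u)) := by
  set h := w.op l - B with hdef
  let m : G → bddMeas Y := fun u => bddMeas.ind (F u) (hF u)
  let v : Lp ℂ 2 (ν.prod (Measure.count : Measure G)) := fibreVec ν 1 (bddMeas.ind V hV)
  let δ : Lp ℂ 2 (ν.prod (Measure.count : Measure G)) := fibreVec ν 1 1
  let x : Lp ℂ 2 (ν.prod (Measure.count : Measure G)) :=
    ∑ u ∈ S, mulCLM _ (bddLift G (m u)) (A.rep (l u) δ)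
  let x' : Lp ℂ 2 (ν.prod (Measure.count : Measure G)) :=
    ∑ u ∈ S, mulCLM _ (bddLift G (m u⁻¹)) (A.rep (l u)⁻¹ δ)
  have hmv : ∀ u, mulCLM _ (bddLift G (m u)) v = mulCLM _ (bddLift G (m u)) δ := by
    intro u
    rw [mulCLM_fibreVec, mulCLM_fibreVec]
    congr 1
    refine Subtype.ext (funext fun y => ?_)
    change (F u).indicator (1 : Y → ℂ) y * V.indicator (1 : Y → ℂ) y =
      (F u).indicator (1 : Y → ℂ) y * (1 : ℂ)
    by_cases hy : y ∈ F u
    · simp [hy, hFV u hy]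
    · simp [hy]
  have hsymm : ∀ u ξ η, ⟪mulCLM (ν.prod (Measure.count : Measure G)) (bddLift G (m u)) ξ, η⟫_ℂ =
      ⟪ξ, mulCLM _ (bddLift G (m u)) η⟫_ℂ := fun u ξ η =>
    inner_mulCLM_ind_left (measurable_fst (hF u)) ξ η
  have hhm : ∀ u ξ, h (mulCLM _ (bddLift G (m u)) ξ) = mulCLM _ (bddLift G (m u)) (h ξ) :=
    fun u ξ => congrArg (fun D => D ξ) (hBF u).eq
  have hhr : ∀ γ ξ, h (A.rep γ ξ) = A.rep γ (h ξ) := fun γ ξ =>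
    congrArg (fun D => D ξ) (hB γ).eq.symm
  have hmr : ∀ u, A.rep (l u)⁻¹ (mulCLM _ (bddLift G (m u)) δ) =
      mulCLM _ (bddLift G (m u⁻¹)) (A.rep (l u)⁻¹ δ) := by
    intro u
    rw [mulCLM_fibreVec, rep_fibreVec, rep_fibreVec, mulCLM_fibreVec]
    congr 1
    refine Subtype.ext (funext fun y => ?_)
    change (A.χ (l u)⁻¹).1 y * ((F u).indicator 1 (A.τ (A.φ (l u)⁻¹)⁻¹ y) * 1) =
      (F u⁻¹).indicator 1 y * ((A.χ (l u)⁻¹).1 y * 1)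
    rw [map_inv, inv_inv, hl]
    have := w.mem_iff_of_weight ha u y
    by_cases hy : y ∈ F u⁻¹
    · simp [hy, this.2 hy]
    · simp [hy, this]
  have hswap : ⟪v, h x⟫_ℂ = ⟪x', h v⟫_ℂ := by
    simp only [x, x']
    rw [map_sum, inner_sum, sum_inner]
    refine Finset.sum_congr rfl fun u _ => ?_
    rw [hhm, hhr, ← hsymm, hmv, inner_rep_right, hmr, hsymm, hsymm, ← hhm, ← hhm, hmv]
  have hx : x = ∑ u ∈ S, fibreVec ν u (m u * A.χ (l u)) := by
    refine Finset.sum_congr rfl fun u _ => ?_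
    rw [rep_fibreVec, mulCLM_fibreVec, hl, mul_one]
    congr 1
    refine Subtype.ext (funext fun y => ?_)
    change (m u).1 y * ((A.χ (l u)).1 y * 1) = (m u).1 y * (A.χ (l u)).1 y
    rw [mul_one]
  have hx' : x' = ∑ u ∈ S, fibreVec ν u⁻¹ (m u⁻¹ * A.χ (l u)⁻¹) := by
    refine Finset.sum_congr rfl fun u _ => ?_
    rw [rep_fibreVec, mulCLM_fibreVec, map_inv, hl, mul_one]
    congr 1
    refine Subtype.ext (funext fun y => ?_)
    change (m u⁻¹).1 y * ((A.χ (l u)⁻¹).1 y * 1) = (m u⁻¹).1 y * (A.χ (l u)⁻¹).1 y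
    rw [mul_one]
  have hmul_int : ∀ {E : Set Y} (q : Y → ℂ), MeasurableSet E → (∀ y, ‖q y‖ = 1) →
      ∫ y, ⟪E.indicator 1 y * q y, E.indicator 1 y * q y⟫_ℂ ∂ν = ((ν.real E : ℝ) : ℂ) := by
    intro E q hE hq
    have : ∀ y, ⟪E.indicator 1 y * q y, E.indicator 1 y * q y⟫_ℂ =
        ((E.indicator (fun _ => (1 : ℝ)) y : ℝ) : ℂ) := by
      intro y
      rw [inner_self_eq_norm_sq_to_K, norm_mul, hq]
      by_cases hy : y ∈ E <;> simp [hy]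
    simp only [this]
    rw [integral_complex_ofReal, integral_indicator_const _ hE, smul_eq_mul, mul_one]
  have hinv : ∀ f : G → ℝ, ∑ u ∈ S, f u⁻¹ = ∑ u ∈ S, f u := fun f =>
    Finset.sum_nbij' (fun u => u⁻¹) (fun u => u⁻¹) hS hS (fun u _ => inv_inv u)
      (fun u _ => inv_inv u) (fun u _ => rfl)
  have hnv : ‖v‖ ^ 2 = ν.real V := by
    have h1 := inner_self_eq_norm_sq_to_K (𝕜 := ℂ) v
    have h2 := hmul_int 1 hV (by simp)
    rw [inner_fibreVec] at h1
    simp only [Pi.one_apply, mul_one] at h2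
    exact Complex.ofReal_injective (by simpa using h1.symm.trans h2)
  have hnx : ‖x‖ ^ 2 = ∑ u ∈ S, ν.real (F u) := by
    have h1 := inner_self_eq_norm_sq_to_K (𝕜 := ℂ) x
    have h2 : ∑ u ∈ S, ∫ y, ⟪(m u * A.χ (l u)).1 y, (m u * A.χ (l u)).1 y⟫_ℂ ∂ν =
        ((∑ u ∈ S, ν.real (F u) : ℝ) : ℂ) := by
      rw [Complex.ofReal_sum]
      exact Finset.sum_congr rfl fun u _ => hmul_int (A.χ (l u)).1 (hF u) (A.norm_χ (l u))
    have h3 := inner_sum_fibreVec (ν := ν) S Function.injective_id (fun u => m u * A.χ (l u))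
      (fun u => m u * A.χ (l u))
    simp only [id_eq, ← hx] at h3
    exact Complex.ofReal_injective (by simpa using h1.symm.trans (h3.trans h2))
  have hnx' : ‖x'‖ ^ 2 = ∑ u ∈ S, ν.real (F u) := by
    have h1 := inner_self_eq_norm_sq_to_K (𝕜 := ℂ) x'
    have h2 : ∑ u ∈ S, ∫ y, ⟪(m u⁻¹ * A.χ (l u)⁻¹).1 y, (m u⁻¹ * A.χ (l u)⁻¹).1 y⟫_ℂ ∂ν =
        ((∑ u ∈ S, ν.real (F u) : ℝ) : ℂ) := by
      rw [← hinv fun u => ν.real (F u), Complex.ofReal_sum]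
      exact Finset.sum_congr rfl fun u _ => hmul_int (A.χ (l u)⁻¹).1 (hF u⁻¹) (A.norm_χ (l u)⁻¹)
    have h3 := inner_sum_fibreVec (ν := ν) S inv_injective (fun u => m u⁻¹ * A.χ (l u)⁻¹)
      (fun u => m u⁻¹ * A.χ (l u)⁻¹)
    rw [← hx'] at h3
    exact Complex.ofReal_injective (by simpa using h1.symm.trans (h3.trans h2))
  have hvTx : ⟪v, w.op l x⟫_ℂ = ((∑ u ∈ S, ∫ y, w.a 1 u y ∂ν : ℝ) : ℂ) := by
    rw [hx, map_sum, inner_sum, Complex.ofReal_sum]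
    refine Finset.sum_congr rfl fun u hu => ?_
    rw [op_fibreVec, inner_sum, Finset.sum_eq_single u, mul_inv_cancel, inner_fibreVec,
      ← integral_complex_ofReal]
    · refine integral_congr_ae (ae_of_all _ fun y => ?_)
      change ⟪V.indicator 1 y, (w.kernel l u).1 (y, 1) * ((F u).indicator 1 y *
        (A.χ (l u)).1 y)⟫_ℂ = _
      rw [kernel_apply, inv_one, A.τ_one, one_mul]
      by_cases hy : y ∈ F u
      · have h1 := Complex.mul_conj' ((A.χ (l u)).1 y)
        rw [A.norm_χ] at h1
        simp only [Set.indicator_of_mem hy, Set.indicator_of_mem (hFV u hy), Pi.one_apply, one_mul,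
          RCLike.inner_apply, map_one, mul_one]
        rw [mul_assoc, mul_comm (starRingEnd ℂ _), h1]
        simp
      · simp [hy, w.weight_left_eq_zero ha hy]
    · intro u' _ hu'
      refine inner_fibreVec_of_ne ν (fun h1 => hu' ?_) _ _
      exact (mul_inv_eq_one.1 h1.symm).symm
    · exact fun h1 => (h1 hu).elim
  have hxTv : ⟪x', w.op l v⟫_ℂ = ((∑ u ∈ S, ∫ y, w.a u 1 y ∂ν : ℝ) : ℂ) := by
    have h0 : w.op l v = ∑ u ∈ S, fibreVec ν u⁻¹ (bddMeas.comp (w.kernel l u)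
        (fun y => (y, u⁻¹)) measurable_prodMk_right * bddMeas.ind V hV) := by
      rw [op_fibreVec]
      simp only [one_mul]
    rw [hx', h0, inner_sum_fibreVec S inv_injective, ← hinv fun u => ∫ y, w.a u 1 y ∂ν,
      Complex.ofReal_sum]
    refine Finset.sum_congr rfl fun u hu => ?_
    rw [← integral_complex_ofReal]
    refine integral_congr_ae (ae_of_all _ fun y => ?_)
    change ⟪(F u⁻¹).indicator 1 y * (A.χ (l u)⁻¹).1 y, (w.kernel l u).1 (y, u⁻¹) *
      V.indicator 1 y⟫_ℂ = _
    rw [kernel_apply, inv_inv, inv_mul_cancel, A.χ_inv, hl]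
    by_cases hy : y ∈ F u⁻¹
    · have h1 := Complex.mul_conj' ((A.χ (l u)).1 (A.τ u y))
      rw [A.norm_χ] at h1
      simp only [Set.indicator_of_mem hy, Set.indicator_of_mem (hFV _ hy), Pi.one_apply, one_mul,
        RCLike.inner_apply, mul_one, Complex.conj_conj]
      rw [mul_assoc, mul_comm (starRingEnd ℂ _), h1]
      simp
    · simp [hy, w.weight_right_eq_zero ha hy]
  have hadd : ∑ u ∈ S, ∫ y, w.a 1 u y ∂ν + ∑ u ∈ S, ∫ y, w.a u 1 y ∂ν =
      ∑ u ∈ S, ν.real (F u) := by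
    rw [← Finset.sum_add_distrib]
    refine Finset.sum_congr rfl fun u _ => ?_
    rw [← integral_add (w.integrable_weight 1 u) (w.integrable_weight u 1)]
    simp only [ha]
    rw [integral_indicator_one (hF u)]
  have hle := w.sum_integral_weight_le ha hV hFV
  have hdiff : ⟪x', w.op l v⟫_ℂ - ⟪v, w.op l x⟫_ℂ = ⟪x', B v⟫_ℂ - ⟪v, B x⟫_ℂ := by
    rw [hdef, sub_apply, sub_apply, inner_sub_right, inner_sub_right] at hswap
    linear_combination -hswap
  have hnorm : ‖⟪x', w.op l v⟫_ℂ - ⟪v, w.op l x⟫_ℂ‖ ≤ 2 * ‖B‖ * (‖v‖ * ‖x‖) := by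
    have hxx : ‖x'‖ = ‖x‖ := by
      rw [← sq_eq_sq₀ (norm_nonneg _) (norm_nonneg _), hnx, hnx']
    rw [hdiff]
    refine (norm_sub_le _ _).trans ?_
    have h1 : ‖⟪x', B v⟫_ℂ‖ ≤ ‖x‖ * (‖B‖ * ‖v‖) := by
      refine (norm_inner_le_norm _ _).trans ?_
      rw [hxx]
      gcongr
      exact B.le_opNorm v
    have h2 : ‖⟪v, B x⟫_ℂ‖ ≤ ‖v‖ * (‖B‖ * ‖x‖) := by
      refine (norm_inner_le_norm _ _).trans ?_
      gcongr
      exact B.le_opNorm x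
    linarith
  rw [hvTx, hxTv, ← Complex.ofReal_sub, Complex.norm_real, Real.norm_eq_abs] at hnorm
  have hsqrt : ‖v‖ * ‖x‖ = √(ν.real V * ∑ u ∈ S, ν.real (F u)) := by
    rw [← hnv, ← hnx, ← mul_pow, Real.sqrt_sq (by positivity)]
  rw [← hsqrt]
  linarith [le_abs_self (∑ u ∈ S, ∫ y, w.a u 1 y ∂ν - ∑ u ∈ S, ∫ y, w.a 1 u y ∂ν)]

end Energy

end Weight

end TwistedAction

section PercolationAction

theorem measurePreserving_shiftConfig {G : Type*} [Group G] (ε : unitInterval) (x : G) :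
    MeasurePreserving (shiftConfig x) (percMeasure G ε) (percMeasure G ε) := by
  have hm : Measurable (shiftConfig x : (G → Bool) → (G → Bool)) :=
    measurable_pi_lambda _ fun h => measurable_pi_apply _
  refine ⟨hm, ?_⟩
  refine Measure.eq_infinitePi _ fun F t ht => ?_
  classical
  have hpre : shiftConfig x ⁻¹' (Set.pi F t) =
      Set.pi (F.image fun h => x⁻¹ * h) fun g => t (x * g) := by
    ext y
    simp only [shiftConfig, Set.mem_preimage, Set.mem_pi, Finset.mem_coe, Finset.mem_image,
      forall_exists_index, and_imp, forall_apply_eq_imp_iff₂, mul_inv_cancel_left]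
  rw [Measure.map_apply hm (.pi F.countable_toSet fun i _ => ht i), hpre, percMeasure,
    Measure.infinitePi_pi _ fun i _ => ht _, Finset.prod_image fun a _ b _ h => mul_left_cancel h]
  simp

/-- A unimodular cocycle over the action on site configurations which sees the number of open
sites modulo `n` in every coset of `C`. -/
structure PercCocycle (Γ : Type*) {G : Type*} [Group Γ] [Group G] (C : Subgroup G) [Fintype C]
    (n : ℕ) [NeZero n] where
  φ : Γ →* G
  surjective : Function.Surjective φ
  χ : Γ → (G → Bool) → ℂ
  measurable : ∀ γ, Measurable (χ γ)
  norm_χ : ∀ γ y, ‖χ γ y‖ = 1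
  χ_mul : ∀ γ γ' y, χ (γ * γ') y = χ γ y * χ γ' (shiftConfig (φ γ)⁻¹ y)
  exists_ker : ∀ g : G, ∃ γ, φ γ = 1 ∧
    ∀ y, χ γ y = ZMod.toCircle (cosetCount C n y (g : G ⧸ C))

namespace PercCocycle

variable {Γ G : Type*} [Group Γ] [Group G] {C : Subgroup G} [Fintype C] {n : ℕ} [NeZero n]
  (P : PercCocycle Γ C n)

/-- The twisted action on Bernoulli configurations attached to a percolation cocycle. -/
def action (ε : unitInterval) : TwistedAction Γ G (percMeasure G ε) where
  φ := P.φ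
  τ := shiftConfig
  measurePreserving := measurePreserving_shiftConfig ε
  τ_one y := by
    funext h
    simp [shiftConfig]
  τ_mul g h y := by
    funext k
    simp [shiftConfig, mul_assoc]
  χ γ := ⟨P.χ γ, P.measurable γ, 1, fun y => (P.norm_χ γ y).le⟩
  norm_χ := P.norm_χ
  χ_mul := P.χ_mul

theorem sum_toCircle_pow (x : ZMod n) :
    ∑ k ∈ Finset.range n, (ZMod.toCircle x : ℂ) ^ k = if x = 0 then (n : ℂ) else 0 := by
  split_ifs with hx
  · simp [hx]
  · have h1 : (ZMod.toCircle x : ℂ) ^ n = 1 := by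
      rw [← Circle.coe_pow, ← AddChar.map_nsmul_eq_pow]
      simp
    have h2 : (ZMod.toCircle x : ℂ) - 1 ≠ 0 := by
      intro h
      refine hx (ZMod.injective_toCircle ?_)
      rw [AddChar.map_zero_eq_one]
      exact Circle.ext (sub_eq_zero.1 h)
    have h3 := mul_geom_sum (ZMod.toCircle x : ℂ) n
    rw [h1, sub_self] at h3
    exact (mul_eq_zero.1 h3).resolve_left h2

variable [Countable G] [MeasurableSpace G] [DiscreteMeasurableSpace G]

/-- An operator commuting with the representation commutes with the occupation events. -/
theorem commute_occupied (ε : unitInterval)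
    {h : Lp ℂ 2 ((percMeasure G ε).prod (Measure.count : Measure G)) →L[ℂ]
      Lp ℂ 2 ((percMeasure G ε).prod (Measure.count : Measure G))}
    (hh : ∀ γ, Commute ((P.action ε).rep γ) h) (ω : G ⧸ C) :
    ∃ hE : MeasurableSet {z : (G → Bool) × G | Occupied C n z.1 ω},
      Commute h (mulCLM _ (bddMeas.ind {z : (G → Bool) × G | Occupied C n z.1 ω} hE)) := by
  refine ⟨measurable_fst (measurableSet_occupied C n ω), ?_⟩
  induction ω using QuotientGroup.induction_on with | _ g => ?_
  obtain ⟨γ, hγ, hχ⟩ := P.exists_ker g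
  let m : bddMeas ((G → Bool) × G) := bddLift G ((P.action ε).χ γ)
  have hm : Commute h (mulHom ((percMeasure G ε).prod (Measure.count : Measure G)) m) := by
    have h1 : (P.action ε).rep γ = mulCLM _ m := by
      ext1 ξ
      refine Lp.ext ?_
      rw [TwistedAction.rep_apply, mul_apply_eq_comp]
      filter_upwards [coeFn_mulCLM m
        (compCLM ((P.action ε).measurePreserving_left ((P.action ε).φ γ)) ξ), coeFn_compCLM
        ((P.action ε).measurePreserving_left ((P.action ε).φ γ)) ξ, coeFn_mulCLM m ξ]
        with z h1 h2 h3
      rw [h1, h2, h3, show (P.action ε).φ γ = 1 from hγ, inv_one, (P.action ε).τ_one, one_mul]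
    rw [mulHom_apply, ← h1]
    exact (hh γ).symm
  have hind : bddMeas.ind {z : (G → Bool) × G | Occupied C n z.1 g}
      (measurable_fst (measurableSet_occupied C n g)) =
      1 - (n : ℂ)⁻¹ • ∑ k ∈ Finset.range n, m ^ k := by
    refine Subtype.ext (funext fun z => ?_)
    rw [bddMeas.ind_apply, Subalgebra.coe_sub, Subalgebra.coe_smul,
      AddSubmonoidClass.coe_finsetSum, Pi.sub_apply, Pi.smul_apply, Finset.sum_apply]
    have h1 : ∀ k, ((m ^ k : bddMeas ((G → Bool) × G)) : (G → Bool) × G → ℂ) z =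
        (ZMod.toCircle (cosetCount C n z.1 g) : ℂ) ^ k := by
      intro k
      rw [Subalgebra.coe_pow, Pi.pow_apply]
      congr 1
      exact hχ z.1
    simp only [h1]
    rw [sum_toCircle_pow]
    have hn0 : (n : ℂ) ≠ 0 := Nat.cast_ne_zero.2 (NeZero.ne n)
    by_cases hz : cosetCount C n z.1 g = 0
    · simp [Occupied, hz, hn0]
    · simp [Occupied, hz]
  rw [hind, ← mulHom_apply, map_sub, map_one, map_smul, map_sum]
  refine (Commute.one_right h).sub_right (Commute.smul_right (Commute.sum_right _ _ _ ?_) _)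
  intro k _
  rw [map_pow]
  exact hm.pow_right k

omit [NeZero n] [Countable G] [MeasurableSpace G] [DiscreteMeasurableSpace G] in
theorem measurableSet_percGraph_adj {Z : Type*} [MeasurableSpace Z] {f : Z → G → Bool}
    (hf : ∀ ω, MeasurableSet {z | Occupied C n (f z) ω}) (S : Finset G) (s t : G ⧸ C) :
    MeasurableSet {z | (percGraph C n S (f z)).Adj s t} := by
  change MeasurableSet {z | s ≠ t ∧ Occupied C n (f z) s ∧ Occupied C n (f z) t ∧
    (s.out⁻¹ * t.out ∈ S ∨ t.out⁻¹ * s.out ∈ S)}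
  exact (MeasurableSet.const _).inter ((hf s).inter ((hf t).inter (MeasurableSet.const _)))

/-- An operator commuting with the representation commutes with the bridge events. -/
theorem commute_bridge (ε : unitInterval)
    {h : Lp ℂ 2 ((percMeasure G ε).prod (Measure.count : Measure G)) →L[ℂ]
      Lp ℂ 2 ((percMeasure G ε).prod (Measure.count : Measure G))}
    (hh : ∀ γ, Commute ((P.action ε).rep γ) h) (S : Finset G) (s t : G ⧸ C) :
    ∃ hE : MeasurableSet {z : (G → Bool) × G | (percGraph C n S z.1).BridgeAt s t},
      Commute h (mulCLM _ (bddMeas.ind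
        {z : (G → Bool) × G | (percGraph C n S z.1).BridgeAt s t} hE)) := by
  let 𝒞 : Set (Set ((G → Bool) × G)) :=
    Set.range fun ω : G ⧸ C => {z : (G → Bool) × G | Occupied C n z.1 ω}
  have h𝒞 : ∀ E ∈ 𝒞, ∃ hE : MeasurableSet E, Commute h (mulCLM _ (bddMeas.ind E hE)) := by
    rintro _ ⟨ω, rfl⟩
    exact P.commute_occupied ε hh ω
  refine commute_mulCLM_ind_of_generateFrom h h𝒞 ?_
  have hcount : Countable (G ⧸ C) := Quotient.countable
  refine @SimpleGraph.measurableSet_bridgeAt _ hcount _ (MeasurableSpace.generateFrom 𝒞) _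
    (fun s t => ?_) s t
  exact @measurableSet_percGraph_adj _ _ _ _ _ _ (MeasurableSpace.generateFrom 𝒞) _
    (fun ω => MeasurableSpace.measurableSet_generateFrom (Set.mem_range_self ω)) S s t

end PercCocycle

end PercolationAction

open Classical in
theorem SimpleGraph.isParent_add_swap {V : Type*} {e : V → ℕ} (he : Function.Injective e)
    (𝒢 : SimpleGraph V) (s t : V) :
    ((if 𝒢.IsParent e s t then 1 else 0) + (if 𝒢.IsParent e t s then 1 else 0) : ℝ) =
      if 𝒢.BridgeAt s t then 1 else 0 := by
  by_cases h : 𝒢.BridgeAt s t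
  · rcases h.isParent_or (e := e) with h' | h'
    · simp [h, h', h'.not_swap he]
    · simp [h, h', h'.not_swap he]
  · have h1 : ¬ 𝒢.IsParent e s t := fun h' => h h'.1
    have h2 : ¬ 𝒢.IsParent e t s := fun h' => h h'.1.symm
    simp [h, h1, h2]

namespace PercCocycle

variable {Γ G : Type*} [Group Γ] [Group G] {C : Subgroup G} [Fintype C] {n : ℕ} [NeZero n]
  (P : PercCocycle Γ C n)

variable [Countable G] [MeasurableSpace G] [DiscreteMeasurableSpace G]

open Classical in
/-- The weight which records the parent of each vertex in the forest of bridges. -/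
noncomputable def parentWeight (ε : unitInterval) {S : Finset G} (hinv : ∀ s ∈ S, s⁻¹ ∈ S)
    (hC : ∀ s ∈ S, ∀ a ∈ C, ∀ b ∈ C, a * s * b ∈ S) {e : G ⧸ C → ℕ}
    (he : Function.Injective e) : (P.action ε).Weight S (Fintype.card C : ℝ) where
  a s t y := if (percGraph C n S y).IsParent e (s : G ⧸ C) (t : G ⧸ C) then 1 else 0
  measurable s t := by
    have hcount : Countable (G ⧸ C) := Quotient.countable
    exact Measurable.ite (SimpleGraph.measurableSet_isParent (fun s t =>
      measurableSet_percGraph_adj (measurableSet_occupied C n) S s t) e _ _)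
      measurable_const measurable_const
  nonneg s t y := by split_ifs <;> norm_num
  le_one s t y := by split_ifs <;> norm_num
  row y s := by
    rw [Finset.sum_boole, Nat.cast_le]
    rcases Finset.eq_empty_or_nonempty (S.filter fun u =>
      (percGraph C n S y).IsParent e (s : G ⧸ C) ((s * u : G) : G ⧸ C)) with h | ⟨v, hv⟩
    · rw [h, Finset.card_empty]
      exact Nat.zero_le _
    · refine (Finset.card_le_card (t := Finset.univ.image fun a : C => v * (a : G))
        fun u hu => ?_).trans Finset.card_image_le
      have h := (Finset.mem_filter.1 hv).2.unique he (Finset.mem_filter.1 hu).2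
      rw [QuotientGroup.eq] at h
      refine Finset.mem_image.2 ⟨⟨v⁻¹ * u, by simpa [mul_assoc] using h⟩, Finset.mem_univ _, ?_⟩
      exact mul_inv_cancel_left v u
  equivariant x y s t := by
    rw [SimpleGraph.isParent_add_swap he, SimpleGraph.isParent_add_swap he]
    exact if_congr (bridgeAt_shiftConfig hinv hC x y s t) rfl rfl

/-- A group carrying a percolation cocycle over a finitely generated nonamenable group is not
unitarizable. -/
theorem not_isUnitarizableGroup {Γ G : Type} [Group Γ] [Group G] [Countable G] [Group.FG G]
    {C : Subgroup G} [Fintype C] {n : ℕ} [NeZero n]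
    (hG : ¬ IsAmenable G) (hn : 2 ≤ n) (P : PercCocycle Γ C n) : ¬ IsUnitarizableGroup Γ := by
  intro hΓ
  let mG : MeasurableSpace G := ⊤
  have dG : DiscreteMeasurableSpace G := ⟨fun _ => trivial⟩
  have hcount : Countable (G ⧸ C) := Quotient.countable
  obtain ⟨e, he⟩ := Countable.exists_injective_nat (G ⧸ C)
  choose S hinv hSC ε hε hlow using fun j : ℕ =>
    exists_percolation_bridge (C := C) hG hn (j + 1) (Nat.le_add_left 1 j)
  choose l hl using P.surjective
  let w := fun j => P.parentWeight (ε j) (hinv j) (hSC j) he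
  have hc0 : (0 : ℝ) ≤ Fintype.card C := Nat.cast_nonneg _
  obtain ⟨K, hK⟩ := hΓ.exists_uniform_commute (fun j => (P.action (ε j)).rep)
    (fun j => (P.action (ε j)).norm_rep_le) (fun j => (w j).op l) (2 * (Fintype.card C : ℝ))
    (fun j => (w j).norm_rep_mul_op_sub_le l hc0 (hinv j))
  have hmain : ∀ j : ℕ, ((j : ℝ) + 1) / 8 ≤
      (4 * (Fintype.card C : ℝ) + 4 * K ^ 2) * Fintype.card C := by
    intro j
    obtain ⟨B, hBK, hB⟩ := hK j
    let μ := percMeasure G (ε j)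
    let F : G → Set (G → Bool) := fun u =>
      {y | (percGraph C n (S j) y).BridgeAt ((1 : G) : G ⧸ C) (u : G ⧸ C)}
    let V : Set (G → Bool) := {y | Occupied C n y ((1 : G) : G ⧸ C)}
    have hF : ∀ u, MeasurableSet (F u) := fun u => SimpleGraph.measurableSet_bridgeAt (fun s t =>
      measurableSet_percGraph_adj (measurableSet_occupied C n) (S j) s t) _ _
    have hV : MeasurableSet V := measurableSet_occupied C n _
    have hFV : ∀ u, F u ⊆ V := fun u y hy => hy.1.2.1
    have henergy := (w j).energy_le (F := F) hl (fun u y => by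
      classical
      refine (SimpleGraph.isParent_add_swap he _ _ _).trans ?_
      rw [Set.indicator_apply]
      rfl) hF (hinv j) hV hFV B hB (fun u => by
      obtain ⟨hE, h⟩ := P.commute_bridge (ε j) hB (S j) ((1 : G) : G ⧸ C) (u : G ⧸ C)
      exact h)
    have hv : μ.real V ≤ Fintype.card C * ε j := by
      have h := percMeasure_occupied_le (C := C) (n := n) (ε j) {((1 : G) : G ⧸ C)}
      rw [Finset.card_singleton, pow_one] at h
      refine ENNReal.toReal_le_of_le_ofReal (mul_nonneg hc0 (ε j).2.1) ?_
      simpa using h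
    have hE := hlow j
    change _ ≤ ∑ u ∈ S j, μ.real (F u) at hE
    change ∑ u ∈ S j, μ.real (F u) ≤ _ at henergy
    change _ ≤ 2 * (_ * μ.real V) + 2 * ‖B‖ * √(μ.real V * ∑ u ∈ S j, μ.real (F u)) at henergy
    set E := ∑ u ∈ S j, μ.real (F u)
    set v := μ.real V
    have hv0 : 0 ≤ v := measureReal_nonneg
    have hE0 : 0 ≤ E := Finset.sum_nonneg fun _ _ => measureReal_nonneg
    have hK0 : 0 ≤ K := (norm_nonneg B).trans hBK
    have hsqrt : √(v * E) ^ 2 = v * E := Real.sq_sqrt (mul_nonneg hv0 hE0)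
    have hEv : E ≤ (4 * (Fintype.card C : ℝ) + 4 * K ^ 2) * v := by
      have h1 : 2 * ‖B‖ * √(v * E) ≤ 2 * K * √(v * E) := by gcongr
      have h2 : 2 * K * √(v * E) ≤ E / 2 + 2 * K ^ 2 * v := by
        refine abs_le_of_sq_le_sq' ?_ (by positivity) |>.2
        nlinarith [sq_nonneg (E / 2 - 2 * K ^ 2 * v)]
      linarith
    have h3 : (ε j : ℝ) * (((j : ℝ) + 1) / 8) ≤
        ε j * ((4 * (Fintype.card C : ℝ) + 4 * K ^ 2) * Fintype.card C) := by
      have h4 := hEv.trans (mul_le_mul_of_nonneg_left hv (by positivity))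
      push_cast at hE
      linarith
    exact le_of_mul_le_mul_left h3 (hε j)
  obtain ⟨j, hj⟩ := exists_nat_gt (8 * ((4 * (Fintype.card C : ℝ) + 4 * K ^ 2) * Fintype.card C))
  linarith [hmain j]

end PercCocycle

namespace Burnside

variable {m k : ℕ}

/-- The standard generators of the free Burnside group. -/
def gen (i : Fin m) : Burnside m k := QuotientGroup.mk (FreeGroup.of i)

theorem pow_eq_one (g : Burnside m k) : g ^ k = 1 := by
  induction g using QuotientGroup.induction_on with | _ v => ?_
  rw [← QuotientGroup.mk_pow, QuotientGroup.eq_one_iff]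
  exact Subgroup.subset_normalClosure ⟨v, rfl⟩

/-- The homomorphism out of the free Burnside group determined by the images of the generators. -/
def lift {W : Type*} [Group W] (f : Fin m → W) (hW : ∀ w : W, w ^ k = 1) : Burnside m k →* W :=
  QuotientGroup.lift _ (FreeGroup.lift f) (by
    refine Subgroup.normalClosure_le_normal ?_
    rintro _ ⟨v, rfl⟩
    simp [hW])

theorem lift_gen {W : Type*} [Group W] (f : Fin m → W) (hW : ∀ w : W, w ^ k = 1) (i : Fin m) :
    lift f hW (gen i) = f i := by
  simp [lift, gen]

theorem closure_gen : Subgroup.closure (Set.range (gen : Fin m → Burnside m k)) = ⊤ := by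
  have h := congrArg (Subgroup.map (QuotientGroup.mk' (Subgroup.normalClosure
    {w : FreeGroup (Fin m) | ∃ v : FreeGroup (Fin m), w = v ^ k})))
    (FreeGroup.closure_range_of (Fin m))
  rw [MonoidHom.map_closure, ← Set.range_comp] at h
  rw [show (gen : Fin m → Burnside m k) = QuotientGroup.mk' _ ∘ FreeGroup.of from rfl, h]
  exact Subgroup.map_top_of_surjective _ (QuotientGroup.mk'_surjective _)

instance : Group.FG (Burnside m k) := QuotientGroup.fg _

instance : Countable (Burnside m k) := Quotient.countable

end Burnside

/-- The lamplighter group with lamps in `R`, that is, the restricted wreath product `R ≀ G`. -/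
@[ext]
structure LampGroup (R G : Type*) [AddCommGroup R] where
  lamps : G →₀ R
  position : G

namespace LampGroup

variable {R G : Type*} [AddCommGroup R] [Group G]

/-- The translate of a finitely supported function by a group element. -/
noncomputable def shift (g : G) : (G →₀ R) →+ (G →₀ R) :=
  (Finsupp.domCongr (Equiv.mulLeft g)).toAddMonoidHom

@[simp]
theorem shift_apply (g : G) (u : G →₀ R) (s : G) : shift g u s = u (g⁻¹ * s) := rfl

noncomputable instance : Group (LampGroup R G) where
  mul w w' := ⟨w.lamps + shift w.position w'.lamps, w.position * w'.position⟩
  one := ⟨0, 1⟩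
  inv w := ⟨-shift w.position⁻¹ w.lamps, w.position⁻¹⟩
  mul_assoc a b c := by
    refine LampGroup.ext ?_ (mul_assoc _ _ _)
    ext s
    change (a.lamps s + b.lamps (a.position⁻¹ * s)) + c.lamps ((a.position * b.position)⁻¹ * s) =
      a.lamps s + (b.lamps (a.position⁻¹ * s) + c.lamps (b.position⁻¹ * (a.position⁻¹ * s)))
    rw [mul_inv_rev, add_assoc, mul_assoc]
  one_mul a := by
    refine LampGroup.ext ?_ (one_mul _)
    ext s
    change (0 : R) + a.lamps (1⁻¹ * s) = a.lamps s
    simp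
  mul_one a := by
    refine LampGroup.ext ?_ (mul_one _)
    ext s
    change a.lamps s + (0 : R) = a.lamps s
    simp
  inv_mul_cancel a := by
    refine LampGroup.ext ?_ (inv_mul_cancel _)
    ext s
    change -(a.lamps (a.position⁻¹⁻¹ * s)) + a.lamps (a.position⁻¹⁻¹ * s) = (0 : R)
    simp

theorem one_lamps : (1 : LampGroup R G).lamps = 0 := rfl

theorem mul_lamps (w w' : LampGroup R G) :
    (w * w').lamps = w.lamps + shift w.position w'.lamps := rfl

/-- The projection of the lamplighter group onto the base. -/
def toBase : LampGroup R G →* G where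
  toFun := position
  map_one' := rfl
  map_mul' _ _ := rfl

theorem pow_lamps_of_position_eq_one {w : LampGroup R G} (h : w.position = 1) (n : ℕ) :
    (w ^ n).lamps = n • w.lamps := by
  induction n with
  | zero => simp [one_lamps]
  | succ n ih =>
    have h1 : (w ^ n).position = 1 := by
      change toBase (w ^ n) = 1
      rw [map_pow, show toBase w = 1 from h, one_pow]
    rw [pow_succ, mul_lamps, ih, h1, succ_nsmul]
    congr 1
    ext s
    simp

theorem pow_mul_eq_one {n p : ℕ} (hG : ∀ g : G, g ^ p = 1) (w : LampGroup (ZMod n) G) :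
    w ^ (n * p) = 1 := by
  have h : (w ^ p).position = 1 := (map_pow toBase w p).trans (hG _)
  rw [mul_comm, pow_mul]
  refine LampGroup.ext ?_ ?_
  · rw [pow_lamps_of_position_eq_one h, one_lamps]
    ext s
    simp
  · change toBase ((w ^ p) ^ n) = 1
    rw [map_pow, show toBase (w ^ p) = 1 from h, one_pow]

variable {Γ : Type*} [Group Γ] {n : ℕ}

theorem conj_lamps {R : Type*} [AddCommGroup R] (w : LampGroup R G) {v : LampGroup R G}
    (hv : v.position = 1) : (w * v * w⁻¹).lamps = shift w.position v.lamps := by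
  ext s
  change (w.lamps s + v.lamps (w.position⁻¹ * s)) +
    -(w.lamps (w.position⁻¹⁻¹ * ((w.position * v.position)⁻¹ * s))) = v.lamps (w.position⁻¹ * s)
  simp [hv]

/-- The sum of the lamps over the open sites of a configuration. -/
noncomputable def lampSum (y : G → Bool) : (G →₀ ZMod n) →+ ZMod n :=
  Finsupp.liftAddHom fun s => if y s then AddMonoidHom.id (ZMod n) else 0

omit [Group G] in
theorem lampSum_apply (y : G → Bool) (u : G →₀ ZMod n) :
    lampSum y u = ∑ s ∈ u.support, if y s then u s else 0 := by
  rw [lampSum, Finsupp.liftAddHom_apply, Finsupp.sum]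
  refine Finset.sum_congr rfl fun s _ => ?_
  split_ifs <;> rfl

omit [Group G] in
theorem lampSum_single (y : G → Bool) (s : G) (r : ZMod n) :
    lampSum y (Finsupp.single s r) = if y s then r else 0 := by
  rw [lampSum, Finsupp.liftAddHom_apply_single]
  split_ifs <;> rfl

theorem shift_single {R : Type*} [AddCommGroup R] (g s : G) (r : R) :
    shift g (Finsupp.single s r) = Finsupp.single (g * s) r :=
  Finsupp.equivMapDomain_single _ _ _

theorem lampSum_shift (y : G → Bool) (g : G) (u : G →₀ ZMod n) :
    lampSum y (shift g u) = lampSum (shiftConfig g⁻¹ y) u := by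
  have h : (lampSum y).comp (shift g) = lampSum (n := n) (shiftConfig g⁻¹ y) := by
    refine Finsupp.addHom_ext fun s r => ?_
    rw [AddMonoidHom.comp_apply, shift_single, lampSum_single, lampSum_single, shiftConfig, inv_inv]
  exact DFunLike.congr_fun h u

omit [Group G] in
theorem measurable_toCircle_lampSum [NeZero n] (u : G →₀ ZMod n) :
    Measurable fun y : G → Bool => (ZMod.toCircle (lampSum y u) : ℂ) := by
  have h : (fun y : G → Bool => (ZMod.toCircle (lampSum y u) : ℂ)) = fun y =>
      ∏ s ∈ u.support, (ZMod.toCircle (if y s then u s else 0) : ℂ) := by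
    funext y
    rw [lampSum_apply]
    exact map_prod (Circle.coeHom.comp ZMod.toCircle.toMonoidHom)
      (fun s => Multiplicative.ofAdd (if y s then u s else 0)) u.support
  rw [h]
  exact Finset.measurable_prod _ fun s _ =>
    (measurable_of_finite fun b : Bool => (ZMod.toCircle (if b then u s else 0) : ℂ)).comp
      (measurable_pi_apply s)

theorem pow_lamps {R : Type*} [AddCommGroup R] (r : R) (a : G) (c : ℕ) :
    ((⟨Finsupp.single 1 r, a⟩ : LampGroup R G) ^ c).lamps =
      ∑ i ∈ Finset.range c, Finsupp.single (a ^ i) r := by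
  induction c with
  | zero => rfl
  | succ c ih =>
    rw [pow_succ, mul_lamps, ih, Finset.sum_range_succ, shift_single, mul_one,
      show ((⟨Finsupp.single 1 r, a⟩ : LampGroup R G) ^ c).position = a ^ c from map_pow toBase _ c]

/-- The percolation cocycle of a homomorphism to a lamplighter group over a base with a torsion
element, whose image contains the product of that element with a lamp at the origin. -/
noncomputable def percCocycle [NeZero n] (θ : Γ →* LampGroup (ZMod n) G)
    (hθ : Function.Surjective (toBase.comp θ)) {a : G} [Fintype (Subgroup.zpowers a)] {α : Γ}
    (hα : θ α = ⟨Finsupp.single 1 1, a⟩) (ha : IsOfFinOrder a) :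
    PercCocycle Γ (Subgroup.zpowers a) n where
  φ := toBase.comp θ
  surjective := hθ
  χ γ y := ZMod.toCircle (lampSum y (θ γ).lamps)
  measurable γ := measurable_toCircle_lampSum _
  norm_χ γ y := Circle.norm_coe _
  χ_mul γ γ' y := by
    rw [map_mul, mul_lamps, map_add, AddChar.map_add_eq_mul, lampSum_shift, Circle.coe_mul]
    rfl
  exists_ker g := by
    obtain ⟨t, ht⟩ := hθ g
    have hpos : (θ (α ^ orderOf a)).position = 1 := by
      change toBase (θ (α ^ orderOf a)) = 1
      rw [map_pow, map_pow, hα]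
      exact pow_orderOf_eq_one a
    refine ⟨t * α ^ orderOf a * t⁻¹, ?_, fun y => ?_⟩
    · rw [map_mul, map_mul, show (toBase.comp θ) (α ^ orderOf a) = 1 from hpos, mul_one, map_inv,
        mul_inv_cancel]
    · rw [map_mul, map_mul, map_inv, conj_lamps _ hpos, map_pow, hα, pow_lamps, map_sum, map_sum,
        cosetCount_mk, Finset.sum_range]
      congr 2
      refine Fintype.sum_equiv (finEquivZPowers ha) _ _ fun i => ?_
      rw [shift_single, lampSum_single, show (θ t).position = g from ht, finEquivZPowers_apply]

end LampGroup

/-- **Monod–Ozawa.**  If the free Burnside group `B(2,p)` is not amenable, then for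
every integer `n ≥ 2` the free Burnside group `B(2,np)` is not unitarizable. -/
theorem statement18 (p : ℕ) (hp : 0 < p) (hpa : ¬ IsAmenable (Burnside 2 p)) :
    ∀ n : ℕ, 2 ≤ n → ¬ IsUnitarizableGroup (Burnside 2 (n * p)) := by
  intro n hn
  have hn0 : NeZero n := ⟨by omega⟩
  let θ : Burnside 2 (n * p) →* LampGroup (ZMod n) (Burnside 2 p) :=
    Burnside.lift (fun i => ⟨if i = 0 then Finsupp.single 1 1 else 0, Burnside.gen i⟩)
      (LampGroup.pow_mul_eq_one Burnside.pow_eq_one)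
  have hθg : ∀ i, θ (Burnside.gen i) =
      ⟨if i = 0 then Finsupp.single 1 1 else 0, Burnside.gen i⟩ := Burnside.lift_gen _ _
  have hθ : Function.Surjective (LampGroup.toBase.comp θ) := by
    rw [← MonoidHom.range_eq_top, eq_top_iff, ← Burnside.closure_gen, Subgroup.closure_le]
    rintro _ ⟨i, rfl⟩
    exact ⟨Burnside.gen i, congrArg LampGroup.toBase (hθg i)⟩
  have ha : IsOfFinOrder (Burnside.gen 0 : Burnside 2 p) :=
    isOfFinOrder_iff_pow_eq_one.2 ⟨p, hp, Burnside.pow_eq_one _⟩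
  have hfin : Finite (Subgroup.zpowers (Burnside.gen 0 : Burnside 2 p)) := ha.finite_zpowers
  let hC : Fintype (Subgroup.zpowers (Burnside.gen 0 : Burnside 2 p)) := Fintype.ofFinite _
  exact (LampGroup.percCocycle θ hθ (α := Burnside.gen 0) (by simpa using hθg 0)
    ha).not_isUnitarizableGroup hpa hn
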